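/- arXiv:1908.07383 — 2 statements merged into one kernel-verified Lean document; each statement's English description precedes it below -/
import Mathlib

section
/- Let f be a transcendental self-map of ℂ* and let e ∈ {0,∞}^ℕ. Then the set I_e(f) ∪ {0,∞}, regarded as a subset of the Riemann sphere ℂ̂ = ℂ ∪ {∞}, is either connected or it has exactly two connected components, one containing 0 and the other containing ∞. -/
open Complex Topology Filter Set Function OnePoint

noncomputable section

/-- The chordal (spherical) distance on the Riemann sphere, restricted to finite points. -/
def chordalDist (z w : ℂ) : ℝ :=
  ‖z - w‖ / Real.sqrt ((1 + ‖z‖ ^ 2) * (1 + ‖w‖ ^ 2))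

/-- A transcendental self-map of `ℂ* = ℂ \ {0}`: a holomorphic self-map of the punctured
plane with essential singularities at `0` and `∞`; equivalently, on `ℂ*` it has the form
`z ^ m * exp (g z + h z⁻¹)` for some `m : ℤ` and nonconstant entire functions `g, h`. -/
def IsTranscendentalSelfMapCStar (f : ℂ → ℂ) : Prop :=
  ∃ (m : ℤ) (g h : ℂ → ℂ),
    Differentiable ℂ g ∧ Differentiable ℂ h ∧
    (¬ ∃ c : ℂ, ∀ z, g z = c) ∧ (¬ ∃ c : ℂ, ∀ z, h z = c) ∧
    ∀ z : ℂ, z ≠ 0 → f z = z ^ m * Complex.exp (g z + h z⁻¹)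

/-- The escaping set `I(f)` of a self-map of the punctured plane: points whose orbit
accumulates only at `0` and `∞`. -/
def escapingSet (f : ℂ → ℂ) : Set ℂ :=
  {z | z ≠ 0 ∧ ∀ ε : ℝ, 0 < ε → ∃ N : ℕ, ∀ n ≥ N,
    ‖f^[n] z‖ < ε ∨ 1 / ε < ‖f^[n] z‖}

/-- The little escaping set `I_e(f)` with essential itinerary `e` (where `true` stands for the
symbol `∞` and `false` for the symbol `0`). -/
def littleEscapingSet (f : ℂ → ℂ) (e : ℕ → Bool) : Set ℂ :=
  {z | z ∈ escapingSet f ∧ ∃ ℓ k : ℕ, ∀ n : ℕ,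
    (1 < ‖f^[n + ℓ] z‖ ↔ e (n + k) = true)}

/-- The immediate little escaping set `Ĩ_e(f)`. -/
def immediateLittleEscapingSet (f : ℂ → ℂ) (e : ℕ → Bool) : Set ℂ :=
  {z | z ∈ escapingSet f ∧ ∃ ℓ : ℕ, ∀ n : ℕ,
    (1 < ‖f^[n + ℓ] z‖ ↔ e (n + ℓ) = true)}

/-- The Fatou set of a self-map of the punctured plane: points of `ℂ*` with a neighbourhood
(inside `ℂ*`) on which the family of iterates is equicontinuous w.r.t. the chordal metric. -/
def FatouSet (f : ℂ → ℂ) : Set ℂ :=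
  {z | z ≠ 0 ∧ ∃ U : Set ℂ, IsOpen U ∧ z ∈ U ∧ (∀ w ∈ U, w ≠ 0) ∧
    ∀ w ∈ U, ∀ ε : ℝ, 0 < ε → ∃ δ : ℝ, 0 < δ ∧ ∀ w' ∈ U,
      chordalDist w w' < δ → ∀ n : ℕ, chordalDist (f^[n] w) (f^[n] w') < ε}

/-- The Julia set `J(f) = ℂ* \ F(f)`. -/
def JuliaSet (f : ℂ → ℂ) : Set ℂ := {z : ℂ | z ≠ 0} \ FatouSet f

/-- A Fatou component: a connected component of the Fatou set. -/
def IsFatouComponent (f : ℂ → ℂ) (U : Set ℂ) : Prop :=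
  ∃ z ∈ FatouSet f, U = connectedComponentIn (FatouSet f) z

/-- A wandering domain: a Fatou component `U` such that the Fatou components containing the
iterated images `fⁿ(U)` are pairwise distinct. -/
def IsWanderingDomain (f : ℂ → ℂ) (U : Set ℂ) : Prop :=
  IsFatouComponent f U ∧ ∃ V : ℕ → Set ℂ, V 0 = U ∧
    (∀ n, IsFatouComponent f (V n)) ∧
    (∀ n, f '' V n ⊆ V (n + 1)) ∧ Function.Injective V

/-- A set is bounded in `ℂ*` if it lies in some closed annulus `{r ≤ |z| ≤ R}`. -/
def BoundedInCStar (X : Set ℂ) : Prop :=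
  ∃ r R : ℝ, 0 < r ∧ r ≤ R ∧ X ⊆ {z : ℂ | r ≤ ‖z‖ ∧ ‖z‖ ≤ R}

/-- The boundary of a subset of `ℂ*` taken in `ℂ*`. -/
def boundaryInCStar (G : Set ℂ) : Set ℂ := frontier G \ {0}

/-- The set `I(f) ∪ {0, ∞}` regarded as a subset of the Riemann sphere `ℂ̂ = ℂ ∪ {∞}`. -/
def escapingSphere (f : ℂ → ℂ) : Set (OnePoint ℂ) :=
  ((fun z : ℂ => (z : OnePoint ℂ)) '' escapingSet f) ∪ {((0 : ℂ) : OnePoint ℂ), ∞}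

/-- The set `I_e(f) ∪ {0, ∞}` regarded as a subset of the Riemann sphere. -/
def littleEscapingSphere (f : ℂ → ℂ) (e : ℕ → Bool) : Set (OnePoint ℂ) :=
  ((fun z : ℂ => (z : OnePoint ℂ)) '' littleEscapingSet f e) ∪ {((0 : ℂ) : OnePoint ℂ), ∞}

/-- A subset of the sphere has exactly two connected components. -/
def HasExactlyTwoComponents (K : Set (OnePoint ℂ)) : Prop :=
  ∃ x ∈ K, ∃ y ∈ K, connectedComponentIn K x ≠ connectedComponentIn K y ∧
    ∀ z ∈ K, connectedComponentIn K z = connectedComponentIn K x ∨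
      connectedComponentIn K z = connectedComponentIn K y

/-- A domain `U ⊆ ℂ*` is doubly connected if its complement in the Riemann sphere has
exactly two connected components. -/
def DoublyConnected (U : Set ℂ) : Prop :=
  HasExactlyTwoComponents (((fun z : ℂ => (z : OnePoint ℂ)) '' U)ᶜ)

/-- A transcendental entire function. -/
def IsTranscendentalEntire (f : ℂ → ℂ) : Prop :=
  Differentiable ℂ f ∧ ¬ ∃ p : Polynomial ℂ, ∀ z, f z = p.eval z

/-- The Fatou set of an entire function. -/
def FatouSetEntire (f : ℂ → ℂ) : Set ℂ :=
  {z | ∃ U : Set ℂ, IsOpen U ∧ z ∈ U ∧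
    ∀ w ∈ U, ∀ ε : ℝ, 0 < ε → ∃ δ : ℝ, 0 < δ ∧ ∀ w' ∈ U,
      chordalDist w w' < δ → ∀ n : ℕ, chordalDist (f^[n] w) (f^[n] w') < ε}

/-- The Julia set of an entire function. -/
def JuliaSetEntire (f : ℂ → ℂ) : Set ℂ := (FatouSetEntire f)ᶜ

/-- `f` has a finite asymptotic value. -/
def HasFiniteAsymptoticValue (f : ℂ → ℂ) : Prop :=
  ∃ (a : ℂ) (γ : ℝ → ℂ), ContinuousOn γ (Set.Ici (0 : ℝ)) ∧
    Tendsto (fun t => ‖γ t‖) atTop atTop ∧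
    Tendsto (fun t => f (γ t)) atTop (nhds a)

section

open Metric
open scoped Real

/-- Quantitative covering: a holomorphic function with large derivative at the centre of a disc,
and controlled oscillation on the disc, covers a disc of definite size. -/
theorem ball_subset_image_ball_of_norm_sub_le {H : ℂ → ℂ} {z : ℂ} {ρ Λ : ℝ} (hρ : 0 < ρ)
    (hΛ : 0 < Λ) (hd : DifferentiableOn ℂ H (ball z ρ))
    (hb : ∀ w ∈ ball z ρ, ‖H w - H z‖ ≤ Λ) :
    ball (H z) (‖deriv H z‖ ^ 2 * ρ ^ 2 / (16 * Λ)) ⊆ H '' ball z ρ := by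
  rcases eq_or_ne (deriv H z) 0 with h0 | h0
  · simp [h0]
  have hpos : 0 < ‖deriv H z‖ := norm_pos_iff.2 h0
  have hmaps : MapsTo H (ball z ρ) (closedBall (H z) Λ) := fun w hw => by
    rw [mem_closedBall, dist_eq_norm]; exact hb w hw
  have hq : ∀ w ∈ ball z ρ, ‖dslope H z w‖ ≤ Λ / ρ := fun w hw =>
    norm_dslope_le_div_of_mapsTo_ball hd hmaps hw
  have hder : ‖deriv H z‖ ≤ Λ / ρ := norm_deriv_le_div_of_mapsTo_ball hd hmaps hρ
  have hqd : DifferentiableOn ℂ (dslope H z) (ball z ρ) :=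
    (differentiableOn_dslope (ball_mem_nhds z hρ)).2 hd
  have hqmaps : MapsTo (dslope H z) (ball z ρ) (closedBall (dslope H z z) (2 * (Λ / ρ))) := by
    intro w hw
    rw [mem_closedBall, dist_eq_norm]
    refine (norm_sub_le _ _).trans ?_
    have := hq w hw
    have := hq z (mem_ball_self hρ)
    linarith
  set t : ℝ := ‖deriv H z‖ * ρ ^ 2 / (4 * Λ) with ht
  have htpos : 0 < t := by positivity
  have htρ : t < ρ := by
    rw [ht, div_lt_iff₀ (by positivity)]
    rw [le_div_iff₀ hρ] at hder
    nlinarith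
  have hsub : closedBall z t ⊆ ball z ρ := closedBall_subset_ball htρ
  have hdc : DiffContOnCl ℂ H (ball z t) := by
    apply DifferentiableOn.diffContOnCl
    rw [closure_ball _ htpos.ne']
    exact hd.mono hsub
  have hsph : ∀ w ∈ sphere z t, ‖deriv H z‖ ^ 2 * ρ ^ 2 / (8 * Λ) ≤ ‖H w - H z‖ := by
    intro w hw
    have hwz : ‖w - z‖ = t := by rw [← dist_eq_norm]; exact hw
    have h1 := dist_le_div_mul_dist_of_mapsTo_ball hqd hqmaps (hsub (sphere_subset_closedBall hw))
    rw [dist_eq_norm, dist_eq_norm, hwz, dslope_same] at h1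
    have h2 : ‖deriv H z‖ - 2 * (Λ / ρ) / ρ * t ≤ ‖dslope H z w‖ := by
      have := norm_sub_norm_le (deriv H z) (dslope H z w)
      rw [norm_sub_rev] at this
      linarith
    have h3 : H w - H z = (w - z) • dslope H z w := (sub_smul_dslope H z w).symm
    rw [h3, norm_smul, hwz]
    have h4 : ‖deriv H z‖ - 2 * (Λ / ρ) / ρ * t = ‖deriv H z‖ / 2 := by
      rw [ht]; field_simp; ring
    rw [h4] at h2
    calc _ = t * (‖deriv H z‖ / 2) := by rw [ht]; ring
      _ ≤ _ := by gcongr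
  have hfreq : ∃ᶠ w in 𝓝 z, H w ≠ H z := by
    intro hcon
    have : H =ᶠ[𝓝 z] fun _ => H z := by
      filter_upwards [hcon] with w hw
      simpa using hw
    exact h0 (by rw [this.deriv_eq]; simp)
  have := hdc.ball_subset_image_closedBall htpos hsph hfreq
  have he : ‖deriv H z‖ ^ 2 * ρ ^ 2 / (8 * Λ) / 2 = ‖deriv H z‖ ^ 2 * ρ ^ 2 / (16 * Λ) := by ring
  rw [he] at this
  exact this.trans (image_mono hsub)

/-- **Bloch's theorem**, with a non-optimal constant. -/
theorem exists_ball_subset_image_closedBall {F : ℂ → ℂ} {U : Set ℂ} {z : ℂ} {s : ℝ} (hs : 0 < s)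
    (hU : IsOpen U) (hd : DifferentiableOn ℂ F U) (hsU : closedBall z s ⊆ U) :
    ∃ w ∈ closedBall z s, ball (F w) (s * ‖deriv F z‖ / 64) ⊆ F '' closedBall z s := by
  rcases eq_or_ne (deriv F z) 0 with h0 | h0
  · exact ⟨z, mem_closedBall_self hs.le, by simp [h0]⟩
  have hdc : ContinuousOn (deriv F) (closedBall z s) :=
    ((hd.deriv hU).continuousOn).mono hsU
  obtain ⟨ζ, hζ, hmax⟩ := (isCompact_closedBall z s).exists_isMaxOn
    ⟨z, mem_closedBall_self hs.le⟩
    (f := fun ζ => ‖deriv F ζ‖ * (s - dist ζ z))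
    (hdc.norm.mul (by fun_prop))
  set V := ‖deriv F ζ‖ * (s - dist ζ z) with hV
  have hVz : s * ‖deriv F z‖ ≤ V := by
    have := hmax (mem_closedBall_self hs.le : z ∈ closedBall z s)
    simp only [mem_ofPred_eq, dist_self, sub_zero] at this
    linarith
  have hVpos : 0 < V := lt_of_lt_of_le (mul_pos hs (norm_pos_iff.2 h0)) hVz
  set d := s - dist ζ z with hd'
  have hdpos : 0 < d := by
    by_contra! h
    have := mul_nonpos_of_nonneg_of_nonpos (norm_nonneg (deriv F ζ)) h
    linarith
  have hsub : ball ζ (d / 2) ⊆ closedBall z s := by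
    intro w hw
    rw [mem_ball] at hw
    rw [mem_closedBall]
    have := dist_triangle w ζ z
    linarith
  have hder : ∀ w ∈ ball ζ (d / 2), ‖deriv F w‖ ≤ 2 * ‖deriv F ζ‖ := by
    intro w hw
    have h1 : ‖deriv F w‖ * (s - dist w z) ≤ V := hmax (hsub hw)
    rw [mem_ball] at hw
    have := dist_triangle w ζ z
    have h2 : d / 2 ≤ s - dist w z := by linarith
    have h3 : ‖deriv F w‖ * (d / 2) ≤ ‖deriv F ζ‖ * d :=
      (mul_le_mul_of_nonneg_left h2 (norm_nonneg _)).trans h1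
    by_contra! h
    nlinarith
  have hosc : ∀ w ∈ ball ζ (d / 2), ‖F w - F ζ‖ ≤ V := by
    intro w hw
    have := (convex_ball ζ (d / 2)).norm_image_sub_le_of_norm_deriv_le (f := F)
      (fun x hx => hd.differentiableAt (hU.mem_nhds (hsU (hsub hx)))) hder
      (mem_ball_self (by positivity)) hw
    rw [mem_ball, dist_eq_norm] at hw
    calc _ ≤ 2 * ‖deriv F ζ‖ * ‖w - ζ‖ := this
      _ ≤ 2 * ‖deriv F ζ‖ * (d / 2) := by gcongr
      _ = V := by rw [hV]; ring
  have := ball_subset_image_ball_of_norm_sub_le (by positivity) hVpos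
    (hd.mono (hsub.trans hsU)) hosc
  refine ⟨ζ, hζ, (ball_subset_ball ?_).trans (this.trans (image_mono hsub))⟩
  have : ‖deriv F ζ‖ ^ 2 * (d / 2) ^ 2 / (16 * V) = V / 64 := by
    have : V ^ 2 = ‖deriv F ζ‖ ^ 2 * d ^ 2 := by rw [hV]; ring
    field_simp
    linarith
  rw [this]
  linarith

/-- A convex function with superlinear growth does not grow too fast from suitable points
on, compared to its left slope there. -/
theorem ConvexOn.exists_le_add_of_superlinear {Φ : ℝ → ℝ} (hc : ConvexOn ℝ univ Φ)
    (hs : ∀ A : ℝ, ∃ R : ℝ, ∀ r ≥ R, A * r ≤ Φ r) {K : ℝ} (hK : 0 < K) :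
    ∃ c₀ : ℝ, ∀ c ≥ c₀, c ≤ Φ c ∧ ∃ x a : ℝ, c + 5 / 4 ≤ x ∧ x ≤ c + 3 / 2 ∧ 8 * K ≤ a ∧
      Φ c + 1 ≤ Φ x ∧ (∃ δ > 0, ∀ y ∈ Ioo (x - δ) x, a * (x - y) ≤ Φ x - Φ y) ∧
      Φ (x + K / a) ≤ Φ x + 4 * K := by
  obtain ⟨A, hA1, hA⟩ : ∃ A : ℝ, 1 ≤ A ∧ 8 * K ≤ A :=
    ⟨max 1 (8 * K), le_max_left _ _, le_max_right _ _⟩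
  obtain ⟨R₁, hR₁⟩ := hs (A + |Φ 0|)
  obtain ⟨R₂, hR₂⟩ := hs 1
  refine ⟨max 1 (max R₁ R₂), fun c hcc => ?_⟩
  simp only [ge_iff_le, max_le_iff] at hcc
  obtain ⟨hc1, hcR₁, hcR₂⟩ := hcc
  have hslope : ∀ y x, c ≤ y → y ≤ x → A * (x - y) ≤ Φ x - Φ y := by
    intro y x hy hyx
    rcases hyx.eq_or_lt with rfl | hyx
    · simp
    have h1 := hc.slope_mono_adjacent (mem_univ 0) (mem_univ x) (by linarith : (0:ℝ) < y) hyx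
    rw [div_le_div_iff₀ (by linarith) (by linarith)] at h1
    have h2 := hR₁ y (by linarith)
    have h3 : |Φ 0| ≤ |Φ 0| * y := le_mul_of_one_le_right (abs_nonneg _) (by linarith)
    have h4 := le_abs_self (Φ 0)
    have h5 : A * y ≤ Φ y - Φ 0 := by nlinarith
    have h6 : A * y * (x - y) ≤ (Φ x - Φ y) * y := by
      have := mul_le_mul_of_nonneg_right h5 (by linarith : 0 ≤ x - y)
      linarith
    have hy0 : 0 < y := by linarith
    nlinarith
  refine ⟨by simpa using hR₂ c hcR₂, ?_⟩
  by_contra! hcon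
  have key : ∀ k : ℕ, ∃ x : ℝ, c + 5 / 4 ≤ x ∧
      x ≤ c + 5 / 4 + K / A * (4 / 3) * (1 - (1 / 4) ^ k) ∧
      (∃ δ > 0, ∀ y ∈ Ioo (x - δ) x, (4 ^ k * A) * (x - y) ≤ Φ x - Φ y) ∧
      Φ (c + 5 / 4) + 4 * K * k ≤ Φ x := by
    intro k
    induction k with
    | zero =>
      refine ⟨c + 5 / 4, le_rfl, by simp, ⟨1, one_pos, fun y hy => ?_⟩, by simp⟩
      rw [pow_zero, one_mul]
      exact hslope y _ (by linarith [hy.1]) hy.2.le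
    | succ k ih =>
      obtain ⟨x, hx1, hx2, hδ, hx3⟩ := ih
      have hp : (1 : ℝ) ≤ 4 ^ k := one_le_pow₀ (by norm_num)
      have hAp : 0 < A := by linarith
      have hq : (0 : ℝ) ≤ (1 / 4) ^ k := by positivity
      have hKA : K / A ≤ 1 / 8 := by rw [div_le_iff₀ hAp]; linarith
      have hKA0 : 0 < K / A := by positivity
      have hx4 : x ≤ c + 3 / 2 := by nlinarith
      have hstep := hcon x (4 ^ k * A) hx1 hx4 (by nlinarith)
        (by have := hslope c x le_rfl (by linarith); nlinarith) hδ
      have he : K / (4 ^ k * A) = K / A * (1 / 4) ^ k := by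
        rw [one_div, inv_pow]; field_simp
      have hpos : 0 < K / (4 ^ k * A) := by positivity
      refine ⟨x + K / (4 ^ k * A), by linarith, ?_, ⟨K / (4 ^ k * A), hpos, ?_⟩, ?_⟩
      · rw [he, pow_succ]
        nlinarith
      · intro y hy
        set x' := x + K / (4 ^ k * A) with hx'
        have hyx : x < y := by have := hy.1; rw [hx'] at this; linarith
        have hsec := hc.secant_mono (mem_univ x') (mem_univ x) (mem_univ y)
          (by rw [hx']; linarith) hy.2.ne hyx.le
        have e1 : (Φ x - Φ x') / (x - x') = (Φ x' - Φ x) / (K / (4 ^ k * A)) := by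
          rw [← neg_div_neg_eq]; congr 1 <;> rw [hx'] <;> ring
        have e2 : (Φ y - Φ x') / (y - x') = (Φ x' - Φ y) / (x' - y) := by
          rw [← neg_div_neg_eq]; congr 1 <;> ring
        rw [e1, e2] at hsec
        have h4 : 4 ^ (k + 1) * A ≤ (Φ x' - Φ x) / (K / (4 ^ k * A)) := by
          rw [le_div_iff₀ hpos]
          have : 4 ^ (k + 1) * A * (K / (4 ^ k * A)) = 4 * K := by
            field_simp; ring
          rw [this]; linarith
        have h5 := h4.trans hsec
        rwa [le_div_iff₀ (by linarith [hy.2])] at h5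
      · push_cast; linarith
  obtain ⟨k, hk⟩ := exists_nat_gt ((Φ (c + 3 / 2) - Φ (c + 5 / 4)) / (4 * K))
  obtain ⟨x, hx1, hx2, -, hx3⟩ := key k
  rw [div_lt_iff₀ (by linarith)] at hk
  have hAp : 0 < A := by linarith
  have hq : (0 : ℝ) ≤ (1 / 4) ^ k := by positivity
  have hKA : K / A ≤ 1 / 8 := by rw [div_le_iff₀ hAp]; linarith
  have hKA0 : 0 < K / A := by positivity
  have hx4 : x ≤ c + 3 / 2 := by nlinarith
  have := hslope x (c + 3 / 2) (by linarith) hx4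
  nlinarith

theorem exists_int_im_add_mem (t : ℂ) (a : ℝ) :
    ∃ n : ℤ, (t + n * (2 * π * I)).im ∈ Ico a (a + 2 * π) := by
  obtain ⟨n, hn, -⟩ := existsUnique_add_zsmul_mem_Ico Real.two_pi_pos t.im a
  refine ⟨n, ?_⟩
  simpa using hn

theorem re_add_int_mul_two_pi_I (t : ℂ) (n : ℤ) : (t + n * (2 * π * I)).re = t.re := by
  simp

/-- The maximum of the real part on a vertical line of a function with `2πi`-periodic real part
is attained. -/
theorem exists_re_max_of_periodic {F : ℂ → ℂ} (hF : Continuous F)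
    (hper : Periodic (fun t => (F t).re) (2 * π * I)) (r : ℝ) :
    ∃ T : ℂ, T.re = r ∧ ∀ t : ℂ, t.re = r → (F t).re ≤ (F T).re := by
  obtain ⟨y, -, hy⟩ := (isCompact_Icc (a := (0:ℝ)) (b := 2 * π)).exists_isMaxOn
    ⟨0, by simp [Real.pi_pos.le]⟩ (f := fun y : ℝ => (F (r + y * I)).re)
    (Continuous.continuousOn (by fun_prop))
  refine ⟨r + y * I, by simp, fun t ht => ?_⟩
  obtain ⟨n, hn⟩ := exists_int_im_add_mem t 0
  rw [← show _ = _ from hper.int_mul n t]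
  have := hy (show (t + n * (2 * π * I)).im ∈ Icc 0 (2 * π) from
    ⟨hn.1, by simpa using hn.2.le⟩)
  have he : t + n * (2 * π * I) = r + (t + n * (2 * π * I)).im * I := by
    apply Complex.ext <;> simp [ht]
  change (F (t + n * (2 * π * I))).re ≤ _
  rw [he]
  exact this

/-- **Hadamard's three lines theorem** for functions with `2πi`-periodic real part. -/
theorem convexOn_re_max_of_periodic {F : ℂ → ℂ} (hF : Differentiable ℂ F)
    (hper : Periodic (fun t => (F t).re) (2 * π * I)) {T : ℝ → ℂ} (hT : ∀ r, (T r).re = r)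
    (hmax : ∀ t : ℂ, (F t).re ≤ (F (T t.re)).re) :
    ConvexOn ℝ univ (fun r => (F (T r)).re) := by
  refine LinearOrder.convexOn_of_lt convex_univ fun l _ u _ hlu a b ha hb hab => ?_
  set z := T (a • l + b • u) with hz
  have hzre : z.re = a * l + b * u := by rw [hz, hT]; simp
  have hul : 0 < u - l := by linarith
  have hmem : z ∈ HadamardThreeLines.verticalClosedStrip l u := by
    simp only [HadamardThreeLines.verticalClosedStrip, mem_preimage, hzre, mem_Icc]
    have h1 : a = 1 - b := by linarith
    subst h1
    constructor <;> nlinarith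
  have hbdd : BddAbove ((norm ∘ fun t => cexp (F t)) ''
      HadamardThreeLines.verticalClosedStrip l u) := by
    obtain ⟨M, hM⟩ := ((isCompact_Icc (a := l) (b := u)).reProdIm
      (isCompact_Icc (a := (0:ℝ)) (b := 2 * π))).bddAbove_image
      (f := fun t => Real.exp (F t).re)
      (Continuous.continuousOn (by have := hF.continuous; fun_prop))
    refine ⟨M, ?_⟩
    rintro _ ⟨t, ht, rfl⟩
    obtain ⟨n, hn⟩ := exists_int_im_add_mem t 0
    simp only [comp_apply, norm_exp]
    rw [← show _ = _ from hper.int_mul n t]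
    refine hM ⟨t + n * (2 * π * I), ⟨?_, hn.1, by simpa using hn.2.le⟩, rfl⟩
    simp only [mem_preimage, re_add_int_mul_two_pi_I]
    exact ht
  have := HadamardThreeLines.norm_le_interp_of_mem_verticalClosedStrip' hlu hmem
    (f := fun t => cexp (F t)) (a := Real.exp (F (T l)).re) (b := Real.exp (F (T u)).re)
    (Differentiable.diffContOnCl (by fun_prop)) hbdd
    (fun t ht => by
      rw [norm_exp, Real.exp_le_exp]
      have := hmax t
      rwa [show t.re = l from ht] at this)
    (fun t ht => by
      rw [norm_exp, Real.exp_le_exp]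
      have := hmax t
      rwa [show t.re = u from ht] at this)
  have hb' : (z.re - l) / (u - l) = b := by
    rw [hzre, div_eq_iff hul.ne', show a = 1 - b by linarith]; ring
  rw [hb', norm_exp, ← Real.exp_mul, ← Real.exp_mul, ← Real.exp_add, Real.exp_le_exp] at this
  simp only [smul_eq_mul]
  rw [show 1 - b = a by linarith] at this
  linarith

theorem le_re_deriv_of_left_slope {F : ℂ → ℂ} {t : ℂ} (hF : DifferentiableAt ℂ F t) {a δ : ℝ}
    (hδ : 0 < δ) (h : ∀ s ∈ Ioo 0 δ, a * s ≤ (F t).re - (F (t - s)).re) :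
    a ≤ (deriv F t).re := by
  have h1 : HasDerivAt (fun w : ℂ => F (t + w)) (deriv F t) ((0:ℝ) : ℂ) := by
    have : HasDerivAt F (deriv F t) (t + ((0:ℝ) : ℂ)) := by simpa using hF.hasDerivAt
    simpa using this.comp_const_add t _
  have h2 := h1.real_of_complex
  have h3 := (hasDerivWithinAt_iff_tendsto_slope' (by simp)).1 (h2.hasDerivWithinAt (s := Iio 0))
  refine ge_of_tendsto h3 ?_
  filter_upwards [Ioo_mem_nhdsLT (show -δ < 0 by linarith)] with y hy
  have h4 := h (-y) ⟨by linarith [hy.2], by linarith [hy.1]⟩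
  rw [slope_def_field, le_div_iff_of_neg (by linarith [hy.2])]
  simp only [ofReal_neg, sub_neg_eq_add, ofReal_zero, add_zero, sub_zero] at h4 ⊢
  linarith

/-- An entire function with `2πi`-periodic real part which grows superlinearly covers, from a
vertical strip of width one, a vertical strip further to the right modulo `2πi`. -/
theorem exists_strip_covering {F : ℂ → ℂ} (hF : Differentiable ℂ F)
    (hper : Periodic (fun t => (F t).re) (2 * π * I))
    (hs : ∀ A : ℝ, ∃ R : ℝ, ∀ r ≥ R, ∃ t : ℂ, t.re = r ∧ A * r ≤ (F t).re) :
    ∃ c₀ : ℝ, ∀ c ≥ c₀, ∃ c' ≥ c + 1, (∀ t : ℂ, t.re = c → (F t).re ≤ c') ∧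
      ∀ w : ℂ, w.re ∈ Icc (c' + 1) (c' + 2) →
        ∃ (t : ℂ) (k : ℤ), t.re ∈ Icc (c + 1) (c + 2) ∧ F t = w + k * (2 * π * I) := by
  choose T hT hTmax using exists_re_max_of_periodic hF.continuous hper
  set Φ : ℝ → ℝ := fun r => (F (T r)).re with hΦ
  have hmax : ∀ t : ℂ, (F t).re ≤ Φ t.re := fun t => hTmax _ _ rfl
  have hconv : ConvexOn ℝ univ Φ := convexOn_re_max_of_periodic hF hper hT hmax
  have hsup : ∀ A : ℝ, ∃ R : ℝ, ∀ r ≥ R, A * r ≤ Φ r := by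
    intro A
    obtain ⟨R, hR⟩ := hs A
    refine ⟨R, fun r hr => ?_⟩
    obtain ⟨t, rfl, h⟩ := hR r hr
    exact h.trans (hmax t)
  obtain ⟨K, hK⟩ : ∃ K : ℝ, K = 4096 := ⟨_, rfl⟩
  have hK0 : 0 < K := by rw [hK]; norm_num
  obtain ⟨c₀, hc₀⟩ := hconv.exists_le_add_of_superlinear hsup hK0
  refine ⟨c₀, fun c hc => ?_⟩
  obtain ⟨hcΦ, x, a, hx1, hx2, ha, hΦx, ⟨δ, hδ, hleft⟩, hright⟩ := hc₀ c hc
  have ha0 : 0 < a := by linarith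
  obtain ⟨s, hs⟩ : ∃ s, s = K / a := ⟨_, rfl⟩
  rw [← hs] at hright
  have hs0 : 0 < s := by rw [hs]; positivity
  have hs8 : s ≤ 1 / 8 := by rw [hs, div_le_iff₀ ha0]; linarith
  have hup : ∀ y ∈ Icc c (x + s), Φ y ≤ Φ x + 4 * K := by
    intro y hy
    rcases le_total y x with h | h
    · have := hconv.le_max_of_mem_Icc (mem_univ c) (mem_univ x) ⟨hy.1, h⟩
      rcases le_max_iff.1 this with h | h <;> linarith
    · have := hconv.le_max_of_mem_Icc (mem_univ x) (mem_univ (x + s)) ⟨h, hy.2⟩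
      rcases le_max_iff.1 this with h | h <;> linarith
  have hball : ∀ t ∈ ball (T x) s, |t.re - x| < s := by
    intro t ht
    rw [mem_ball, dist_eq_norm] at ht
    have := abs_re_le_norm (t - T x)
    rw [sub_re, hT] at this
    linarith
  have hosc : ∀ t ∈ ball (T x) (s / 2), ‖F t - F (T x)‖ ≤ 8 * K := by
    intro t ht
    have hBC := borelCaratheodory_zero (f := fun ζ => F (T x + ζ) - F (T x)) (M := 4 * K)
      (R := s) (z := t - T x) (by positivity)
      (Differentiable.differentiableOn (by fun_prop)) (fun ζ hζ => by
        have h1 := hball (T x + ζ) (by simpa [dist_eq_norm] using hζ)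
        rw [abs_lt] at h1
        have h2 := hmax (T x + ζ)
        have h3 := hup (T x + ζ).re ⟨by linarith, by linarith⟩
        change (F (T x + ζ) - F (T x)).re ≤ 4 * K
        rw [sub_re]
        change _ - Φ x ≤ _
        linarith) hs0 (by
          rw [mem_ball_zero_iff, ← dist_eq_norm]
          exact lt_trans (mem_ball.1 ht) (by linarith)) (by simp)
    have ht' : ‖t - T x‖ < s / 2 := by rw [← dist_eq_norm]; exact ht
    simp only [add_sub_cancel] at hBC
    refine hBC.trans ?_
    rw [div_le_iff₀ (by linarith)]
    nlinarith
  have hder : a ≤ ‖deriv F (T x)‖ := by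
    refine (le_re_deriv_of_left_slope (hF _) hδ fun h hh => ?_).trans (re_le_norm _)
    have h1 := hleft (x - h) ⟨by linarith [hh.2], by linarith [hh.1]⟩
    have h2 := hmax (T x - h)
    rw [sub_re, hT, ofReal_re] at h2
    change _ ≤ Φ x - _
    rw [sub_sub_cancel] at h1
    linarith
  have hcov := ball_subset_image_ball_of_norm_sub_le (by positivity) (by positivity)
    hF.differentiableOn hosc
  have hrad : 8 ≤ ‖deriv F (T x)‖ ^ 2 * (s / 2) ^ 2 / (16 * (8 * K)) := by
    calc (8:ℝ) = a ^ 2 * (s / 2) ^ 2 / (16 * (8 * K)) := by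
          rw [hs]; field_simp; rw [hK]; norm_num
      _ ≤ _ := by gcongr
  refine ⟨Φ x, by linarith, fun t ht => ?_, fun w hw => ?_⟩
  · have := hmax t
    rw [ht] at this
    linarith
  · obtain ⟨k, hk⟩ := exists_int_im_add_mem w ((F (T x)).im - π)
    have hmem : w + k * (2 * π * I) ∈ ball (F (T x)) 8 := by
      rw [mem_ball, dist_eq_norm]
      refine (norm_le_abs_re_add_abs_im _).trans_lt ?_
      rw [sub_re, sub_im, re_add_int_mul_two_pi_I]
      have h1 : |w.re - (F (T x)).re| ≤ 2 := by
        change |w.re - Φ x| ≤ 2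
        rw [abs_le]; constructor <;> linarith [hw.1, hw.2]
      have h2 : |(w + k * (2 * π * I)).im - (F (T x)).im| ≤ π := by
        rw [abs_le]; constructor <;> linarith [hk.1, hk.2]
      linarith [Real.pi_lt_four]
    obtain ⟨t, ht, hFt⟩ := hcov (ball_subset_ball hrad hmem)
    refine ⟨t, k, ?_, hFt⟩
    have := hball t (ball_subset_ball (by linarith) ht)
    rw [abs_lt] at this
    constructor <;> linarith

theorem Complex.re_le_of_forall_sphere_re_le {g : ℂ → ℂ} (hg : Differentiable ℂ g) {r M : ℝ}
    (hr : 0 < r) (h : ∀ z : ℂ, ‖z‖ = r → (g z).re ≤ M) {z : ℂ} (hz : ‖z‖ ≤ r) : (g z).re ≤ M := by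
  have := norm_le_of_forall_mem_frontier_norm_le (f := fun z => cexp (g z)) (U := ball 0 r)
    isBounded_ball (Differentiable.diffContOnCl (by fun_prop)) (C := Real.exp M)
    (fun z hz => by
      rw [frontier_ball _ hr.ne', mem_sphere_zero_iff_norm] at hz
      rw [norm_exp, Real.exp_le_exp]
      exact h z hz) (z := z) (by
      rw [closure_ball _ hr.ne', mem_closedBall_zero_iff]
      exact hz)
  rwa [norm_exp, Real.exp_le_exp] at this

/-- The real part of a nonconstant entire function cannot be bounded by a multiple of `log |z|`
on large circles. -/
theorem exists_le_re_of_nonconstant {g : ℂ → ℂ} (hg : Differentiable ℂ g)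
    (hnc : ¬ ∃ c : ℂ, ∀ z, g z = c) (A : ℝ) :
    ∃ R : ℝ, ∀ r ≥ R, ∃ z : ℂ, ‖z‖ = Real.exp r ∧ A * r ≤ (g z).re := by
  by_contra! hcon
  refine hnc ⟨g 0, fun z => is_const_of_deriv_eq_zero hg (fun w => ?_) z 0⟩
  have hfreq : ∃ᶠ r in atTop, ∀ z : ℂ, ‖z‖ = Real.exp r → (g z).re < A * r := by
    rw [frequently_atTop]
    exact fun R => (hcon R).imp fun r hr => ⟨hr.1, hr.2⟩
  have hev : ∀ᶠ r : ℝ in atTop, 1 ≤ r ∧ 4 * ‖w‖ + 1 ≤ Real.exp r :=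
    (eventually_ge_atTop 1).and (Real.tendsto_exp_atTop.eventually_ge_atTop _)
  have hlim : Tendsto (fun r : ℝ => 4 * (2 * (|A| + 1) * (r ^ 1 / Real.exp r)
      + 3 * ‖g 0‖ * (r ^ 0 / Real.exp r))) atTop (𝓝 (4 * (2 * (|A| + 1) * 0 + 3 * ‖g 0‖ * 0))) :=
    (((Real.tendsto_pow_mul_exp_neg_atTop_nhds_zero 1).congr fun r => by
      rw [Real.exp_neg]; rfl).const_mul _ |>.add
      (((Real.tendsto_pow_mul_exp_neg_atTop_nhds_zero 0).congr fun r => by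
      rw [Real.exp_neg]; rfl).const_mul _)).const_mul _
  rw [← norm_le_zero_iff]
  refine ge_of_tendsto_of_frequently (hlim.trans (by simp)) ((hfreq.and_eventually hev).mono ?_)
  rintro r ⟨hr, hr1, hr2⟩
  have hE : 0 < Real.exp r := Real.exp_pos r
  have hM : 0 < (|A| + 1) * r := by positivity
  have hre : ∀ z : ℂ, ‖z‖ ≤ Real.exp r → (g z).re ≤ (|A| + 1) * r := fun z hz =>
    re_le_of_forall_sphere_re_le hg hE (fun z hz => (hr z hz).le.trans (by
      have := le_abs_self A
      nlinarith)) hz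
  have hBC : ∀ z : ℂ, ‖z‖ ≤ Real.exp r / 2 → ‖g z‖ ≤ 2 * ((|A| + 1) * r) + 3 * ‖g 0‖ := by
    intro z hz
    have h1 := borelCaratheodory hM hg.differentiableOn (R := Real.exp r) (f := g) (z := z)
      (fun z hz => hre z (mem_ball_zero_iff.1 hz).le) hE
      (mem_ball_zero_iff.2 (by linarith))
    have hpos : 0 < Real.exp r - ‖z‖ := by linarith
    refine h1.trans (add_le_add ?_ ?_)
    · rw [div_le_iff₀ hpos]
      nlinarith
    · rw [div_le_iff₀ hpos]
      nlinarith [norm_nonneg (g 0)]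
  have hC := norm_deriv_le_of_forall_mem_sphere_norm_le (c := w) (R := Real.exp r / 4) (f := g)
    (by positivity) hg.diffContOnCl (fun z hz => hBC z (by
      have h1 : ‖z - w‖ = Real.exp r / 4 := by rw [← dist_eq_norm]; exact hz
      have h2 := norm_le_norm_add_norm_sub w z
      rw [norm_sub_rev] at h2
      linarith))
  refine hC.trans (le_of_eq ?_)
  field_simp

theorem exists_strip_covering_exp (m : ℤ) {g h : ℂ → ℂ} (hg : Differentiable ℂ g)
    (hh : Differentiable ℂ h) (hnc : ¬ ∃ c : ℂ, ∀ z, g z = c) :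
    ∃ c₀ : ℝ, ∀ c ≥ c₀, ∃ c' ≥ c + 1,
      (∀ t : ℂ, t.re = c → (m * t + (g (cexp t) + h (cexp (-t)))).re ≤ c') ∧
      ∀ w : ℂ, w.re ∈ Icc (c' + 1) (c' + 2) → ∃ (t : ℂ) (k : ℤ), t.re ∈ Icc (c + 1) (c + 2) ∧
        m * t + (g (cexp t) + h (cexp (-t))) = w + k * (2 * π * I) := by
  refine exists_strip_covering (F := fun t => m * t + (g (cexp t) + h (cexp (-t))))
    (by fun_prop) (fun t => ?_) (fun A => ?_)
  · have h1 : cexp (-(t + 2 * π * I)) = cexp (-t) := by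
      rw [neg_add, ← sub_eq_add_neg]; exact exp_periodic.sub_eq _
    simp only [exp_periodic t, h1, mul_add (m : ℂ)]
    simp
  · obtain ⟨B, hB⟩ := (isCompact_closedBall (0 : ℂ) 1).exists_bound_of_continuousOn
      hh.continuous.continuousOn
    obtain ⟨R, hR⟩ := exists_le_re_of_nonconstant hg hnc (A + |(m : ℝ)| + B)
    refine ⟨max R 1, fun r hr => ?_⟩
    simp only [ge_iff_le, max_le_iff] at hr
    obtain ⟨z, hz, hgz⟩ := hR r hr.1
    have hz0 : z ≠ 0 := by
      rw [← norm_pos_iff, hz]; exact Real.exp_pos r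
    refine ⟨log z, by rw [log_re, hz, Real.log_exp], ?_⟩
    have h1 := hB (cexp (-log z)) (by
      rw [mem_closedBall_zero_iff, norm_exp, neg_re, log_re, hz, Real.log_exp]
      exact Real.exp_le_one_iff.2 (by linarith))
    have h2 := (abs_le.1 (abs_re_le_norm (h (cexp (-log z))))).1
    have hB0 : 0 ≤ B := (norm_nonneg _).trans h1
    have h3 : -|(m : ℝ)| * r ≤ m * r := by
      have := neg_abs_le (m : ℝ)
      nlinarith [hr.2]
    have h4 : B ≤ B * r := le_mul_of_one_le_right hB0 hr.2
    have h5 : ((m : ℂ) * log z).re = m * r := by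
      rw [← ofReal_intCast, re_ofReal_mul, log_re, hz, Real.log_exp]
    rw [add_re, add_re, h5, exp_log hz0]
    linarith

/-- The coordinate near the end `∞` (for `true`) or `0` (for `false`) of `ℂ*`. -/
def endChart (b : Bool) (w : ℂ) : ℂ := if b then w⁻¹ else w

@[simp] theorem endChart_endChart (b : Bool) (w : ℂ) : endChart b (endChart b w) = w := by
  cases b <;> simp [endChart]

@[simp] theorem endChart_eq_zero {b : Bool} {w : ℂ} : endChart b w = 0 ↔ w = 0 := by
  cases b <;> simp [endChart]

theorem endChart_injective (b : Bool) : Injective (endChart b) :=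
  LeftInverse.injective (g := endChart b) (endChart_endChart b)

theorem IsTranscendentalSelfMapCStar.apply_ne_zero {f : ℂ → ℂ}
    (hf : IsTranscendentalSelfMapCStar f) {z : ℂ} (hz : z ≠ 0) : f z ≠ 0 := by
  obtain ⟨m, g, h, -, -, -, -, hf⟩ := hf
  rw [hf z hz]
  exact mul_ne_zero (zpow_ne_zero _ hz) (Complex.exp_ne_zero _)

theorem IsTranscendentalSelfMapCStar.exists_strip_covering {f : ℂ → ℂ}
    (hf : IsTranscendentalSelfMapCStar f) (a b : Bool) :
    ∃ F : ℂ → ℂ, (∀ t, endChart b (f (endChart a (cexp (-t)))) = cexp (-F t)) ∧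
      ∃ c₀ : ℝ, ∀ c ≥ c₀, ∃ c' ≥ c + 1, (∀ t : ℂ, t.re = c → (F t).re ≤ c') ∧
        ∀ w : ℂ, w.re ∈ Icc (c' + 1) (c' + 2) → ∃ (t : ℂ) (k : ℤ),
          t.re ∈ Icc (c + 1) (c + 2) ∧ F t = w + k * (2 * π * I) := by
  obtain ⟨m, g, h, hg, hh, hgc, hhc, hf⟩ := hf
  have hneg : ∀ {g : ℂ → ℂ}, (¬ ∃ c : ℂ, ∀ z, g z = c) → ¬ ∃ c : ℂ, ∀ z, -g z = c :=
    fun hgc ⟨c, hc⟩ => hgc ⟨-c, fun z => by rw [← hc z, neg_neg]⟩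
  have hlift : ∀ t, f (cexp t) = cexp (m * t + (g (cexp t) + h (cexp (-t)))) := fun t => by
    rw [hf _ (exp_ne_zero t), exp_add (m * t), exp_int_mul, exp_neg]
  cases a <;> cases b
  · refine ⟨_, fun t => ?_, exists_strip_covering_exp m hh.neg hg.neg (hneg hhc)⟩
    simp only [endChart, Bool.false_eq_true, if_false, hlift, Pi.neg_apply, neg_neg]
    congr 1; ring
  · refine ⟨_, fun t => ?_, exists_strip_covering_exp (-m) hh hg hhc⟩
    simp only [endChart, Bool.false_eq_true, if_false, if_true, hlift, ← exp_neg, neg_neg]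
    congr 1; push_cast; ring
  · refine ⟨_, fun t => ?_, exists_strip_covering_exp (-m) hg.neg hh.neg (hneg hgc)⟩
    simp only [endChart, Bool.false_eq_true, if_false, if_true, hlift, ← exp_neg, neg_neg,
      Pi.neg_apply]
    congr 1; push_cast; ring
  · refine ⟨_, fun t => ?_, exists_strip_covering_exp m hg hh hgc⟩
    simp only [endChart, if_true, hlift, ← exp_neg, neg_neg]

/-- Near each end, `f` maps suitable annuli over annuli closer to any prescribed end. -/
theorem IsTranscendentalSelfMapCStar.exists_annulus_covering {f : ℂ → ℂ}
    (hf : IsTranscendentalSelfMapCStar f) :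
    ∃ c₀ : ℝ, ∀ a b : Bool, ∀ c ≥ c₀, ∃ c' ≥ c + 1,
      (∀ z, ‖endChart a z‖ = Real.exp (-c) → Real.exp (-c') ≤ ‖endChart b (f z)‖) ∧
      ∀ w, ‖endChart b w‖ ∈ Icc (Real.exp (-(c' + 2))) (Real.exp (-(c' + 1))) →
        ∃ z, ‖endChart a z‖ ∈ Icc (Real.exp (-(c + 2))) (Real.exp (-(c + 1))) ∧ f z = w := by
  choose F hF c₀ hc₀ using hf.exists_strip_covering
  have hlog : ∀ u : ℂ, u ≠ 0 → ∃ t : ℂ, u = cexp (-t) := fun u hu =>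
    ⟨-log u, by rw [neg_neg, exp_log hu]⟩
  refine ⟨max (max (c₀ false false) (c₀ false true)) (max (c₀ true false) (c₀ true true)),
    fun a b c hc => ?_⟩
  simp only [ge_iff_le, max_le_iff] at hc
  obtain ⟨c', hc', h1, h2⟩ := hc₀ a b c (by cases a <;> cases b <;> simp [hc])
  refine ⟨c', hc', fun z hz => ?_, fun w hw => ?_⟩
  · obtain ⟨t, ht⟩ := hlog (endChart a z) (by
      rw [← norm_pos_iff, hz]; exact Real.exp_pos _)
    have hz' : z = endChart a (cexp (-t)) := by rw [← ht, endChart_endChart]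
    rw [hz', hF, norm_exp, Real.exp_le_exp, neg_re, neg_le_neg_iff]
    rw [ht, norm_exp, Real.exp_eq_exp, neg_re, neg_inj] at hz
    exact h1 t hz
  · obtain ⟨s, hs⟩ := hlog (endChart b w) (by
      rw [← norm_pos_iff]; exact (Real.exp_pos _).trans_le hw.1)
    rw [hs, norm_exp, neg_re, mem_Icc, Real.exp_le_exp, Real.exp_le_exp, neg_le_neg_iff,
      neg_le_neg_iff] at hw
    obtain ⟨t, k, ht, htk⟩ := h2 s ⟨hw.2, hw.1⟩
    refine ⟨endChart a (cexp (-t)), ?_, endChart_injective b ?_⟩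
    · rw [endChart_endChart, norm_exp, neg_re, mem_Icc, Real.exp_le_exp, Real.exp_le_exp,
        neg_le_neg_iff, neg_le_neg_iff]
      exact ⟨ht.2, ht.1⟩
    · rw [hF, htk, hs, Complex.exp_eq_exp_iff_exists_int]
      exact ⟨-k, by push_cast; ring⟩

theorem IsTranscendentalSelfMapCStar.differentiableOn {f : ℂ → ℂ}
    (hf : IsTranscendentalSelfMapCStar f) : DifferentiableOn ℂ f {0}ᶜ := by
  obtain ⟨m, g, h, hg, hh, -, -, hf⟩ := hf
  refine DifferentiableOn.congr (f := fun z => z ^ m * cexp (g z + h z⁻¹)) ?_ hf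
  intro z hz
  have h1 : DifferentiableAt ℂ (fun z : ℂ => z ^ m) z := differentiableAt_zpow.2 (Or.inl hz)
  have h2 : DifferentiableAt ℂ (fun z : ℂ => h z⁻¹) z :=
    (hh _).comp z (differentiableAt_inv hz)
  exact (h1.mul ((hg z).add h2).cexp).differentiableWithinAt

theorem IsTranscendentalSelfMapCStar.iterate_ne_zero {f : ℂ → ℂ}
    (hf : IsTranscendentalSelfMapCStar f) (n : ℕ) {z : ℂ} (hz : z ≠ 0) : f^[n] z ≠ 0 := by
  induction n with
  | zero => exact hz
  | succ n ih => rw [iterate_succ_apply']; exact hf.apply_ne_zero ih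

theorem IsTranscendentalSelfMapCStar.differentiableOn_iterate {f : ℂ → ℂ}
    (hf : IsTranscendentalSelfMapCStar f) (n : ℕ) : DifferentiableOn ℂ f^[n] {0}ᶜ := by
  induction n with
  | zero => exact differentiableOn_id
  | succ n ih =>
    rw [iterate_succ']
    exact hf.differentiableOn.comp ih fun z hz => hf.iterate_ne_zero n hz

theorem differentiableOn_endChart (b : Bool) : DifferentiableOn ℂ (endChart b) {0}ᶜ := by
  cases b
  · exact differentiableOn_id.congr fun z _ => by simp [endChart]
  · exact DifferentiableOn.congr (f := fun z => z⁻¹)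
      (fun z hz => (differentiableAt_inv hz).differentiableWithinAt) fun z _ => by simp [endChart]

/-- The `n`-th iterate of `f`, read in the coordinate at the end `b`. -/
def chartIterate (f : ℂ → ℂ) (b : Bool) (n : ℕ) (z : ℂ) : ℂ := endChart b (f^[n] z)

theorem IsTranscendentalSelfMapCStar.chartIterate_ne_zero {f : ℂ → ℂ}
    (hf : IsTranscendentalSelfMapCStar f) (b : Bool) (n : ℕ) {z : ℂ} (hz : z ≠ 0) :
    chartIterate f b n z ≠ 0 :=
  endChart_eq_zero.not.2 (hf.iterate_ne_zero n hz)

theorem IsTranscendentalSelfMapCStar.differentiableOn_chartIterate {f : ℂ → ℂ}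
    (hf : IsTranscendentalSelfMapCStar f) (b : Bool) (n : ℕ) :
    DifferentiableOn ℂ (chartIterate f b n) {0}ᶜ :=
  (differentiableOn_endChart b).comp (hf.differentiableOn_iterate n)
    fun _ hz => hf.iterate_ne_zero n hz

theorem isCompact_norm_endChart_mem_Icc (b : Bool) {r R : ℝ} (hr : 0 < r) :
    IsCompact {y : ℂ | ‖endChart b y‖ ∈ Icc r R} := by
  have h1 : IsCompact {u : ℂ | ‖u‖ ∈ Icc r R} :=
    (isCompact_closedBall (0 : ℂ) R).of_isClosed_subset
      (isClosed_Icc.preimage continuous_norm) fun u hu => mem_closedBall_zero_iff.2 hu.2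
  have h2 : {u : ℂ | ‖u‖ ∈ Icc r R} ⊆ {0}ᶜ := fun u hu => norm_pos_iff.1 (hr.trans_le hu.1)
  convert h1.image_of_continuousOn ((differentiableOn_endChart b).continuousOn.mono h2) using 1
  ext y
  constructor
  · exact fun hy => ⟨endChart b y, hy, endChart_endChart b y⟩
  · rintro ⟨u, hu, rfl⟩
    simpa using hu

/-- There are points escaping to the ends along any prescribed itinerary, at a rate controlled
by barriers. -/
theorem IsTranscendentalSelfMapCStar.exists_escaping_chain {f : ℂ → ℂ}
    (hf : IsTranscendentalSelfMapCStar f) :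
    ∃ c₀ : ℝ, ∀ σ : ℕ → Bool, ∀ c ≥ c₀, ∃ s : ℕ → ℝ, s 0 = c ∧ (∀ j, s j + 1 ≤ s (j + 1)) ∧
      (∀ j z, ‖endChart (σ j) z‖ = Real.exp (-s j) →
        Real.exp (-s (j + 1)) ≤ ‖endChart (σ (j + 1)) (f z)‖) ∧
      ∃ y, ‖endChart (σ 0) y‖ ∈ Icc (Real.exp (-(c + 2))) (Real.exp (-(c + 1))) ∧
        ∀ j, ‖chartIterate f (σ j) j y‖ ≤ Real.exp (-(s j + 1)) := by
  obtain ⟨c₀, hc₀⟩ := hf.exists_annulus_covering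
  choose N hN using hc₀
  refine ⟨c₀, fun σ c hc => ?_⟩
  let S : ℕ → {c : ℝ // c ≥ c₀} := fun n => Nat.rec ⟨c, hc⟩
    (fun j p => ⟨N (σ j) (σ (j + 1)) p.1 p.2, by
      have := (hN (σ j) (σ (j + 1)) p.1 p.2).1
      have := p.2
      linarith⟩) n
  have hS : ∀ j, (S (j + 1)).1 = N (σ j) (σ (j + 1)) (S j).1 (S j).2 := fun j => rfl
  set W : ℕ → Set ℂ := fun j => {y | ‖endChart (σ j) y‖ ∈
    Icc (Real.exp (-((S j).1 + 2))) (Real.exp (-((S j).1 + 1)))} with hW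
  have hW0 : ∀ j, W j ⊆ {0}ᶜ := fun j y hy => by
    have : endChart (σ j) y ≠ 0 := norm_pos_iff.1 ((Real.exp_pos _).trans_le hy.1)
    simpa using this
  have hcov : ∀ k, ∀ w ∈ W k, ∃ y, f^[k] y = w ∧ ∀ j ≤ k, f^[j] y ∈ W j := by
    intro k
    induction k with
    | zero => exact fun w hw => ⟨w, rfl, fun j hj => by rw [Nat.le_zero.1 hj]; exact hw⟩
    | succ k ih =>
      intro w hw
      obtain ⟨z, hz, hfz⟩ := (hN (σ k) (σ (k + 1)) (S k).1 (S k).2).2.2 w hw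
      obtain ⟨y, hy, hy'⟩ := ih z hz
      have hyw : f^[k + 1] y = w := by rw [iterate_succ_apply', hy, hfz]
      refine ⟨y, hyw, fun j hj => ?_⟩
      rcases Nat.le_succ_iff.1 hj with h | rfl
      · exact hy' j h
      · rw [hyw]; exact hw
  have hW0c : IsCompact (W 0) := isCompact_norm_endChart_mem_Icc _ (Real.exp_pos _)
  have hcl : ∀ j, IsClosed (W 0 ∩ {y | f^[j] y ∈ W j}) := fun j =>
    ((hf.differentiableOn_chartIterate (σ j) j).continuousOn.mono (hW0 0)).norm
      |>.preimage_isClosed_of_isClosed hW0c.isClosed isClosed_Icc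
  obtain ⟨y, hy⟩ := IsCompact.nonempty_iInter_of_sequence_nonempty_isCompact_isClosed
    (fun k => ⋂ j ∈ Iic k, W 0 ∩ {y | f^[j] y ∈ W j})
    (fun k => biInter_subset_biInter_left (Iic_subset_Iic.2 (Nat.le_succ k)))
    (fun k => by
      obtain ⟨y, -, hy⟩ := hcov k (endChart (σ k) (Real.exp (-((S k).1 + 1)) : ℝ)) (by
        simp only [hW, mem_ofPred_eq, endChart_endChart, norm_real, Real.norm_eq_abs,
          Real.abs_exp, mem_Icc, le_refl, and_true]
        gcongr; norm_num)
      exact ⟨y, mem_iInter₂.2 fun j hj => ⟨hy 0 (Nat.zero_le _), hy j hj⟩⟩)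
    (hW0c.of_isClosed_subset (isClosed_biInter fun j _ => hcl j)
      fun y hy => (mem_iInter₂.1 hy 0 (mem_Iic.2 le_rfl)).1)
    (fun k => isClosed_biInter fun j _ => hcl j)
  have hy' : ∀ j, f^[j] y ∈ W j := fun j =>
    (mem_iInter₂.1 (mem_iInter.1 hy j) j (mem_Iic.2 le_rfl)).2
  exact ⟨fun j => (S j).1, rfl, fun j => (hN (σ j) (σ (j + 1)) (S j).1 (S j).2).1,
    fun j z hz => (hN (σ j) (σ (j + 1)) (S j).1 (S j).2).2.1 z hz, y, hy' 0, fun j => (hy' j).2⟩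

/-- If no boundary point of a bounded open set satisfies all of countably many closed conditions,
then finitely many of them cut out a compact subset of the open set. -/
theorem exists_isCompact_sublevel {G : Set ℂ} (hG : IsOpen G) (hb : Bornology.IsBounded G)
    {φ : ℕ → ℂ → ℝ} {r : ℕ → ℝ} (hφ : ∀ n, ContinuousOn (φ n) (closure G))
    (hfr : ∀ ξ ∈ frontier G, ∃ n, r n < φ n ξ) :
    ∃ (M : ℕ) (P : Set ℂ), IsCompact P ∧ P ⊆ G ∧ (∀ z ∈ P, ∀ n ≤ M, φ n z ≤ r n) ∧
      (∀ z ∈ G, (∀ n ≤ M, φ n z ≤ r n) → z ∈ P) ∧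
      ∀ z ∈ P, z ∈ interior P ∨ ∃ n ≤ M, φ n z = r n := by
  have hcl : ∀ n, IsClosed (closure G ∩ {z | φ n z ≤ r n}) := fun n =>
    (hφ n).preimage_isClosed_of_isClosed isClosed_closure isClosed_Iic
  set Q : ℕ → Set ℂ := fun M => ⋂ n ∈ Iic M, closure G ∩ {z | φ n z ≤ r n} with hQ
  have hQcl : ∀ M, IsClosed (Q M) := fun M => isClosed_biInter fun j _ => hcl j
  have hGc : IsCompact (closure G) := hb.isCompact_closure
  have hQG : ∀ M, Q M ⊆ closure G := fun M z hz => (mem_iInter₂.1 hz 0 (Nat.zero_le M)).1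
  have hQm : ∀ M z, z ∈ Q M ↔ z ∈ closure G ∧ ∀ n ≤ M, φ n z ≤ r n := fun M z =>
    ⟨fun h => ⟨hQG M h, fun n hn => (mem_iInter₂.1 h n hn).2⟩,
      fun h => mem_iInter₂.2 fun n hn => ⟨h.1, h.2 n hn⟩⟩
  obtain ⟨M, hM⟩ : ∃ M, ¬ (frontier G ∩ Q M).Nonempty := by
    by_contra! hcon
    obtain ⟨ξ, hξ⟩ := IsCompact.nonempty_iInter_of_sequence_nonempty_isCompact_isClosed
      (fun M => frontier G ∩ Q M)
      (fun k => inter_subset_inter_right _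
        (biInter_subset_biInter_left (Iic_subset_Iic.2 (Nat.le_succ k)))) hcon
      ((hGc.of_isClosed_subset isClosed_frontier frontier_subset_closure).inter_right (hQcl 0))
      (fun k => isClosed_frontier.inter (hQcl k))
    rw [mem_iInter] at hξ
    obtain ⟨n, hn⟩ := hfr ξ (hξ 0).1
    exact hn.not_ge (((hQm n ξ).1 (hξ n).2).2 n le_rfl)
  have hPG : Q M ⊆ G := fun z hz => by
    by_contra h
    exact hM ⟨z, ⟨hQG M hz, by rwa [hG.interior_eq]⟩, hz⟩
  refine ⟨M, Q M, hGc.of_isClosed_subset (hQcl M) (hQG M), hPG, fun z hz => ((hQm M z).1 hz).2,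
    fun z hz h => (hQm M z).2 ⟨subset_closure hz, h⟩, fun z hz => ?_⟩
  rw [or_iff_not_imp_right]
  push Not
  intro hne
  rw [mem_interior_iff_mem_nhds]
  have h1 : ∀ᶠ w in 𝓝 z, ∀ n ∈ Iic M, φ n w < r n :=
    (eventually_all_finite (finite_Iic M)).2 fun n hn =>
      ((hφ n).continuousAt (mem_of_superset (hG.mem_nhds (hPG hz)) subset_closure)).eventually_lt
        continuousAt_const (lt_of_le_of_ne (((hQm M z).1 hz).2 n hn) (hne n hn))
  filter_upwards [h1, hG.mem_nhds (hPG hz)] with w hw hwG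
  exact (hQm M w).2 ⟨subset_closure hwG, fun n hn => (hw n hn).le⟩

/-- An orbit in a bounded open set which stays below the barriers forces a boundary point
to stay below the barriers, by the maximum principle. -/
theorem IsTranscendentalSelfMapCStar.exists_mem_frontier_of_barrier {f : ℂ → ℂ}
    (hf : IsTranscendentalSelfMapCStar f) {G : Set ℂ} (hG : IsOpen G)
    (hb : Bornology.IsBounded G) (h0 : (0 : ℂ) ∉ closure G) {σ : ℕ → Bool} {s : ℕ → ℝ} {n : ℕ}
    (hs : ∀ j z, ‖endChart (σ j) z‖ = Real.exp (-s j) →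
      Real.exp (-s (j + 1)) ≤ ‖endChart (σ (j + 1)) (f z)‖)
    {η : ℂ} (hη : η ∈ G)
    (hηs : ∀ j, ‖chartIterate f (σ j) (n + j) η‖ ≤ Real.exp (-(s j + 1))) :
    ∃ ξ ∈ frontier G, ∀ j, ‖chartIterate f (σ j) (n + j) ξ‖ ≤ Real.exp (-s j) := by
  by_contra! hcon
  have hG0 : closure G ⊆ {0}ᶜ := fun z hz h => h0 (h ▸ hz)
  have hd : ∀ j, DifferentiableOn ℂ (chartIterate f (σ j) (n + j)) (closure G) := fun j =>
    (hf.differentiableOn_chartIterate _ _).mono hG0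
  obtain ⟨M, P, hPc, hPG, hP, hPm, hPi⟩ := exists_isCompact_sublevel hG hb
    (fun j => (hd j).continuousOn.norm) hcon
  have hlt : ∀ j, Real.exp (-(s j + 1)) < Real.exp (-s j) := fun j => by
    gcongr; linarith
  have hηP : η ∈ P := hPm η hη fun j _ => (hηs j).trans (hlt j).le
  have hηi : η ∈ interior P := (hPi η hηP).resolve_right fun ⟨j, _, hj⟩ =>
    absurd hj ((hηs j).trans_lt (hlt j)).ne
  have hbd : ∀ z ∈ frontier (interior P), Real.exp (-s M) ≤ ‖chartIterate f (σ M) (n + M) z‖ := by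
    intro z hz
    have hz' := frontier_interior_subset hz
    have hzP : z ∈ P := hPc.isClosed.frontier_subset hz'
    obtain ⟨j, hj, hjz⟩ := (hPi z hzP).resolve_left hz'.2
    suffices ∀ i, j ≤ i → i ≤ M → ‖chartIterate f (σ i) (n + i) z‖ = Real.exp (-s i) from
      (this M hj le_rfl).ge
    intro i hji
    induction i, hji using Nat.le_induction with
    | base => exact fun _ => hjz
    | succ i _ ih =>
      intro hi
      refine le_antisymm (hP z hzP _ hi) ?_
      have := hs i _ (ih (by omega))
      rwa [← iterate_succ_apply' f] at this
  have hsub : closure (interior P) ⊆ closure G :=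
    closure_mono (interior_subset.trans hPG)
  have := norm_le_of_forall_mem_frontier_norm_le (f := fun z => (chartIterate f (σ M) (n + M) z)⁻¹)
    (hPc.isBounded.subset interior_subset)
    (DifferentiableOn.diffContOnCl (((hd M).mono hsub).inv fun z hz =>
      hf.chartIterate_ne_zero _ _ (hG0 (hsub hz)))) (C := (Real.exp (-s M))⁻¹)
    (fun z hz => by
      rw [norm_inv]
      exact inv_anti₀ (Real.exp_pos _) (hbd z hz)) (subset_closure hηi)
  rw [norm_inv, inv_le_inv₀ (norm_pos_iff.2
    (hf.chartIterate_ne_zero _ _ (hG0 (subset_closure hη)))) (Real.exp_pos _)] at this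
  exact ((hηs M).trans_lt (hlt M)).not_ge this

theorem exists_exp_eq_on_ball {h : ℂ → ℂ} {z : ℂ} {s : ℝ}
    (hd : DifferentiableOn ℂ h (ball z s)) (h0 : ∀ w ∈ ball z s, h w ≠ 0) :
    ∃ F : ℂ → ℂ, DifferentiableOn ℂ F (ball z s) ∧ ∀ w ∈ ball z s, cexp (F w) = h w := by
  rcases le_or_gt s 0 with hs | hs
  · rw [ball_eq_empty.2 hs]; exact ⟨0, by simp⟩
  have hz : z ∈ ball z s := mem_ball_self hs
  obtain ⟨F, hFz, hF⟩ := IsExactOn.with_val_at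
    ((hd.deriv isOpen_ball).div hd h0).isExactOn_ball z (log (h z))
  have hder : ∀ w ∈ ball z s, HasDerivAt (fun w => cexp (-F w) * h w) 0 w := by
    intro w hw
    have h1 : HasDerivAt (fun w => cexp (-F w) * h w)
        (cexp (-F w) * -(deriv h w / h w) * h w + cexp (-F w) * deriv h w) w :=
      ((hF w hw).neg.cexp).mul ((hd.differentiableAt (isOpen_ball.mem_nhds hw)).hasDerivAt)
    have e : cexp (-F w) * -(deriv h w / h w) * h w + cexp (-F w) * deriv h w = 0 := by
      have := h0 w hw
      field_simp
      ring
    rwa [e] at h1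
  obtain ⟨a, ha⟩ := isOpen_ball.exists_is_const_of_deriv_eq_zero
    (convex_ball z s).isPreconnected
    (fun w hw => (hder w hw).differentiableAt.differentiableWithinAt)
    (fun w hw => (hder w hw).deriv)
  have ha1 : a = 1 := by
    rw [← ha z hz, hFz, exp_neg, exp_log (h0 z hz), inv_mul_cancel₀ (h0 z hz)]
  refine ⟨F, fun w hw => (hF w hw).differentiableAt.differentiableWithinAt, fun w hw => ?_⟩
  have := ha w hw
  rw [ha1, exp_neg] at this
  exact (inv_mul_eq_one₀ (exp_ne_zero _)).1 this

/-- The points whose orbits tend to the ends of `ℂ*` along the itinerary `b`. -/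
def itineraryEscapingSet (f : ℂ → ℂ) (b : ℕ → Bool) : Set ℂ :=
  {z | z ≠ 0 ∧ Tendsto (fun n => chartIterate f (b n) n z) atTop (𝓝 0)}

theorem exists_endChart_exp (b : Bool) :
    ∃ ε : ℝ, |ε| = 1 ∧ (ε = if b then 1 else -1) ∧
      ∀ t : ℂ, ‖endChart b (cexp t)‖ = Real.exp (-(ε * t.re)) := by
  cases b
  · exact ⟨-1, by simp, by simp, fun t => by simp [endChart, norm_exp]⟩
  · exact ⟨1, by simp, by simp, fun t => by simp [endChart, norm_exp, Real.exp_neg]⟩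

/-- If no boundary point of `G` escapes along `b`, then no branch of `log fⁿ` on `G` covers a
large disc. -/
theorem IsTranscendentalSelfMapCStar.exists_not_ball_subset_image {f : ℂ → ℂ}
    (hf : IsTranscendentalSelfMapCStar f) {G : Set ℂ} (hG : IsOpen G)
    (hb : Bornology.IsBounded G) (h0 : (0 : ℂ) ∉ closure G) {b : ℕ → Bool}
    (hfr : ∀ ξ ∈ frontier G, ξ ∉ itineraryEscapingSet f b) :
    ∃ L > 0, ∀ (n : ℕ) (U : Set ℂ) (F : ℂ → ℂ) (w : ℂ), U ⊆ G →
      (∀ z ∈ U, cexp (F z) = f^[n] z) → ¬ ball (F w) L ⊆ F '' U := by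
  obtain ⟨c₀, hc₀⟩ := hf.exists_escaping_chain
  refine ⟨|c₀| + 6, by positivity, fun n U F w hUG hF hball => ?_⟩
  obtain ⟨d, ε, hε, hεd, hεx⟩ : ∃ (d : Bool) (ε : ℝ), |ε| = 1 ∧ 0 ≤ ε * (F w).re ∧
      ∀ t : ℂ, ‖endChart d (cexp t)‖ = Real.exp (-(ε * t.re)) := by
    rcases le_total 0 (F w).re with h | h
    · obtain ⟨ε, h1, h2, h3⟩ := exists_endChart_exp true
      exact ⟨true, ε, h1, by simpa [h2] using h, h3⟩
    · obtain ⟨ε, h1, h2, h3⟩ := exists_endChart_exp false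
      exact ⟨false, ε, h1, by simpa [h2] using h, h3⟩
  set c := max c₀ (ε * (F w).re) with hc
  obtain ⟨s, hs0, hs1, hs, y, hy, hyj⟩ :=
    hc₀ (fun j => if j = 0 then d else b (n + j)) c (le_max_left _ _)
  simp only [if_true] at hy
  have hy0 : y ≠ 0 := (endChart_eq_zero (b := d)).not.1
    (norm_pos_iff.1 ((Real.exp_pos _).trans_le hy.1))
  obtain ⟨k, hk⟩ := exists_int_im_add_mem (log y) ((F w).im - π)
  set u := log y + k * (2 * π * I) with hu
  have huy : cexp u = y := by
    rw [hu, exp_add, exp_log hy0, exp_int_mul_two_pi_mul_I, mul_one]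
  have hure : ε * u.re ∈ Icc (c + 1) (c + 2) := by
    rw [← huy, hεx, mem_Icc, Real.exp_le_exp, Real.exp_le_exp, neg_le_neg_iff,
      neg_le_neg_iff] at hy
    exact ⟨hy.2, hy.1⟩
  have humem : u ∈ ball (F w) (|c₀| + 6) := by
    rw [mem_ball, dist_eq_norm]
    refine (norm_le_abs_re_add_abs_im _).trans_lt ?_
    have h1 : |(u - F w).re| ≤ |c₀| + 2 := by
      have : |(u - F w).re| = |ε * u.re - ε * (F w).re| := by
        rw [← mul_sub, abs_mul, hε, one_mul, sub_re]
      rw [this, abs_le]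
      have h2 : ε * (F w).re ≤ c := le_max_right _ _
      have h3 : c ≤ |c₀| + ε * (F w).re :=
        max_le (by linarith [le_abs_self c₀]) (by linarith [abs_nonneg c₀])
      constructor <;> linarith [hure.1, hure.2, abs_nonneg c₀]
    have h2 : |(u - F w).im| ≤ π := by
      rw [sub_im, abs_le]; constructor <;> linarith [hk.1, hk.2]
    linarith [Real.pi_lt_four]
  obtain ⟨η, hηU, hηu⟩ := hball humem
  have hηy : f^[n] η = y := by rw [← hF η hηU, hηu, huy]
  obtain ⟨ξ, hξ, hξs⟩ := hf.exists_mem_frontier_of_barrier hG hb h0 (n := n) hs (hUG hηU)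
    (fun j => by
      have := hyj j
      rwa [chartIterate, ← hηy, ← iterate_add_apply, add_comm j n] at this)
  refine hfr ξ hξ ⟨fun h => h0 (h ▸ frontier_subset_closure hξ), ?_⟩
  have hslin : ∀ j : ℕ, c + j ≤ s j := by
    intro j
    induction j with
    | zero => simp [hs0]
    | succ j ih => push_cast; linarith [hs1 j]
  have hlim : Tendsto (fun j => Real.exp (-s j)) atTop (𝓝 0) :=
    Real.tendsto_exp_neg_atTop_nhds_zero.comp (tendsto_atTop_mono hslin
      (tendsto_atTop_add_const_left _ _ tendsto_natCast_atTop_atTop))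
  rw [← tendsto_add_atTop_iff_nat n]
  refine squeeze_zero_norm' ?_ hlim
  filter_upwards [eventually_ge_atTop 1] with j hj
  have := hξs j
  rwa [if_neg (by omega), add_comm n j] at this

/-- If no boundary point of the domain `G` escapes along `b`, then `G` escapes along `b` as soon
as one of its points does. -/
theorem IsTranscendentalSelfMapCStar.subset_itineraryEscapingSet {f : ℂ → ℂ}
    (hf : IsTranscendentalSelfMapCStar f) {G : Set ℂ} (hG : IsOpen G) (hGc : IsPreconnected G)
    (hb : Bornology.IsBounded G) (h0 : (0 : ℂ) ∉ closure G) {b : ℕ → Bool}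
    (hfr : ∀ ξ ∈ frontier G, ξ ∉ itineraryEscapingSet f b)
    (hne : (G ∩ itineraryEscapingSet f b).Nonempty) : G ⊆ itineraryEscapingSet f b := by
  have hG0 : G ⊆ {0}ᶜ := fun z hz h => h0 (h ▸ subset_closure hz)
  obtain ⟨L, hL0, hL⟩ := hf.exists_not_ball_subset_image hG hb h0 hfr
  have hosc : ∀ (z : ℂ) (s : ℝ), ball z s ⊆ G → ∀ w ∈ ball z (s / 4), ∀ n,
      |Real.log ‖f^[n] w‖ - Real.log ‖f^[n] z‖| ≤ 64 * L := by
    intro z s hzs w hw n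
    have hs : 0 < s := by
      have := pos_of_mem_ball hw
      linarith
    obtain ⟨F, hFd, hF⟩ := exists_exp_eq_on_ball
      ((hf.differentiableOn_iterate n).mono (hzs.trans hG0))
      (fun w hw => hf.iterate_ne_zero n (hG0 (hzs hw)))
    have hlog : ∀ w ∈ ball z s, Real.log ‖f^[n] w‖ = (F w).re := fun w hw => by
      rw [← hF w hw, norm_exp, Real.log_exp]
    have hder : ∀ w ∈ ball z (s / 4), ‖deriv F w‖ ≤ 256 * L / s := by
      intro w hw
      have hsub : closedBall w (s / 4) ⊆ ball z s := by
        intro v hv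
        rw [mem_ball] at hw ⊢
        rw [mem_closedBall] at hv
        linarith [dist_triangle v w z]
      obtain ⟨v, -, hv⟩ := exists_ball_subset_image_closedBall (by positivity) isOpen_ball hFd hsub
      by_contra! hcon
      refine hL n (closedBall w (s / 4)) F v (hsub.trans hzs) (fun z hz => hF z (hsub hz))
        ((ball_subset_ball ?_).trans hv)
      rw [div_lt_iff₀ hs] at hcon
      linarith
    have h4 : ball z (s / 4) ⊆ ball z s := ball_subset_ball (by linarith)
    have hlip := (convex_ball z (s / 4)).norm_image_sub_le_of_norm_deriv_le (f := F)
      (fun x hx => hFd.differentiableAt (isOpen_ball.mem_nhds (h4 hx))) hder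
      (mem_ball_self (by positivity)) hw
    rw [hlog w (h4 hw), hlog z (mem_ball_self hs), ← sub_re]
    refine (abs_re_le_norm _).trans (hlip.trans ?_)
    have : ‖w - z‖ ≤ s / 4 := by rw [← dist_eq_norm]; exact (mem_ball.1 hw).le
    calc 256 * L / s * ‖w - z‖ ≤ 256 * L / s * (s / 4) := by gcongr
      _ = 64 * L := by field_simp; norm_num
  have htrans : ∀ z w : ℂ, z ≠ 0 → w ≠ 0 →
      (∀ n, |Real.log ‖f^[n] w‖ - Real.log ‖f^[n] z‖| ≤ 64 * L) →
      z ∈ itineraryEscapingSet f b → w ∈ itineraryEscapingSet f b := by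
    rintro z w hz hw hzw ⟨-, hzt⟩
    refine ⟨hw, squeeze_zero_norm (a := fun n => Real.exp (64 * L) * ‖chartIterate f (b n) n z‖)
      (fun n => ?_) (by simpa using hzt.norm.const_mul (Real.exp (64 * L)))⟩
    have hz' := norm_pos_iff.2 (hf.chartIterate_ne_zero (b n) n hz)
    have hw' := norm_pos_iff.2 (hf.chartIterate_ne_zero (b n) n hw)
    rw [← Real.log_le_log_iff hw' (by positivity), Real.log_mul (by positivity) hz'.ne',
      Real.log_exp]
    have := abs_le.1 (hzw n)
    unfold chartIterate endChart
    split_ifs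
    · rw [norm_inv, norm_inv, Real.log_inv, Real.log_inv]; linarith
    · linarith
  have hopen : ∀ z ∈ G, ∃ V, IsOpen V ∧ z ∈ V ∧ V ⊆ G ∧
      ∀ w ∈ V, z ∈ itineraryEscapingSet f b ↔ w ∈ itineraryEscapingSet f b := by
    intro z hz
    obtain ⟨s, hs, hzs⟩ := Metric.isOpen_iff.1 hG z hz
    have hsub : ball z (s / 4) ⊆ G := (ball_subset_ball (by linarith)).trans hzs
    refine ⟨ball z (s / 4), isOpen_ball, mem_ball_self (by positivity), hsub, fun w hw => ?_⟩
    have h1 := hosc z s hzs w hw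
    exact ⟨htrans z w (hG0 hz) (hG0 (hsub hw)) h1,
      htrans w z (hG0 (hsub hw)) (hG0 hz) fun n => by rw [abs_sub_comm]; exact h1 n⟩
  have ho1 : IsOpen (G ∩ itineraryEscapingSet f b) := isOpen_iff_forall_mem_open.2 fun z hz => by
    obtain ⟨V, hV, hzV, hVG, hVe⟩ := hopen z hz.1
    exact ⟨V, fun w hw => ⟨hVG hw, (hVe w hw).1 hz.2⟩, hV, hzV⟩
  have ho2 : IsOpen (G \ itineraryEscapingSet f b) := isOpen_iff_forall_mem_open.2 fun z hz => by
    obtain ⟨V, hV, hzV, hVG, hVe⟩ := hopen z hz.1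
    exact ⟨V, fun w hw => ⟨hVG hw, fun h => hz.2 ((hVe w hw).2 h)⟩, hV, hzV⟩
  have hsub := hGc.subset_left_of_subset_union ho1 ho2 (disjoint_sdiff_right.mono_left
    inter_subset_right) (by rw [inter_union_sdiff]) (by
      obtain ⟨z, hz⟩ := hne
      exact ⟨z, hz.1, hz⟩)
  exact hsub.trans inter_subset_right

theorem IsTranscendentalSelfMapCStar.isOpen_image {f : ℂ → ℂ}
    (hf : IsTranscendentalSelfMapCStar f) {s : Set ℂ} (hs0 : s ⊆ {0}ᶜ) (hs : IsOpen s) :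
    IsOpen (f '' s) := by
  have hp : IsPreconnected ({0}ᶜ : Set ℂ) :=
    (isConnected_compl_singleton_of_one_lt_rank (by simp) 0).isPreconnected
  rcases (hf.differentiableOn.analyticOnNhd isOpen_compl_singleton).is_constant_or_isOpen hp with
    ⟨w, hw⟩ | h
  · exfalso
    obtain ⟨c, hc⟩ := hf.exists_annulus_covering
    obtain ⟨c', -, -, h⟩ := hc true true c le_rfl
    have key : ∀ u ∈ Icc (c' + 1) (c' + 2), ‖w‖ = Real.exp u := by
      intro u hu
      have hu' : ‖endChart true (Real.exp u : ℝ)‖ = Real.exp (-u) := by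
        simp [endChart, ← Real.exp_neg, norm_exp]
      obtain ⟨z, hz, hfz⟩ := h (Real.exp u : ℝ) (by
        rw [hu', mem_Icc, Real.exp_le_exp, Real.exp_le_exp]
        exact ⟨by linarith [hu.2], by linarith [hu.1]⟩)
      have hz0 : z ≠ 0 := (endChart_eq_zero (b := true)).not.1
        (norm_pos_iff.1 ((Real.exp_pos _).trans_le hz.1))
      rw [← hw z hz0, hfz, norm_real, Real.norm_eq_abs, Real.abs_exp]
    have h1 := (key (c' + 1) ⟨le_rfl, by linarith⟩).symm.trans (key (c' + 2) ⟨by linarith, le_rfl⟩)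
    rw [Real.exp_eq_exp] at h1
    linarith
  · exact h s hs0 hs

theorem IsTranscendentalSelfMapCStar.isOpen_image_iterate {f : ℂ → ℂ}
    (hf : IsTranscendentalSelfMapCStar f) {s : Set ℂ} (hs0 : s ⊆ {0}ᶜ) (hs : IsOpen s) (n : ℕ) :
    IsOpen (f^[n] '' s) := by
  induction n with
  | zero => simpa using hs
  | succ n ih =>
    rw [iterate_succ', image_comp]
    refine hf.isOpen_image ?_ ih
    rintro _ ⟨z, hz, rfl⟩
    exact hf.iterate_ne_zero n (hs0 hz)

theorem exists_pos_le_norm_endChart {K : Set ℂ} (hK : IsCompact K) (hK0 : K ⊆ {0}ᶜ) (a : Bool) :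
    ∃ δ > 0, ∀ u ∈ K, δ ≤ ‖endChart a u‖ := by
  obtain rfl | hne := K.eq_empty_or_nonempty
  · exact ⟨1, one_pos, by simp⟩
  obtain ⟨u, hu, hmin⟩ :=
    hK.exists_isMinOn hne ((differentiableOn_endChart a).continuousOn.mono hK0).norm
  exact ⟨‖endChart a u‖, norm_pos_iff.2 (endChart_eq_zero.not.2 (hK0 hu)), fun v hv => hmin hv⟩

/-- A domain on which `f` escapes, and whose boundary does not escape along any shifted itinerary,
has pairwise disjoint images. -/
theorem IsTranscendentalSelfMapCStar.disjoint_image_iterate {f : ℂ → ℂ}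
    (hf : IsTranscendentalSelfMapCStar f) {G : Set ℂ} (hG : IsOpen G) (hGc : IsPreconnected G)
    (hb : Bornology.IsBounded G) (h0 : (0 : ℂ) ∉ closure G) {b : ℕ → Bool}
    (hfr : ∀ ξ ∈ frontier G, ∀ q, ξ ∉ itineraryEscapingSet f fun n => b (n + q))
    (hGb : G ⊆ itineraryEscapingSet f b) {n m : ℕ} (hnm : n < m) :
    Disjoint (f^[n] '' G) (f^[m] '' G) := by
  have hG0 : closure G ⊆ {0}ᶜ := fun z hz h => h0 (h ▸ hz)
  have hG0' : G ⊆ {0}ᶜ := subset_closure.trans hG0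
  obtain ⟨p, rfl⟩ := Nat.exists_eq_add_of_lt hnm
  have hco : ∀ k, ContinuousOn f^[k] (closure G) := fun k =>
    (hf.differentiableOn_iterate k).continuousOn.mono hG0
  have hK : IsCompact (f^[n] '' closure G) := hb.isCompact_closure.image_of_continuousOn (hco n)
  have hK0 : f^[n] '' closure G ⊆ {0}ᶜ := by
    rintro _ ⟨z, hz, rfl⟩
    exact hf.iterate_ne_zero n (hG0 hz)
  by_contra hnd
  rw [disjoint_comm, not_disjoint_iff_nonempty_inter] at hnd
  have hsub : f^[n + p + 1] '' G ⊆ f^[n] '' G := by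
    refine (hGc.image _ ((hco _).mono subset_closure)).subset_of_closure_inter_subset
      (hf.isOpen_image_iterate hG0' hG n) hnd ?_
    rintro ζ ⟨hζ, η, hη, hηζ⟩
    obtain ⟨ξ, hξ, hξζ⟩ := closure_minimal (image_mono subset_closure) hK.isClosed hζ
    by_cases hξG : ξ ∈ G
    · exact ⟨ξ, hξG, hξζ⟩
    refine absurd ⟨hG0 hξ, ?_⟩ (hfr ξ ⟨hξ, by rwa [hG.interior_eq]⟩ (p + 1))
    rw [← tendsto_add_atTop_iff_nat n]
    refine ((tendsto_add_atTop_iff_nat (n + p + 1)).2 (hGb hη).2).congr fun j => ?_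
    simp only [chartIterate]
    rw [iterate_add_apply f j n, hξζ, ← hηζ, ← iterate_add_apply]
    congr 2
    omega
  obtain ⟨-, ⟨η, hη, -⟩, -⟩ := hnd
  have hper : ∀ j : ℕ, f^[(p + 1) * j + n] η ∈ f^[n] '' G := by
    intro j
    induction j with
    | zero => exact ⟨η, hη, by simp⟩
    | succ j ih =>
      obtain ⟨η', hη', h⟩ := ih
      refine hsub ⟨η', hη', ?_⟩
      rw [show n + p + 1 = (p + 1) + n by ring, iterate_add_apply, h, ← iterate_add_apply]
      congr 1
      ring
  obtain ⟨δ, hδ, hδK⟩ := exists_pos_le_norm_endChart hK hK0 false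
  obtain ⟨δ', hδ', hδK'⟩ := exists_pos_le_norm_endChart hK hK0 true
  have hlim : Tendsto (fun j : ℕ => (p + 1) * j + n) atTop atTop :=
    tendsto_atTop_mono (fun j => show j ≤ _ by nlinarith [Nat.zero_le (p * j)]) tendsto_id
  have := ((hGb hη).2.comp hlim).norm
  rw [norm_zero] at this
  obtain ⟨j, hj⟩ := (this.eventually_lt_const (lt_min hδ hδ')).exists
  have hmem := image_mono (f := f^[n]) subset_closure (hper j)
  have h2 : min δ δ' ≤ ‖endChart (b ((p + 1) * j + n)) (f^[(p + 1) * j + n] η)‖ := by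
    cases b ((p + 1) * j + n)
    · exact (min_le_left _ _).trans (hδK _ hmem)
    · exact (min_le_right _ _).trans (hδK' _ hmem)
  exact h2.not_gt hj

/-- The arguments of the points of the circle of radius `r` about `0` lying in `V`. -/
def circleTrace (V : Set ℂ) (r : ℝ) : Set ℝ := {θ ∈ Icc 0 (2 * π) | circleMap 0 r θ ∈ V}

theorem circleTrace_subset (V : Set ℂ) (r : ℝ) : circleTrace V r ⊆ Icc 0 (2 * π) :=
  sep_subset _ _

theorem isCompact_circleTrace_compl {V : Set ℂ} (hV : IsOpen V) (r : ℝ) :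
    IsCompact (circleTrace Vᶜ r) :=
  isCompact_Icc.inter_right (hV.isClosed_compl.preimage (continuous_circleMap 0 r))

theorem measurableSet_circleTrace {V : Set ℂ} (hV : IsOpen V) (r : ℝ) :
    MeasurableSet (circleTrace V r) :=
  measurableSet_Icc.inter (hV.preimage (continuous_circleMap 0 r)).measurableSet

theorem volume_circleTrace_ne_top (V : Set ℂ) (r : ℝ) :
    MeasureTheory.volume (circleTrace V r) ≠ ⊤ :=
  ((MeasureTheory.measure_mono (sep_subset _ _)).trans_lt
    (isCompact_Icc (a := (0 : ℝ)) (b := 2 * π)).measure_lt_top).ne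

/-- The logarithmic potential of the part of the circle of radius `r` about `0` outside `V`. -/
def circlePotential (V : Set ℂ) (r : ℝ) (u : ℂ) : ℝ :=
  (2 * π)⁻¹ * ∫ θ in circleTrace Vᶜ r, Real.log ‖u - circleMap 0 r θ‖

theorem continuousOn_circlePotential {V : Set ℂ} (hV : IsOpen V) (r : ℝ) :
    ContinuousOn (circlePotential V r) V := by
  intro u hu
  obtain ⟨δ, hδ, hball⟩ := Metric.isOpen_iff.1 hV u hu
  have hd : ∀ v ∈ ball u (δ / 2), ∀ ξ ∉ V, δ / 2 ≤ ‖v - ξ‖ := by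
    intro v hv ξ hξ
    by_contra! h
    refine hξ (hball ?_)
    rw [← dist_eq_norm, dist_comm] at h
    have := dist_triangle ξ v u
    rw [mem_ball] at hv ⊢
    linarith
  have hc : Continuous fun p : ℂ × ℝ => Real.log (max ‖p.1 - circleMap 0 r p.2‖ (δ / 2)) := by
    refine Continuous.log ?_ fun p => (lt_max_of_lt_right (half_pos hδ)).ne'
    exact ((continuous_fst.sub ((continuous_circleMap 0 r).comp continuous_snd)).norm).max
      continuous_const
  have hc' := continuous_parametric_integral_of_continuous (μ := MeasureTheory.volume)
    (f := fun (v : ℂ) (θ : ℝ) => Real.log (max ‖v - circleMap 0 r θ‖ (δ / 2))) hc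
    (isCompact_circleTrace_compl hV r)
  refine ContinuousAt.continuousWithinAt (((continuous_const.mul hc').continuousAt
    (x := u)).congr (f := fun v => (2 * π)⁻¹ * _) ?_)
  filter_upwards [ball_mem_nhds u (half_pos hδ)] with v hv
  rw [circlePotential]
  congr 1
  refine MeasureTheory.setIntegral_congr_fun (isCompact_circleTrace_compl hV r).measurableSet
    fun θ hθ => ?_
  simp only [max_eq_left (hd v hv _ hθ.2)]

theorem circleAverage_circlePotential {V U : Set ℂ} (hV : IsOpen V) (hU : IsOpen U) {r : ℝ}
    {x : ℂ → ℂ} (hx : DifferentiableOn ℂ x U) (hxV : MapsTo x U V) {c : ℂ} {ρ : ℝ}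
    (hc : closedBall c |ρ| ⊆ U) :
    Real.circleAverage (fun z => circlePotential V r (x z)) c ρ = circlePotential V r (x c) := by
  have hm : MeasurableSet (circleTrace Vᶜ r) := (isCompact_circleTrace_compl hV r).measurableSet
  have hcm : ∀ t, circleMap c ρ t ∈ U := fun t =>
    hc (sphere_subset_closedBall (circleMap_mem_sphere' c ρ t))
  have hco : ContinuousOn (uncurry fun (t θ : ℝ) =>
      Real.log ‖x (circleMap c ρ t) - circleMap 0 r θ‖)
      (Icc 0 (2 * π) ×ˢ circleTrace Vᶜ r) := by
    refine ContinuousOn.log (ContinuousOn.norm (ContinuousOn.sub ?_ ?_)) ?_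
    · exact hx.continuousOn.comp ((continuous_circleMap c ρ).comp continuous_fst).continuousOn
        fun p _ => hcm p.1
    · exact ((continuous_circleMap 0 r).comp continuous_snd).continuousOn
    · rintro ⟨t, θ⟩ ⟨-, hθ⟩
      rw [norm_ne_zero_iff, sub_ne_zero]
      exact fun h => hθ.2 (h ▸ hxV (hcm t))
  have hlogint := (hco.integrableOn_compact (μ := MeasureTheory.volume)
    (isCompact_Icc.prod (isCompact_circleTrace_compl hV r))).mono_set
    (prod_mono Ioc_subset_Icc_self Subset.rfl)
  rw [MeasureTheory.IntegrableOn, MeasureTheory.Measure.volume_eq_prod,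
    ← MeasureTheory.Measure.prod_restrict] at hlogint
  rw [← uIoc_of_le Real.two_pi_pos.le] at hlogint
  simp only [Real.circleAverage_def, circlePotential, smul_eq_mul]
  rw [intervalIntegral.integral_const_mul, MeasureTheory.intervalIntegral_integral_swap hlogint,
    ← MeasureTheory.integral_const_mul]
  congr 1
  refine MeasureTheory.setIntegral_congr_fun hm fun θ hθ => ?_
  have := AnalyticOnNhd.circleAverage_log_norm_of_ne_zero (R := ρ) (c := c)
    (g := fun z => x z - circleMap 0 r θ)
    (((hx.analyticOnNhd hU).mono hc).sub analyticOnNhd_const)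
    fun u hu => sub_ne_zero.2 fun h => hθ.2 (h ▸ hxV (hc hu))
  rwa [Real.circleAverage_def, smul_eq_mul] at this

theorem integrableOn_log_norm_sub_circleMap (r : ℝ) (u : ℂ) :
    MeasureTheory.IntegrableOn (fun θ => Real.log ‖u - circleMap 0 r θ‖) (Icc 0 (2 * π)) := by
  have := circleIntegrable_log_norm_sub_const (a := u) (c := 0) r
  rw [CircleIntegrable, intervalIntegrable_iff_integrableOn_Icc_of_le Real.two_pi_pos.le] at this
  simpa only [norm_sub_rev] using this

theorem integral_log_norm_sub_circleMap (r : ℝ) (u : ℂ) :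
    (2 * π)⁻¹ * ∫ θ in Icc 0 (2 * π), Real.log ‖u - circleMap 0 r θ‖ =
      Real.circleAverage (fun ξ => Real.log ‖ξ - u‖) 0 r := by
  rw [Real.circleAverage_def, smul_eq_mul, intervalIntegral.integral_of_le Real.two_pi_pos.le,
    MeasureTheory.integral_Icc_eq_integral_Ioc]
  simp only [norm_sub_rev]

theorem le_circlePotential (V : Set ℂ) {r : ℝ} (hr : 0 < r) {u : ℂ} (hu : ‖u‖ + r ≤ 1) :
    Real.log r + Real.posLog (r⁻¹ * ‖u‖) ≤ circlePotential V r u := by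
  have h1 := circleAverage_log_norm_sub_const_eq_log_radius_add_posLog (a := u) (c := 0) hr.ne'
  rw [zero_sub, norm_neg, ← integral_log_norm_sub_circleMap] at h1
  rw [← h1, circlePotential]
  refine mul_le_mul_of_nonneg_left ?_ (by positivity)
  have h2 := MeasureTheory.setIntegral_mono_set (s := circleTrace Vᶜ r)
    (integrableOn_log_norm_sub_circleMap r u).neg
    (Eventually.of_forall fun θ => ?_) (LE.le.eventuallyLE (sep_subset _ _))
  · simpa only [Pi.neg_apply, MeasureTheory.integral_neg, neg_le_neg_iff] using h2
  · refine neg_nonneg.2 (Real.log_nonpos (norm_nonneg _) ((norm_sub_le _ _).trans ?_))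
    simpa [abs_of_pos hr] using hu

theorem circlePotential_le {V : Set ℂ} (hV : IsOpen V) {r : ℝ} (hr : 0 < r) {u : ℂ}
    (hu : ‖u‖ ≤ r / 2) :
    circlePotential V r u ≤
      Real.log r + (2 * π)⁻¹ *
        (MeasureTheory.volume.real (circleTrace V r) * -Real.log (r / 2)) := by
  have h1 := circleAverage_log_norm_sub_const_of_mem_closedBall (a := u) (c := 0) (R := r)
    (by rw [mem_closedBall_zero_iff, abs_of_pos hr]; linarith)
  have hu' : circleTrace V r ∪ circleTrace Vᶜ r = Icc 0 (2 * π) := by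
    ext θ
    simp only [circleTrace, mem_union, mem_ofPred_eq, mem_compl_iff]
    tauto
  have hlogint := integrableOn_log_norm_sub_circleMap r u
  rw [← integral_log_norm_sub_circleMap, ← hu', MeasureTheory.setIntegral_union
    (disjoint_left.2 fun θ (h : θ ∈ circleTrace V r) h' => h'.2 h.2)
    (isCompact_circleTrace_compl hV r).measurableSet
    (hlogint.mono_set (circleTrace_subset V r)) (hlogint.mono_set (circleTrace_subset _ r)),
    mul_add] at h1
  have h2 : ∫ θ in circleTrace V r, Real.log (r / 2) ≤
      ∫ θ in circleTrace V r, Real.log ‖u - circleMap 0 r θ‖ := by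
    refine MeasureTheory.setIntegral_mono_on
      (MeasureTheory.integrableOn_const (volume_circleTrace_ne_top V r))
      (hlogint.mono_set (sep_subset _ _)) (measurableSet_circleTrace hV r) fun θ _ => ?_
    refine Real.log_le_log (by positivity) ?_
    have := norm_sub_norm_le (circleMap 0 r θ) u
    rw [norm_circleMap_zero, abs_of_pos hr, norm_sub_rev] at this
    linarith
  rw [MeasureTheory.setIntegral_const, smul_eq_mul] at h2
  have h3 := mul_le_mul_of_nonneg_left h2 (inv_nonneg.2 Real.two_pi_pos.le)
  rw [circlePotential]
  linarith

/-- A minimum principle on a compact set for functions with the mean value property. -/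
theorem exists_notMem_interior_le {P : Set ℂ} (hP : IsCompact P) {S : ℂ → ℝ}
    (hS : ContinuousOn S P)
    (hmv : ∀ c ρ, 0 < ρ → closedBall c ρ ⊆ P → Real.circleAverage S c ρ = S c)
    {z₀ : ℂ} (hz₀ : z₀ ∈ P) : ∃ z ∈ P, z ∉ interior P ∧ S z ≤ S z₀ := by
  obtain ⟨w, hw, hmin⟩ := hP.exists_isMinOn ⟨z₀, hz₀⟩ hS
  have hQ : IsCompact (P ∩ {z | S z ≤ S w}) :=
    hP.of_isClosed_subset (hS.preimage_isClosed_of_isClosed hP.isClosed isClosed_Iic)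
      inter_subset_left
  obtain ⟨z, ⟨hzP, hzw⟩, hmax⟩ :=
    hQ.exists_isMaxOn ⟨w, hw, le_refl (S w)⟩ continuous_re.continuousOn
  refine ⟨z, hzP, fun hzi => ?_, hzw.trans (hmin hz₀)⟩
  obtain ⟨ρ, hρ, hball⟩ := nhds_basis_closedBall.mem_iff.1 (mem_interior_iff_mem_nhds.1 hzi)
  have hsub : ∀ θ, circleMap z ρ θ ∈ P := fun θ =>
    hball (circleMap_mem_closedBall z hρ.le θ)
  have hlt : S w < S (circleMap z ρ 0) := by
    by_contra! h
    have : (circleMap z ρ 0).re ≤ z.re := hmax ⟨hsub 0, h⟩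
    simp [circleMap] at this
    linarith
  have h1 := intervalIntegral.integral_lt_integral_of_continuousOn_of_le_of_exists_lt
    (f := fun _ => S w) (g := fun θ => S (circleMap z ρ θ)) Real.two_pi_pos continuousOn_const
    (hS.comp (continuous_circleMap z ρ).continuousOn fun θ _ => hsub θ)
    (fun θ _ => hmin (hsub θ)) ⟨0, left_mem_Icc.2 Real.two_pi_pos.le, hlt⟩
  have h2 := hmv z ρ hρ hball
  rw [Real.circleAverage_def, smul_eq_mul, inv_mul_eq_iff_eq_mul₀ Real.two_pi_pos.ne'] at h2
  rw [intervalIntegral.integral_const, smul_eq_mul, sub_zero, h2] at h1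
  exact (lt_of_mul_lt_mul_left h1 Real.two_pi_pos.le).not_ge hzw

/-- A diagonal sequence along countably many summable families. -/
theorem exists_tendsto_atTop_sum_le {a : ℕ → ℕ → ℝ} (ha0 : ∀ i n, 0 ≤ a i n)
    (ha : ∀ i, Summable (a i)) {p : ℕ → ℕ → Prop} (hp : ∀ i, ∀ᶠ n in atTop, p i n) {ε : ℝ}
    (hε : 0 < ε) :
    ∃ (I : ℕ → ℕ) (N : ℕ), Tendsto I atTop atTop ∧ (∀ n ≥ N, p (I n) n) ∧
      ∀ M, ∑ n ∈ Finset.Ico N M, a (I n) n ≤ ε := by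
  have h1 : ∀ i, ∃ N, (∀ n ≥ N, p i n) ∧
      ∀ M, ∑ n ∈ Finset.Ico N M, a i n ≤ ε * (1 / 2 / 2 ^ i) := by
    intro i
    have h2 := (tendsto_sum_nat_add (a i)).eventually_le_const
      (show 0 < ε * (1 / 2 / 2 ^ i) by positivity)
    obtain ⟨N, hN⟩ := eventually_atTop.1 ((hp i).and h2)
    refine ⟨N, fun n hn => (hN n hn).1, fun M => ?_⟩
    rw [Finset.sum_Ico_eq_sum_range]
    simp only [add_comm N]
    exact (((summable_nat_add_iff N).2 (ha i)).sum_le_tsum _ fun n _ => ha0 _ _).trans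
      (hN N le_rfl).2
  choose N hNp hNs using h1
  set I : ℕ → ℕ := fun n => Nat.findGreatest (fun i => N i ≤ n) n with hI
  have hIN : ∀ n ≥ N 0, N (I n) ≤ n := fun n hn =>
    Nat.findGreatest_spec (P := fun i => N i ≤ n) (Nat.zero_le n) hn
  refine ⟨I, N 0, ?_, fun n hn => hNp _ _ (hIN n hn), fun M => ?_⟩
  · refine tendsto_atTop.2 fun i => ?_
    filter_upwards [eventually_ge_atTop (max i (N i))] with n hn
    exact Nat.le_findGreatest (le_of_max_le_left hn) (le_of_max_le_right hn)
  · calc ∑ n ∈ Finset.Ico (N 0) M, a (I n) n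
        ≤ ∑ n ∈ Finset.Ico (N 0) M, ∑ i ∈ Finset.range M, if N i ≤ n then a i n else 0 := by
          refine Finset.sum_le_sum fun n hn => ?_
          rw [Finset.mem_Ico] at hn
          have hmem : I n ∈ Finset.range M :=
            Finset.mem_range.2 ((Nat.findGreatest_le n).trans_lt hn.2)
          refine le_trans ?_ (Finset.single_le_sum (fun i _ => ?_) hmem)
          · rw [if_pos (hIN n hn.1)]
          · split_ifs
            exacts [ha0 _ _, le_rfl]
      _ = ∑ i ∈ Finset.range M, ∑ n ∈ Finset.Ico (N 0) M, if N i ≤ n then a i n else 0 :=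
          Finset.sum_comm
      _ ≤ ∑ i ∈ Finset.range M, ε * (1 / 2 / 2 ^ i) := by
          refine Finset.sum_le_sum fun i _ => le_trans ?_ (hNs i M)
          rw [← Finset.sum_filter]
          refine Finset.sum_le_sum_of_subset_of_nonneg (fun n hn => ?_) fun n _ _ => ha0 _ _
          simp only [Finset.mem_filter, Finset.mem_Ico] at hn ⊢
          exact ⟨hn.2, hn.1.2⟩
      _ ≤ ε := by
          rw [← Finset.mul_sum]
          refine mul_le_of_le_one_right hε.le ?_
          have := (summable_geometric_two' 1).sum_le_tsum (Finset.range M)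
            fun i _ => by positivity
          rwa [tsum_geometric_two'] at this

theorem summable_volume_circleTrace {V : ℕ → Set ℂ} (hV : ∀ n, IsOpen (V n)) {b : ℕ → Bool}
    (hd : ∀ n m, n ≠ m → b n = b m → Disjoint (V n) (V m)) (r : ℝ) :
    Summable fun n => MeasureTheory.volume.real (circleTrace (V n) r) := by
  have key : ∀ (c : Bool) (s : Finset ℕ), (∀ n ∈ s, b n = c) →
      ∑ n ∈ s, MeasureTheory.volume.real (circleTrace (V n) r) ≤
        MeasureTheory.volume.real (Icc 0 (2 * π)) := by
    intro c s hs
    rw [← MeasureTheory.measureReal_biUnion_finset (fun n hn m hm hnm =>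
      disjoint_left.2 fun θ h h' => disjoint_left.1
        (hd n m hnm ((hs n hn).trans (hs m hm).symm)) h.2 h'.2)
      (fun n _ => measurableSet_circleTrace (hV n) r)
      (fun n _ => volume_circleTrace_ne_top (V n) r)]
    exact MeasureTheory.measureReal_mono (iUnion₂_subset fun n _ => circleTrace_subset _ _)
      isCompact_Icc.measure_lt_top.ne
  refine summable_of_sum_le (c := 2 * MeasureTheory.volume.real (Icc 0 (2 * π)))
    (fun n => MeasureTheory.measureReal_nonneg) fun s => ?_
  rw [← Finset.sum_filter_add_sum_filter_not s (fun n => b n = true)]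
  have h1 := key true (s.filter fun n => b n = true) fun n hn => (Finset.mem_filter.1 hn).2
  have h2 := key false (s.filter fun n => ¬ b n = true) fun n hn => by
    simpa using (Finset.mem_filter.1 hn).2
  linarith

theorem isOpen_image_endChart (b : Bool) {s : Set ℂ} (hs : IsOpen s) (hs0 : s ⊆ {0}ᶜ) :
    IsOpen (endChart b '' s) := by
  have : endChart b '' s = {0}ᶜ ∩ endChart b ⁻¹' s := by
    ext u
    constructor
    · rintro ⟨z, hz, rfl⟩
      exact ⟨endChart_eq_zero.not.2 (hs0 hz), by rwa [mem_preimage, endChart_endChart]⟩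
    · exact fun h => ⟨_, h.2, endChart_endChart b u⟩
  rw [this]
  exact (differentiableOn_endChart b).continuousOn.isOpen_inter_preimage isOpen_compl_singleton hs

/-- A bounded domain containing a point escaping along `b` has a boundary point escaping along
some shift of `b`. -/
theorem IsTranscendentalSelfMapCStar.exists_mem_frontier_itineraryEscapingSet {f : ℂ → ℂ}
    (hf : IsTranscendentalSelfMapCStar f) {G : Set ℂ} (hG : IsOpen G) (hGc : IsPreconnected G)
    (hb : Bornology.IsBounded G) (h0 : (0 : ℂ) ∉ closure G) {b : ℕ → Bool}
    (hne : (G ∩ itineraryEscapingSet f b).Nonempty) :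
    ∃ ξ ∈ frontier G, ∃ q, ξ ∈ itineraryEscapingSet f fun n => b (n + q) := by
  by_contra! hfr
  have hfr0 : ∀ ξ ∈ frontier G, ξ ∉ itineraryEscapingSet f b := fun ξ hξ => hfr ξ hξ 0
  have hGb := hf.subset_itineraryEscapingSet hG hGc hb h0 hfr0 hne
  obtain ⟨z₀, hz₀, hz₀b⟩ := hne
  have hG0 : closure G ⊆ {0}ᶜ := fun z hz h => h0 (h ▸ hz)
  have hG0' : G ⊆ {0}ᶜ := subset_closure.trans hG0
  have hdisj : ∀ {n m}, n < m → Disjoint (f^[n] '' G) (f^[m] '' G) :=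
    hf.disjoint_image_iterate hG hGc hb h0 hfr hGb
  set x : ℕ → ℂ → ℂ := fun n => chartIterate f (b n) n with hx
  have hxd : ∀ n, DifferentiableOn ℂ (x n) (closure G) := fun n =>
    (hf.differentiableOn_chartIterate _ _).mono hG0
  set V : ℕ → Set ℂ := fun n => endChart (b n) '' (f^[n] '' G) with hVdef
  have hxV : ∀ n, MapsTo (x n) G (V n) := fun n z hz => ⟨_, ⟨z, hz, rfl⟩, rfl⟩
  have hV : ∀ n, IsOpen (V n) := fun n => by
    refine isOpen_image_endChart _ (hf.isOpen_image_iterate hG0' hG n) ?_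
    rintro _ ⟨z, hz, rfl⟩
    exact hf.iterate_ne_zero n (hG0' hz)
  have hVd : ∀ n m, n ≠ m → b n = b m → Disjoint (V n) (V m) := by
    intro n m hnm hbb
    simp only [hVdef, hbb]
    refine (disjoint_image_iff (endChart_injective _)).2 ?_
    exact hnm.lt_or_gt.elim hdisj fun h => (hdisj h).symm
  set ρ : ℕ → ℝ := fun i => (1 / 2) ^ (i + 2) with hρ
  have hρ0 : ∀ i, 0 < ρ i := fun i => by positivity
  have hρ1 : ∀ i, ρ i ≤ 1 / 4 := fun i => by
    have : ((1 : ℝ) / 2) ^ i ≤ 1 := pow_le_one₀ (by norm_num) (by norm_num)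
    simp only [hρ, pow_add]
    linarith
  have hρlim : Tendsto ρ atTop (𝓝 0) :=
    (tendsto_add_atTop_iff_nat 2).2 (tendsto_pow_atTop_nhds_zero_of_lt_one (by norm_num)
      (by norm_num))
  obtain ⟨I, N, hI, hIN, hsum⟩ := exists_tendsto_atTop_sum_le
    (a := fun i n => (2 * π)⁻¹ *
      (MeasureTheory.volume.real (circleTrace (V n) (ρ i)) * -Real.log (ρ i / 2)))
    (fun i n => mul_nonneg (by positivity) (mul_nonneg MeasureTheory.measureReal_nonneg
      (neg_nonneg.2 (Real.log_nonpos (by linarith [hρ0 i]) (by linarith [hρ1 i])))))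
    (fun i => ((summable_volume_circleTrace hV hVd (ρ i)).mul_right _).mul_left _)
    (p := fun i n => ‖x n z₀‖ ≤ ρ i / 2)
    (fun i => (hz₀b.2.norm.eventually_le_const (by rw [norm_zero]; linarith [hρ0 i])))
    (half_pos (Real.log_pos one_lt_two))
  set r : ℕ → ℝ := fun n => ρ (I n) with hr
  have hr0 : ∀ n, 0 < r n := fun n => hρ0 _
  have hr1 : ∀ n, r n ≤ 1 / 4 := fun n => hρ1 _
  have hrlim : Tendsto (fun i => 2 * r (i + N)) atTop (𝓝 0) := by
    simpa using (((tendsto_add_atTop_iff_nat N).2 (hρlim.comp hI)).const_mul 2)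
  obtain ⟨M, P, hPc, hPG, hP, hPm, hPi⟩ := exists_isCompact_sublevel hG hb
    (φ := fun i z => ‖x (i + N) z‖) (r := fun i => 2 * r (i + N))
    (fun i => (hxd _).continuousOn.norm) (by
      intro ξ hξ
      by_contra! hcon
      exact hfr0 ξ hξ ⟨hG0 (frontier_subset_closure hξ),
        (tendsto_add_atTop_iff_nat N).1 (squeeze_zero_norm hcon hrlim)⟩)
  have hz₀P : z₀ ∈ P := hPm z₀ hz₀ fun i _ => by
    have : ‖x (i + N) z₀‖ ≤ r (i + N) / 2 := hIN (i + N) (Nat.le_add_left _ _)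
    linarith [hr0 (i + N)]
  set s : ℕ → ℂ → ℝ := fun i z =>
    circlePotential (V (i + N)) (r (i + N)) (x (i + N) z) - Real.log (r (i + N)) with hs
  have hsc : ∀ i, ContinuousOn (s i) G := fun i =>
    ((continuousOn_circlePotential (hV _) _).comp ((hxd _).continuousOn.mono subset_closure)
      (hxV _)).sub continuousOn_const
  have hslow : ∀ i ≤ M, ∀ z ∈ P, Real.posLog ((r (i + N))⁻¹ * ‖x (i + N) z‖) ≤ s i z := by
    intro i hi z hz
    have h1 : ‖x (i + N) z‖ ≤ 2 * r (i + N) := hP z hz i hi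
    have := le_circlePotential (V (i + N)) (hr0 (i + N)) (u := x (i + N) z)
      (by linarith [hr1 (i + N)])
    simp only [hs]
    linarith
  obtain ⟨z, hzP, hzi, hzS⟩ := exists_notMem_interior_le hPc
    (S := fun z => ∑ i ∈ Finset.range (M + 1), s i z)
    (continuousOn_finsetSum _ fun i _ => (hsc i).mono hPG)
    (by
      intro c ρ hρ hcP
      have hcG : closedBall c |ρ| ⊆ G := by rw [abs_of_pos hρ]; exact hcP.trans hPG
      have hci : ∀ i, CircleIntegrable (s i) c ρ := fun i =>
        ContinuousOn.circleIntegrable' ((hsc i).mono (sphere_subset_closedBall.trans hcG))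
      rw [Real.circleAverage_fun_sum fun i _ => hci i]
      refine Finset.sum_congr rfl fun i _ => ?_
      have h1 := circleAverage_circlePotential (hV (i + N)) hG
        (r := r (i + N)) ((hxd (i + N)).mono subset_closure) (hxV (i + N)) hcG
      have h2 : CircleIntegrable
          (fun z => circlePotential (V (i + N)) (r (i + N)) (x (i + N) z)) c ρ := by
        convert (hci i).add (circleIntegrable_const (Real.log (r (i + N))) c ρ) using 1
        ext z
        simp [hs]
      simp only [hs]
      rw [Real.circleAverage_fun_sub h2 (circleIntegrable_const _ c ρ), h1,
        Real.circleAverage_const])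
    hz₀P
  obtain ⟨j, hj, hjz⟩ := (hPi z hzP).resolve_left hzi
  have hlow : Real.log 2 ≤ ∑ i ∈ Finset.range (M + 1), s i z := by
    refine le_trans ?_ (Finset.single_le_sum (f := fun i => s i z) (fun i hi =>
      Real.posLog_nonneg.trans (hslow i (Nat.lt_succ_iff.1 (Finset.mem_range.1 hi)) z hzP))
      (Finset.mem_range.2 (Nat.lt_succ_iff.2 hj)))
    refine le_trans ?_ (hslow j hj z hzP)
    rw [hjz, mul_left_comm, inv_mul_cancel₀ (hr0 _).ne', mul_one]
    exact le_max_right _ _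
  have hup : ∑ i ∈ Finset.range (M + 1), s i z₀ ≤ Real.log 2 / 2 := by
    refine le_trans ?_ (hsum (N + (M + 1)))
    rw [Finset.sum_Ico_eq_sum_range, Nat.add_sub_cancel_left]
    refine Finset.sum_le_sum fun i _ => ?_
    rw [add_comm N i]
    have := circlePotential_le (hV (i + N)) (hr0 (i + N)) (hIN (i + N) (Nat.le_add_left _ _))
    simp only [hs]
    linarith
  linarith [Real.log_pos one_lt_two]

theorem IsTranscendentalSelfMapCStar.exists_subset_itineraryEscapingSet {f : ℂ → ℂ}
    (hf : IsTranscendentalSelfMapCStar f) {e : ℕ → Bool} {z : ℂ} (hz : z ∈ littleEscapingSet f e) :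
    ∃ b, z ∈ itineraryEscapingSet f b ∧
      ∀ q, itineraryEscapingSet f (fun n => b (n + q)) ⊆ littleEscapingSet f e := by
  obtain ⟨⟨hz0, hesc⟩, ℓ, k, hlk⟩ := hz
  refine ⟨fun n => e (n + k - ℓ), ⟨hz0, ?_⟩, fun q w hw => ?_⟩
  · rw [Metric.tendsto_atTop]
    intro ε hε
    obtain ⟨N, hN⟩ := hesc (min ε 1) (lt_min hε one_pos)
    refine ⟨max N ℓ, fun n hn => ?_⟩
    obtain ⟨j, rfl⟩ := Nat.exists_eq_add_of_le' (le_of_max_le_right hn)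
    have h1 := hlk j
    have h2 := hN _ (le_of_max_le_left hn)
    have h3 : 1 ≤ 1 / min ε 1 := by
      rw [le_div_iff₀ (lt_min hε one_pos), one_mul]; exact min_le_right _ _
    rw [dist_zero_right, chartIterate]
    beta_reduce
    rw [show j + ℓ + k - ℓ = j + k by omega]
    cases hjk : e (j + k)
    · have h4 : ‖f^[j + ℓ] z‖ ≤ 1 := by simpa [hjk] using h1
      exact (h2.resolve_right (not_lt.2 (h4.trans h3))).trans_le (min_le_left _ _)
    · have h4 : 1 < ‖f^[j + ℓ] z‖ := by simpa [hjk] using h1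
      have h5 := h2.resolve_left (not_lt.2 ((min_le_right _ _).trans h4.le))
      simp only [endChart, if_true, norm_inv]
      rw [one_div] at h5
      exact (inv_lt_of_inv_lt₀ (lt_min hε one_pos) h5).trans_le (min_le_left _ _)
  · obtain ⟨hw0, hlim⟩ := hw
    have hlim' := hlim.norm
    rw [norm_zero] at hlim'
    refine ⟨⟨hw0, fun ε hε => ?_⟩, ?_⟩
    · obtain ⟨N, hN⟩ := eventually_atTop.1 (hlim'.eventually_lt_const hε)
      refine ⟨N, fun n hn => ?_⟩
      have h1 := hN n hn
      rw [chartIterate] at h1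
      beta_reduce at h1
      cases hb : e (n + q + k - ℓ) <;> rw [hb] at h1
      · exact Or.inl h1
      · right
        simp only [endChart, if_true, norm_inv] at h1
        rw [one_div]
        exact inv_lt_of_inv_lt₀ (norm_pos_iff.2 (hf.iterate_ne_zero n hw0)) h1
    · obtain ⟨N, hN⟩ := eventually_atTop.1 (hlim'.eventually_lt_const one_pos)
      refine ⟨max N ℓ, max N ℓ + q + k - ℓ, fun n => ?_⟩
      have h1 := hN (n + max N ℓ) (le_trans (le_max_left _ _) (Nat.le_add_left _ _))
      have hℓ : ℓ ≤ max N ℓ := le_max_right _ _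
      rw [show n + (max N ℓ + q + k - ℓ) = n + max N ℓ + q + k - ℓ by omega]
      rw [chartIterate] at h1
      beta_reduce at h1
      cases hb : e (n + max N ℓ + q + k - ℓ) <;> rw [hb] at h1
      · simpa [endChart] using h1.le
      · simp only [endChart, if_true, norm_inv] at h1
        simpa using (inv_lt_one₀ (norm_pos_iff.2 (hf.iterate_ne_zero _ hw0))).1 h1

theorem IsTranscendentalSelfMapCStar.exists_mem_frontier_littleEscapingSet {f : ℂ → ℂ}
    (hf : IsTranscendentalSelfMapCStar f) {e : ℕ → Bool} {G : Set ℂ} (hG : IsOpen G)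
    (hGc : IsPreconnected G) (hb : Bornology.IsBounded G) (h0 : (0 : ℂ) ∉ closure G)
    (hne : (G ∩ littleEscapingSet f e).Nonempty) :
    (frontier G ∩ littleEscapingSet f e).Nonempty := by
  obtain ⟨z, hzG, hz⟩ := hne
  obtain ⟨b, hzb, hb'⟩ := hf.exists_subset_itineraryEscapingSet hz
  obtain ⟨ξ, hξ, q, hq⟩ := hf.exists_mem_frontier_itineraryEscapingSet hG hGc hb h0 ⟨z, hzG, hzb⟩
  exact ⟨ξ, hξ, hb' q hq⟩

theorem frontier_connectedComponentIn_subset {G : Set ℂ} (hG : IsOpen G) (z : ℂ) :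
    frontier (connectedComponentIn G z) ⊆ closure G \ G := by
  intro ξ hξ
  refine ⟨closure_mono (connectedComponentIn_subset G z) hξ.1, fun hξG => ?_⟩
  rw [hG.connectedComponentIn.frontier_eq] at hξ
  have hne : (connectedComponentIn G z).Nonempty := closure_nonempty_iff.1 ⟨ξ, hξ.1⟩
  have hz : z ∈ G := connectedComponentIn_nonempty_iff.1 hne
  have h1 : IsPreconnected (insert ξ (connectedComponentIn G z)) :=
    isPreconnected_connectedComponentIn.subset_closure (subset_insert _ _)
      (insert_subset hξ.1 subset_closure)
  exact hξ.2 (h1.subset_connectedComponentIn (mem_insert_of_mem _ (mem_connectedComponentIn hz))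
    (insert_subset hξG (connectedComponentIn_subset G z)) (mem_insert _ _))

/-- If bounded domains away from `0` cannot cut off points of `S`, then no open set separates points
of `S` from `0` and `∞`. -/
theorem inter_eq_empty_of_separation {S : Set ℂ}
    (hS : ∀ G : Set ℂ, IsOpen G → IsPreconnected G → Bornology.IsBounded G → (0 : ℂ) ∉ closure G →
      (G ∩ S).Nonempty → (frontier G ∩ S).Nonempty)
    {U V : Set ℂ} (hU : IsOpen U) (hV : IsOpen V) {R : ℝ} (hR : ∀ z : ℂ, R ≤ ‖z‖ → z ∈ U)
    (h0 : (0 : ℂ) ∈ U) (hSUV : S ⊆ U ∪ V) (hd : ∀ z ∈ S, z ∈ U → z ∉ V) (h0V : (0 : ℂ) ∉ V) :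
    S ∩ V = ∅ := by
  by_contra hA
  obtain ⟨z₀, hz₀⟩ := nonempty_iff_ne_empty.2 hA
  set A := S ∩ V with hAdef
  set B := (insert 0 S ∩ U) ∪ {z : ℂ | R ≤ ‖z‖} with hBdef
  have h0B : (0 : ℂ) ∈ B := Or.inl ⟨mem_insert _ _, h0⟩
  have hBU : B ⊆ U := union_subset inter_subset_right fun z hz => hR z hz
  have hAB : ∀ z ∈ B, z ∉ closure A := by
    intro z hz hzA
    obtain ⟨w, hwU, hwA⟩ := mem_closure_iff.1 hzA U hU (hBU hz)
    exact hd w hwA.1 hwU hwA.2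
  have hBA : ∀ z ∈ A, z ∉ closure B := by
    intro z hz hzB
    rw [hBdef, closure_union, (isClosed_le continuous_const continuous_norm).closure_eq] at hzB
    rcases hzB with hzB | hzB
    · obtain ⟨w, hwV, hwS, hwU⟩ := mem_closure_iff.1 hzB V hV hz.2
      rcases hwS with rfl | hwS
      exacts [h0V hwV, hd w hwS hwU hwV]
    · exact hd z hz.1 (hR z hzB) hz.2
  set G' := {z : ℂ | infDist z A < infDist z B} with hG'
  have hG'o : IsOpen G' := isOpen_lt (continuous_infDist_pt A) (continuous_infDist_pt B)
  have hG'c : closure G' ⊆ {z : ℂ | infDist z A ≤ infDist z B} :=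
    closure_lt_subset_le (continuous_infDist_pt A) (continuous_infDist_pt B)
  have hA0 : ∀ z, infDist z A = 0 → z ∈ closure A := fun z h =>
    (mem_closure_iff_infDist_zero ⟨z₀, hz₀⟩).2 h
  have hB0 : ∀ z, infDist z B = 0 → z ∈ closure B := fun z h =>
    (mem_closure_iff_infDist_zero ⟨0, h0B⟩).2 h
  have hzG' : z₀ ∈ G' := by
    have h1 : infDist z₀ A = 0 := infDist_zero_of_mem hz₀
    have h2 : infDist z₀ B ≠ 0 := fun h => hBA z₀ hz₀ (hB0 z₀ h)
    simp only [hG', mem_ofPred_eq, h1]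
    exact lt_of_le_of_ne infDist_nonneg h2.symm
  have hBG' : ∀ z ∈ B, z ∉ closure G' := fun z hz hzG => by
    have h1 : infDist z A ≤ infDist z B := hG'c hzG
    rw [infDist_zero_of_mem hz] at h1
    exact hAB z hz (hA0 z (le_antisymm h1 infDist_nonneg))
  obtain ⟨ξ, hξ, hξS⟩ := hS (connectedComponentIn G' z₀) hG'o.connectedComponentIn
    isPreconnected_connectedComponentIn
    ((isBounded_closedBall (x := (0 : ℂ)) (r := R)).subset fun z hz => by
      rw [mem_closedBall_zero_iff]
      by_contra! h
      exact hBG' z (Or.inr h.le) (subset_closure (connectedComponentIn_subset _ _ hz)))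
    (fun h => hBG' 0 h0B (closure_mono (connectedComponentIn_subset _ _) h))
    ⟨z₀, mem_connectedComponentIn hzG', hz₀.1⟩
  obtain ⟨hξc, hξG⟩ := frontier_connectedComponentIn_subset hG'o z₀ hξ
  rcases hSUV hξS with hξU | hξV
  · exact hBG' ξ (Or.inl ⟨mem_insert_of_mem _ hξS, hξU⟩) hξc
  · have h1 : infDist ξ B ≤ infDist ξ A := not_lt.1 hξG
    rw [infDist_zero_of_mem (show ξ ∈ A from ⟨hξS, hξV⟩)] at h1
    exact hBA ξ ⟨hξS, hξV⟩ (hB0 ξ (le_antisymm h1 infDist_nonneg))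

theorem isPreconnected_inter_of_separation {X : Type*} [TopologicalSpace X] {K : Set X} {p q : X}
    (H : ∀ U V, IsOpen U → IsOpen V → K ⊆ U ∪ V → K ∩ (U ∩ V) = ∅ → p ∈ U → q ∈ U → K ∩ V = ∅)
    (hp : p ∈ K) {u v : Set X} (hu : IsOpen u) (hv : IsOpen v) (huv : K ⊆ u ∪ v)
    (hd : K ∩ (u ∩ v) = ∅) (hpu : p ∈ u) (hqv : q ∈ v) : IsPreconnected (K ∩ u) := by
  have key : ∀ u' v', IsOpen u' → IsOpen v' → K ∩ u ⊆ u' ∪ v' → K ∩ u ∩ (u' ∩ v') = ∅ →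
      p ∈ u' → K ∩ u ⊆ u' := by
    intro u' v' hu' hv' hsub hd' hp'
    have h1 := H ((u ∩ u') ∪ v) (u ∩ v') ((hu.inter hu').union hv) (hu.inter hv')
      (fun z hz => by
        have h1 := huv hz
        have h2 : z ∈ u → z ∈ u' ∪ v' := fun h => hsub ⟨hz, h⟩
        simp only [mem_union, mem_inter_iff] at *
        tauto)
      (by
        rw [eq_empty_iff_forall_notMem] at hd hd' ⊢
        intro z
        have h1 := hd z
        have h2 := hd' z
        simp only [mem_union, mem_inter_iff] at *
        tauto)
      (Or.inl ⟨hpu, hp'⟩) (Or.inr hqv)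
    intro z hz
    refine (hsub hz).resolve_right fun h => ?_
    exact (eq_empty_iff_forall_notMem.1 h1) z ⟨hz.1, hz.2, h⟩
  rw [isPreconnected_iff_subset_of_disjoint]
  intro u' v' hu' hv' hsub hd'
  rcases hsub ⟨hp, hpu⟩ with h | h
  · exact Or.inl (key u' v' hu' hv' hsub hd' h)
  · exact Or.inr (key v' u' hv' hu' (by rwa [union_comm]) (by rwa [inter_comm v']) h)

theorem isConnected_or_two_components_of_separation {X : Type*} [TopologicalSpace X] {K : Set X}
    {p q : X} (hp : p ∈ K) (hq : q ∈ K)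
    (H : ∀ U V, IsOpen U → IsOpen V → K ⊆ U ∪ V → K ∩ (U ∩ V) = ∅ → p ∈ U → q ∈ U → K ∩ V = ∅) :
    IsConnected K ∨ (connectedComponentIn K p ≠ connectedComponentIn K q ∧
      connectedComponentIn K p ∪ connectedComponentIn K q = K) := by
  refine or_iff_not_imp_left.2 fun hK => ?_
  have hK' : ¬ IsPreconnected K := fun h => hK ⟨⟨p, hp⟩, h⟩
  have hcov : connectedComponentIn K p ∪ connectedComponentIn K q = K := by
    refine (union_subset (connectedComponentIn_subset _ _)
      (connectedComponentIn_subset _ _)).antisymm ?_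
    have key : ∀ u v, IsOpen u → IsOpen v → K ⊆ u ∪ v → K ∩ (u ∩ v) = ∅ → p ∈ u → q ∈ v →
        K ⊆ connectedComponentIn K p ∪ connectedComponentIn K q := by
      intro u v hu hv huv hd hpu hqv z hz
      rcases huv hz with h | h
      · exact Or.inl ((isPreconnected_inter_of_separation H hp hu hv huv hd hpu hqv)
          |>.subset_connectedComponentIn ⟨hp, hpu⟩ inter_subset_left ⟨hz, h⟩)
      · exact Or.inr ((isPreconnected_inter_of_separation
          (fun U V hU hV h1 h2 h3 h4 => H U V hU hV h1 h2 h4 h3) hq hv hu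
          (by rwa [union_comm]) (by rwa [inter_comm v]) hqv hpu)
          |>.subset_connectedComponentIn ⟨hq, hqv⟩ inter_subset_left ⟨hz, h⟩)
    rw [isPreconnected_iff_subset_of_disjoint] at hK'
    push Not at hK'
    obtain ⟨u, v, hu, hv, huv, hd, hnu, hnv⟩ := hK'
    have hv' : ∀ a b : Set X, K ⊆ a ∪ b → K ∩ b = ∅ → K ⊆ a := fun a b hab hb z hz =>
      (hab hz).resolve_right fun h => (eq_empty_iff_forall_notMem.1 hb) z ⟨hz, h⟩
    have huv' : K ⊆ v ∪ u := by rwa [union_comm]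
    have hd' : K ∩ (v ∩ u) = ∅ := by rwa [inter_comm v]
    rcases huv hp with hpu | hpv <;> rcases huv hq with hqu | hqv
    · exact absurd (hv' u v huv (H u v hu hv huv hd hpu hqu)) hnu
    · exact key u v hu hv huv hd hpu hqv
    · exact key v u hv hu huv' hd' hpv hqu
    · exact absurd (hv' v u huv' (H v u hv hu huv' hd' hpv hqv)) hnv
  refine ⟨fun heq => hK' ?_, hcov⟩
  rw [heq, union_self] at hcov
  rw [← hcov]
  exact isPreconnected_connectedComponentIn

end

/-- For a transcendental self-map `f` of `ℂ*` and any `e ∈ {0,∞}^ℕ`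
(encoded with `true = ∞`, `false = 0`), the set `I_e(f) ∪ {0,∞} ⊆ ℂ̂` is either connected,
or has exactly two connected components, one containing `0` and the other containing `∞`. -/
theorem littleEscapingSphere_connected_or_two_components (f : ℂ → ℂ)
    (hf : IsTranscendentalSelfMapCStar f) (e : ℕ → Bool) :
    IsConnected (littleEscapingSphere f e) ∨
      (connectedComponentIn (littleEscapingSphere f e) ((0 : ℂ) : OnePoint ℂ) ≠
          connectedComponentIn (littleEscapingSphere f e) ∞ ∧
        connectedComponentIn (littleEscapingSphere f e) ((0 : ℂ) : OnePoint ℂ) ∪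
            connectedComponentIn (littleEscapingSphere f e) ∞ = littleEscapingSphere f e) := by
  have h0K : ((0 : ℂ) : OnePoint ℂ) ∈ littleEscapingSphere f e := Or.inr (Or.inl rfl)
  have hiK : ∞ ∈ littleEscapingSphere f e := Or.inr (Or.inr rfl)
  refine isConnected_or_two_components_of_separation h0K hiK fun U V hU hV hUV hd h0 hi => ?_
  obtain ⟨hc, hU'⟩ := (OnePoint.isOpen_iff_of_mem' hi).1 hU
  obtain ⟨R, hR⟩ := hc.isBounded.subset_ball (0 : ℂ)
  have hd' : ∀ z ∈ littleEscapingSphere f e, z ∈ U → z ∉ V := fun z hz hzU hzV =>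
    (eq_empty_iff_forall_notMem.1 hd) z ⟨hz, hzU, hzV⟩
  have hmem : ∀ z ∈ littleEscapingSet f e, (z : OnePoint ℂ) ∈ littleEscapingSphere f e :=
    fun z hz => Or.inl ⟨z, hz, rfl⟩
  have hmain := inter_eq_empty_of_separation (S := littleEscapingSet f e)
    (fun G hG hGc hGb hG0 hne => hf.exists_mem_frontier_littleEscapingSet hG hGc hGb hG0 hne)
    hU' (hV.preimage OnePoint.continuous_coe) (R := R)
    (fun z hz => by
      by_contra h
      have := hR h
      rw [mem_ball_zero_iff] at this
      linarith)
    h0 (fun z hz => hUV (hmem z hz)) (fun z hz => hd' z (hmem z hz)) (hd' _ h0K h0)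
  rw [eq_empty_iff_forall_notMem]
  rintro z ⟨hzK, hzV⟩
  rcases hzK with ⟨w, hw, rfl⟩ | rfl | rfl
  · exact (eq_empty_iff_forall_notMem.1 hmain) w ⟨hw, hzV⟩
  · exact hd' _ h0K h0 hzV
  · exact hd' _ hiK hi hzV
end
end

section
/- Let f be a transcendental self-map of ℂ* and suppose that I(f) ∪ {0,∞} ⊆ ℂ̂ is disconnected, so that it has exactly two connected components I⁰(f) containing 0 and I^∞(f) containing ∞. Then for every e ∈ {0,∞}^ℕ one has I⁰(f) ∩ I_e(f) ≠ ∅ and I^∞(f) ∩ I_e(f) ≠ ∅. -/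
open Complex Topology Filter Set Function OnePoint

noncomputable section

/-- A zero-free holomorphic function on a disc has a holomorphic logarithm. -/
lemma exists_log_of_ne_zero_on_ball {f : ℂ → ℂ} {c : ℂ} {r : ℝ}
    (hf : DifferentiableOn ℂ f (Metric.ball c r)) (h0 : ∀ z ∈ Metric.ball c r, f z ≠ 0) :
    ∃ g : ℂ → ℂ, DifferentiableOn ℂ g (Metric.ball c r) ∧
      ∀ z ∈ Metric.ball c r, Complex.exp (g z) = f z := by
  rcases le_or_gt r 0 with hr | hr
  · exact ⟨0, by simp [Metric.ball_eq_empty.2 hr], by simp [Metric.ball_eq_empty.2 hr]⟩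
  have hc : c ∈ Metric.ball c r := Metric.mem_ball_self hr
  have hfa : ∀ z ∈ Metric.ball c r, HasDerivAt f (deriv f z) z := fun z hz =>
    ((hf z hz).differentiableAt (Metric.isOpen_ball.mem_nhds hz)).hasDerivAt
  have hd : DifferentiableOn ℂ (fun z => deriv f z / f z) (Metric.ball c r) :=
    (hf.deriv Metric.isOpen_ball).div hf h0
  obtain ⟨g, hg⟩ := hd.isExactOn_ball
  have hg' : ∀ z ∈ Metric.ball c r,
      HasDerivAt (fun z => f z * Complex.exp (-g z)) 0 z := fun z hz => by
    refine ((hfa z hz).mul (hg z hz).neg.cexp).congr_deriv ?_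
    have := h0 z hz
    field_simp
    ring
  have hconst : ∀ z ∈ Metric.ball c r,
      f z * Complex.exp (-g z) = f c * Complex.exp (-g c) := fun z hz =>
    Metric.isOpen_ball.is_const_of_deriv_eq_zero (convex_ball c r).isPreconnected
      (fun w hw => (hg' w hw).differentiableAt.differentiableWithinAt)
      (fun w hw => (hg' w hw).deriv) hz hc
  refine ⟨fun z => g z - g c + Complex.log (f c), fun z hz =>
    (((hg z hz).differentiableAt.sub_const _).add_const _).differentiableWithinAt,
    fun z hz => ?_⟩
  have h1 := hconst z hz
  rw [Complex.exp_add, Complex.exp_log (h0 c hc), Complex.exp_sub]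
  rw [Complex.exp_neg, Complex.exp_neg] at h1
  have := Complex.exp_ne_zero (g z)
  have := Complex.exp_ne_zero (g c)
  field_simp at h1 ⊢
  linear_combination -h1

/-- A quantitative form of Bloch's theorem: if the image of a disc contains no disc of radius `4`,
then the derivative is controlled by the distance to the boundary. -/
lemma norm_deriv_mul_le_of_omits_ball {H : ℂ → ℂ} {c : ℂ} {r : ℝ}
    (hH : DifferentiableOn ℂ H (Metric.ball c r))
    (hgap : ∀ w : ℂ, ∃ w' ∈ Metric.ball w 4, ∀ z ∈ Metric.ball c r, H z ≠ w')
    {s : ℝ} (hs : s < r) {z : ℂ} (hz : z ∈ Metric.closedBall c s) :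
    ‖deriv H z‖ * (s - ‖z - c‖) ≤ 192 := by
  have hsub : Metric.closedBall c s ⊆ Metric.ball c r := Metric.closedBall_subset_ball hs
  have hdH : DifferentiableOn ℂ (deriv H) (Metric.ball c r) := hH.deriv Metric.isOpen_ball
  have hcont : ContinuousOn (fun z => ‖deriv H z‖ * (s - ‖z - c‖)) (Metric.closedBall c s) :=
    (hdH.continuousOn.mono hsub).norm.mul (by fun_prop)
  obtain ⟨a, ha, hmax⟩ := (isCompact_closedBall c s).exists_isMaxOn ⟨z, hz⟩ hcont
  refine (hmax hz).trans ?_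
  by_contra! hbig
  have has : ‖a - c‖ ≤ s := by simpa [dist_eq_norm] using ha
  set A := ‖deriv H a‖ with hA
  have hA0 : 0 ≤ A := norm_nonneg _
  obtain ⟨d, hd⟩ : ∃ d, d = (s - ‖a - c‖) / 2 := ⟨_, rfl⟩
  have hd0 : 0 < d := by
    have : 0 < s - ‖a - c‖ := by
      by_contra! h
      nlinarith
    linarith
  have hApos : 0 < A := by
    rcases hA0.eq_or_lt with h | h
    · rw [← h] at hbig; linarith
    · exact h
  have hball : ∀ w ∈ Metric.ball a d, ‖w - c‖ ≤ s - d := fun w hw => by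
    have h1 : ‖w - a‖ < d := by simpa [dist_eq_norm] using hw
    have h2 : ‖w - c‖ ≤ ‖w - a‖ + ‖a - c‖ := norm_sub_le_norm_sub_add_norm_sub _ _ _
    linarith
  have hballr : Metric.ball a d ⊆ Metric.ball c r := fun w hw =>
    hsub (by simpa [dist_eq_norm] using (hball w hw).trans (by linarith))
  have hder : ∀ w ∈ Metric.ball a d, ‖deriv H w‖ ≤ 2 * A := fun w hw => by
    have h1 := hball w hw
    have h2 : ‖deriv H w‖ * (s - ‖w - c‖) ≤ A * (s - ‖a - c‖) :=
      hmax (show w ∈ Metric.closedBall c s by simpa [dist_eq_norm] using h1.trans (by linarith))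
    have h3 : ‖deriv H w‖ * d ≤ ‖deriv H w‖ * (s - ‖w - c‖) := by gcongr; linarith
    have h4 : ‖deriv H w‖ * d ≤ 2 * A * d := by
      rw [show 2 * A * d = A * (s - ‖a - c‖) by rw [hd]; ring]
      linarith
    exact le_of_mul_le_mul_right h4 hd0
  have hlip : ∀ w ∈ Metric.ball a d, ‖deriv H w - deriv H a‖ ≤ 3 * A / d * ‖w - a‖ := by
    intro w hw
    have := Complex.dist_le_div_mul_dist_of_mapsTo_ball (hdH.mono hballr) (R₂ := 3 * A)
      (fun v hv => by
        rw [mem_closedBall_iff_norm]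
        calc _ ≤ ‖deriv H v‖ + A := norm_sub_le _ _
          _ ≤ 3 * A := by linarith [hder v hv]) hw
    simpa [dist_eq_norm] using this
  obtain ⟨ρ, hρ⟩ : ∃ ρ, ρ = d / 6 := ⟨_, rfl⟩
  have hρ0 : 0 < ρ := by linarith
  have hρd : Metric.closedBall a ρ ⊆ Metric.ball a d :=
    Metric.closedBall_subset_ball (by linarith)
  have hat : ∀ w ∈ Metric.ball c r, HasDerivAt H (deriv H w) w := fun w hw =>
    ((hH w hw).differentiableAt (Metric.isOpen_ball.mem_nhds hw)).hasDerivAt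
  have hsphere : ∀ w ∈ Metric.sphere a ρ, A * ρ / 2 ≤ ‖H w - H a‖ := by
    intro w hw
    have hw1 : ‖w - a‖ = ρ := by simpa [dist_eq_norm] using hw
    have h1 : ‖(H w - deriv H a * w) - (H a - deriv H a * a)‖ ≤ A / 2 * ‖w - a‖ := by
      refine Convex.norm_image_sub_le_of_norm_hasDerivWithin_le
        (f := fun v => H v - deriv H a * v) (f' := fun v => deriv H v - deriv H a)
        (s := Metric.closedBall a ρ) (fun v hv => ?_) (fun v hv => ?_)
        (convex_closedBall a ρ) (Metric.mem_closedBall_self hρ0.le)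
        (Metric.sphere_subset_closedBall hw)
      · refine HasDerivAt.hasDerivWithinAt ?_
        have := (hat v (hballr (hρd hv))).sub ((hasDerivAt_id v).const_mul (deriv H a))
        rwa [mul_one] at this
      · refine (hlip v (hρd hv)).trans ?_
        have h2 : ‖v - a‖ ≤ ρ := by simpa [dist_eq_norm] using hv
        calc 3 * A / d * ‖v - a‖ ≤ 3 * A / d * ρ := by gcongr
          _ = A / 2 := by rw [hρ]; field_simp; norm_num
    have h2 : ‖deriv H a * (w - a)‖ ≤ ‖H w - H a‖ +
        ‖(H w - deriv H a * w) - (H a - deriv H a * a)‖ := by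
      refine le_trans (le_of_eq ?_) (norm_sub_le _ _)
      congr 1
      ring
    rw [norm_mul, hw1] at h2
    rw [hw1] at h1
    linarith
  have hcov := DiffContOnCl.ball_subset_image_closedBall (f := H) (z₀ := a) (r := ρ)
    (hH.diffContOnCl_ball (hρd.trans hballr)) hρ0 hsphere (by
      intro hev
      have h1 : H =ᶠ[𝓝 a] fun _ => H a := by
        filter_upwards [hev] with w hw using not_not.1 hw
      have h2 : deriv H a = 0 := by rw [h1.deriv_eq]; simp
      rw [hA, h2, norm_zero] at hApos
      exact lt_irrefl _ hApos)
  obtain ⟨w', hw', hom⟩ := hgap (H a)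
  have h4 : (4 : ℝ) ≤ A * ρ / 2 / 2 := by
    have : A * (s - ‖a - c‖) = 12 * (A * ρ) := by rw [hρ, hd]; ring
    linarith
  obtain ⟨v, hv, hvw⟩ := hcov (Metric.ball_subset_ball h4 hw')
  exact hom v (hballr (hρd hv)) hvw

/-- Every point of the plane is within distance `4` of a point `w` for which
`cosh² w = (2 + exp (2 * w) + exp (-2 * w)) / 4` is an integer. -/
lemma exists_near_coshSq_eq_int (w : ℂ) : ∃ w' ∈ Metric.ball w 4, ∃ n : ℤ,
    (2 + Complex.exp (2 * w') + Complex.exp (-(2 * w'))) / 4 = n := by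
  let φ : ℝ → ℝ := fun x => (2 + Real.exp (2 * x) + Real.exp (-(2 * x))) / 4
  have hφ : Continuous φ := by fun_prop
  have key : ∀ x : ℝ, 0 ≤ x → φ x + 1 ≤ φ (x + 1) := by
    intro x hx
    have h1 : (1 : ℝ) ≤ Real.exp (2 * x) := Real.one_le_exp (by linarith)
    have h2 : Real.exp (2 * (x + 1)) = Real.exp (2 * x) * Real.exp 2 := by
      rw [← Real.exp_add]; ring_nf
    have h3 : (7 : ℝ) ≤ Real.exp 2 := by
      have h5 : Real.exp 2 = Real.exp 1 * Real.exp 1 := by rw [← Real.exp_add]; norm_num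
      have := Real.exp_one_gt_d9
      nlinarith
    have h4 : Real.exp (-(2 * x)) ≤ 1 := Real.exp_le_one_iff.2 (by linarith)
    have h6 := Real.exp_pos (-(2 * (x + 1)))
    simp only [φ]
    rw [h2]
    nlinarith
  obtain ⟨x', hx', n, hn⟩ : ∃ x' : ℝ, |x' - w.re| ≤ 1 ∧ ∃ n : ℤ, φ x' = n := by
    have pos : ∀ x : ℝ, 0 ≤ x → ∃ x' : ℝ, |x' - x| ≤ 1 ∧ ∃ n : ℤ, φ x' = n := by
      intro x hx
      obtain ⟨y, hy, hy'⟩ := intermediate_value_Icc (by linarith : x ≤ x + 1) hφ.continuousOn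
        (show (⌈φ x⌉ : ℝ) ∈ Set.Icc (φ x) (φ (x + 1)) from
          ⟨Int.le_ceil _, (Int.ceil_lt_add_one _).le.trans (key x hx)⟩)
      exact ⟨y, abs_le.2 ⟨by linarith [hy.1], by linarith [hy.2]⟩, _, hy'⟩
    rcases le_total 0 w.re with h | h
    · exact pos _ h
    · obtain ⟨x', h1, n, h2⟩ := pos (-w.re) (by linarith)
      refine ⟨-x', ?_, n, ?_⟩
      · rw [← abs_neg]; convert h1 using 2; ring
      · rw [← h2]; simp only [φ]; ring_nf
  let k : ℤ := round (w.im / Real.pi)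
  refine ⟨x' + k * (Real.pi * Complex.I), ?_, n, ?_⟩
  · rw [mem_ball_iff_norm]
    refine (Complex.norm_le_abs_re_add_abs_im _).trans_lt ?_
    have h1 : |w.im / Real.pi - k| ≤ 1 / 2 := abs_sub_round _
    have h2 : |k * Real.pi - w.im| ≤ Real.pi / 2 := by
      have : k * Real.pi - w.im = -(Real.pi * (w.im / Real.pi - k)) := by
        field_simp
        ring
      rw [this, abs_neg, abs_mul, abs_of_pos Real.pi_pos]
      nlinarith [Real.pi_pos]
    have h3 := Real.pi_lt_four
    simp only [Complex.sub_re, Complex.add_re, Complex.ofReal_re, Complex.mul_re,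
      Complex.intCast_re, Complex.intCast_im, Complex.sub_im, Complex.add_im, Complex.ofReal_im,
      Complex.mul_im, Complex.I_re, Complex.I_im, mul_zero, mul_one, zero_mul, add_zero, sub_zero,
      zero_add]
    linarith
  · have h1 : Complex.exp (2 * (x' + k * (Real.pi * Complex.I))) = Real.exp (2 * x') := by
      rw [show (2 * (x' + k * (Real.pi * Complex.I)) : ℂ) =
        2 * x' + k * (2 * Real.pi * Complex.I) by ring, Complex.exp_add,
        Complex.exp_int_mul_two_pi_mul_I]
      push_cast; simp
    rw [Complex.exp_neg, h1, ← Complex.ofReal_inv, ← Real.exp_neg, ← Complex.ofReal_intCast, ← hn]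
    simp only [φ]
    push_cast
    ring

/-- A Schottky-type bound for functions omitting the integers on a disc of radius `16`. -/
lemma norm_le_of_omits_int {q : ℂ → ℂ} {c : ℂ} (hq : DifferentiableOn ℂ q (Metric.ball c 16))
    (hom : ∀ z ∈ Metric.ball c 16, ∀ n : ℤ, q z ≠ n) (hc : ‖q c‖ ≤ 1 / 2)
    {z : ℂ} (hz : ‖z - c‖ ≤ 8) : ‖q z‖ ≤ Real.exp 450 := by
  obtain ⟨P, hPd, hP⟩ := exists_log_of_ne_zero_on_ball hq
    (fun z hz => by simpa using hom z hz 0)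
  obtain ⟨Q, hQd, hQ⟩ := exists_log_of_ne_zero_on_ball (hq.sub_const 1)
    (fun z hz => sub_ne_zero.2 (by simpa using hom z hz 1))
  have hsq : ∀ w : ℂ, Complex.exp (w / 2) ^ 2 = Complex.exp w := fun w => by
    rw [← Complex.exp_nat_mul]; congr 1; push_cast; ring
  have hPQ : ∀ z ∈ Metric.ball c 16, (Complex.exp (P z / 2) - Complex.exp (Q z / 2)) *
      (Complex.exp (P z / 2) + Complex.exp (Q z / 2)) = 1 := fun z hz => by
    linear_combination hsq (P z) - hsq (Q z) + hP z hz - hQ z hz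
  obtain ⟨H, hHd, hH⟩ := exists_log_of_ne_zero_on_ball (c := c) (r := 16)
    (f := fun z => Complex.exp (P z / 2) - Complex.exp (Q z / 2))
    ((hPd.div_const 2).cexp.sub (hQd.div_const 2).cexp)
    (fun z hz => left_ne_zero_of_mul_eq_one (hPQ z hz))
  have hqH : ∀ z ∈ Metric.ball c 16,
      q z = (2 + Complex.exp (2 * H z) + Complex.exp (-(2 * H z))) / 4 := fun z hz => by
    have h1 : Complex.exp (-H z) = Complex.exp (P z / 2) + Complex.exp (Q z / 2) := by
      rw [Complex.exp_neg, hH z hz]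
      exact inv_eq_of_mul_eq_one_right (hPQ z hz)
    have h2 : ∀ w : ℂ, Complex.exp (2 * w) = Complex.exp w ^ 2 := fun w => by
      rw [← Complex.exp_nat_mul]; norm_num
    rw [show -(2 * H z) = 2 * (-H z) by ring, h2, h2, h1, hH z hz]
    linear_combination (-hsq (P z) - hsq (Q z)) / 2 + (-hP z hz - hQ z hz) / 2
  have hcb : c ∈ Metric.ball c (16 : ℝ) := Metric.mem_ball_self (by norm_num)
  have hbl : ∀ w ∈ Metric.closedBall c (8 : ℝ), ‖deriv H w‖ ≤ 28 := by
    intro w hw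
    have hw8 : ‖w - c‖ ≤ 8 := by simpa [dist_eq_norm] using hw
    have := norm_deriv_mul_le_of_omits_ball hHd (fun w => by
      obtain ⟨w', hw', n, hn⟩ := exists_near_coshSq_eq_int w
      exact ⟨w', hw', fun z hz h => hom z hz n (by rw [hqH z hz, h, hn])⟩)
      (s := 15) (by norm_num) (z := w)
      (by simpa [dist_eq_norm] using hw8.trans (by norm_num))
    nlinarith [norm_nonneg (deriv H w)]
  have hzb : z ∈ Metric.closedBall c (8 : ℝ) := by simpa [dist_eq_norm] using hz
  have h816 : Metric.closedBall c (8 : ℝ) ⊆ Metric.ball c 16 :=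
    Metric.closedBall_subset_ball (by norm_num)
  have hHz : ‖H z - H c‖ ≤ 224 := by
    have := (convex_closedBall c (8 : ℝ)).norm_image_sub_le_of_norm_deriv_le (f := H) (C := 28)
      (fun w hw => (hHd w (h816 hw)).differentiableAt (Metric.isOpen_ball.mem_nhds (h816 hw)))
      hbl (Metric.mem_closedBall_self (by norm_num)) hzb
    linarith
  have hne : ∀ w : ℂ, ‖Complex.exp (2 * w)‖ = Real.exp (2 * w.re) ∧
      ‖Complex.exp (-(2 * w))‖ = Real.exp (-(2 * w.re)) := fun w => by
    simp [Complex.norm_exp]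
  have hx : |(H c).re| ≤ 1 := by
    have h7 : (7 : ℝ) ≤ Real.exp 2 := by
      have h5 : Real.exp 2 = Real.exp 1 * Real.exp 1 := by rw [← Real.exp_add]; norm_num
      have := Real.exp_one_gt_d9
      nlinarith
    have h4q : ‖4 * q c‖ ≤ 2 := by rw [norm_mul]; norm_num; linarith
    have e1 : 4 * q c = 2 + Complex.exp (2 * H c) + Complex.exp (-(2 * H c)) := by
      rw [hqH c hcb]; ring
    have big1 : Real.exp (2 * (H c).re) ≤ 4 + Real.exp (-(2 * (H c).re)) := by
      rw [← (hne (H c)).1, ← (hne (H c)).2]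
      calc ‖Complex.exp (2 * H c)‖ = ‖4 * q c - 2 - Complex.exp (-(2 * H c))‖ := by
            rw [e1]; congr 1; ring
        _ ≤ ‖4 * q c‖ + ‖(2 : ℂ)‖ + ‖Complex.exp (-(2 * H c))‖ :=
            (norm_sub_le _ _).trans (by gcongr; exact norm_sub_le _ _)
        _ ≤ _ := by norm_num; linarith
    have big2 : Real.exp (-(2 * (H c).re)) ≤ 4 + Real.exp (2 * (H c).re) := by
      rw [← (hne (H c)).1, ← (hne (H c)).2]
      calc ‖Complex.exp (-(2 * H c))‖ = ‖4 * q c - 2 - Complex.exp (2 * H c)‖ := by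
            rw [e1]; congr 1; ring
        _ ≤ ‖4 * q c‖ + ‖(2 : ℂ)‖ + ‖Complex.exp (2 * H c)‖ :=
            (norm_sub_le _ _).trans (by gcongr; exact norm_sub_le _ _)
        _ ≤ _ := by norm_num; linarith
    rw [abs_le]
    constructor
    · by_contra! h
      have h1 : Real.exp 2 ≤ Real.exp (-(2 * (H c).re)) := Real.exp_le_exp.2 (by linarith)
      have h2 : Real.exp (2 * (H c).re) ≤ 1 := Real.exp_le_one_iff.2 (by linarith)
      linarith
    · by_contra! h
      have h1 : Real.exp 2 ≤ Real.exp (2 * (H c).re) := Real.exp_le_exp.2 (by linarith)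
      have h2 : Real.exp (-(2 * (H c).re)) ≤ 1 := Real.exp_le_one_iff.2 (by linarith)
      linarith
  have hxz : |(H z).re| ≤ 225 := by
    have h1 : |(H z - H c).re| ≤ 224 := (Complex.abs_re_le_norm _).trans hHz
    rw [Complex.sub_re] at h1
    have h2 := abs_le.1 h1
    have h3 := abs_le.1 hx
    exact abs_le.2 ⟨by linarith, by linarith⟩
  rw [hqH z (h816 hzb), norm_div]
  have h3 := abs_le.1 hxz
  have h4 : ‖2 + Complex.exp (2 * H z) + Complex.exp (-(2 * H z))‖ ≤
      2 + Real.exp 450 + Real.exp 450 := by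
    refine (norm_add_le _ _).trans (add_le_add ((norm_add_le _ _).trans ?_) ?_)
    · rw [(hne (H z)).1]
      have : Real.exp (2 * (H z).re) ≤ Real.exp 450 := Real.exp_le_exp.2 (by linarith)
      norm_num; linarith
    · rw [(hne (H z)).2]
      exact Real.exp_le_exp.2 (by linarith)
  have h5 : (1 : ℝ) ≤ Real.exp 450 := Real.one_le_exp (by norm_num)
  rw [show ‖(4 : ℂ)‖ = 4 by norm_num, div_le_iff₀ (by norm_num)]
  linarith

/-- Maps of the form `z ^ m * exp (g z + h z⁻¹)` take each value on a round annulus of bounded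
modulus, as soon as the value has modulus between the minimum and a fixed fraction of the maximum
on the middle circle. -/
lemma exists_covering_const : ∃ C : ℝ, 0 < C ∧ ∀ f : ℂ → ℂ, IsTranscendentalSelfMapCStar f →
    ∀ z₁ z₂ w : ℂ, z₁ ≠ 0 → z₂ ≠ 0 → w ≠ 0 → ‖z₁‖ = ‖z₂‖ →
    Real.log ‖f z₂‖ ≤ Real.log ‖w‖ → Real.log ‖w‖ ≤ Real.log ‖f z₁‖ - C →
    ∃ z, z ≠ 0 ∧ |Real.log ‖z‖ - Real.log ‖z₁‖| ≤ 16 ∧ f z = w := by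
  refine ⟨8 * Real.exp 450, by positivity, ?_⟩
  rintro f ⟨m, g, h, hg, hh, -, -, hfe⟩ z₁ z₂ w hz₁ hz₂ hw hzz hlow hup
  let F : ℂ → ℂ := fun ζ => m * ζ + (g (Complex.exp ζ) + h (Complex.exp (-ζ)))
  have hF : Differentiable ℂ F := by fun_prop
  have hfF : ∀ ζ, f (Complex.exp ζ) = Complex.exp (F ζ) := fun ζ => by
    rw [hfe _ (Complex.exp_ne_zero ζ)]
    simp only [F]
    rw [Complex.exp_add (m * ζ), Complex.exp_int_mul, Complex.exp_neg ζ]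
  have hre : ∀ ζ, Real.log ‖f (Complex.exp ζ)‖ = (F ζ).re := fun ζ => by
    rw [hfF, Complex.norm_exp, Real.log_exp]
  let L : ℝ → ℂ := fun s => (Real.log ‖z₁‖ : ℝ) + s * Complex.I
  have hL₁ : Complex.exp (L z₁.arg) = z₁ := by
    have := Complex.exp_log hz₁
    rwa [Complex.log] at this
  have hL₂ : Complex.exp (L z₂.arg) = z₂ := by
    have := Complex.exp_log hz₂
    rwa [Complex.log, ← hzz] at this
  have hcont : Continuous fun s => (F (L s)).re :=
    Complex.continuous_re.comp (hF.continuous.comp (by fun_prop))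
  obtain ⟨s, hs, hFs⟩ := intermediate_value_uIcc (a := z₂.arg) (b := z₁.arg) hcont.continuousOn
    (show Real.log ‖w‖ ∈ Set.uIcc _ _ by
      rw [← hre, ← hre, hL₁, hL₂]
      exact Set.Icc_subset_uIcc ⟨hlow, by linarith [Real.exp_pos 450]⟩)
  have hFs' : (F (L s)).re = Real.log ‖w‖ := hFs
  have hsdist : |z₁.arg - s| ≤ 8 := by
    have h1 := Set.abs_sub_right_of_mem_uIcc hs
    have h2 := Complex.arg_le_pi z₁
    have h3 := Complex.neg_pi_lt_arg z₁
    have h4 := Complex.arg_le_pi z₂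
    have h5 := Complex.neg_pi_lt_arg z₂
    have h6 := Real.pi_lt_four
    refine h1.trans (abs_le.2 ⟨by linarith, by linarith⟩)
  let k : ℤ := round (((F (L s)).im - w.arg) / (2 * Real.pi))
  let p : ℂ := Complex.log w + k * (2 * Real.pi * Complex.I)
  have hp : ∀ n : ℤ, Complex.exp (p + n * (2 * Real.pi * Complex.I)) = w := fun n => by
    rw [Complex.exp_add, Complex.exp_add, Complex.exp_int_mul_two_pi_mul_I,
      Complex.exp_int_mul_two_pi_mul_I, Complex.exp_log hw, mul_one, mul_one]
  have hpre : p.re = Real.log ‖w‖ := by simp [p, Complex.log_re]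
  have hpim : p.im = w.arg + k * (2 * Real.pi) := by simp [p, Complex.log_im]
  have hpF : ‖F (L s) - p‖ ≤ Real.pi := by
    refine (Complex.norm_le_abs_re_add_abs_im _).trans ?_
    have h1 : |((F (L s)).im - w.arg) / (2 * Real.pi) - k| ≤ 1 / 2 := abs_sub_round _
    have h2 : (F (L s)).im - (w.arg + k * (2 * Real.pi)) =
        2 * Real.pi * (((F (L s)).im - w.arg) / (2 * Real.pi) - k) := by
      have := Real.pi_pos
      field_simp
      ring
    rw [Complex.sub_re, Complex.sub_im, hFs', hpre, hpim, h2, sub_self, abs_zero, zero_add,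
      abs_mul, abs_of_pos Real.two_pi_pos]
    nlinarith [Real.pi_pos]
  have hn2 : ‖(2 * Real.pi * Complex.I : ℂ)‖ = 2 * Real.pi := by
    simp [abs_of_pos Real.pi_pos]
  have hne2 : (2 * Real.pi * Complex.I : ℂ) ≠ 0 := Complex.two_pi_I_ne_zero
  by_contra! hno
  have hLre : ∀ s, (L s).re = Real.log ‖z₁‖ := fun s => by simp [L]
  have hom : ∀ ζ ∈ Metric.ball (L s) 16, ∀ n : ℤ, (F ζ - p) / (2 * Real.pi * Complex.I) ≠ n := by
    intro ζ hζ n hn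
    rw [div_eq_iff hne2] at hn
    refine hno (Complex.exp ζ) (Complex.exp_ne_zero ζ) ?_ ?_
    · rw [Complex.norm_exp, Real.log_exp, ← hLre s, ← Complex.sub_re]
      exact (Complex.abs_re_le_norm _).trans (mem_ball_iff_norm.1 hζ).le
    · rw [hfF, ← hp n, ← hn, add_sub_cancel]
  have hS := norm_le_of_omits_int (q := fun ζ => (F ζ - p) / (2 * Real.pi * Complex.I))
    ((hF.sub_const p).div_const _).differentiableOn hom
    (by
      rw [norm_div, hn2, div_le_iff₀ Real.two_pi_pos]
      linarith) (z := L z₁.arg)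
    (by
      have : L z₁.arg - L s = ((z₁.arg - s : ℝ) : ℂ) * Complex.I := by simp [L]; ring
      rw [this, norm_mul, Complex.norm_I, mul_one, Complex.norm_real]
      exact hsdist)
  rw [norm_div, hn2, div_le_iff₀ Real.two_pi_pos] at hS
  have h1 : (F (L z₁.arg) - p).re ≤ Real.exp 450 * (2 * Real.pi) :=
    (Complex.re_le_norm _).trans hS
  rw [Complex.sub_re, ← hre, hL₁, hpre] at h1
  nlinarith [Real.pi_lt_four, Real.exp_pos 450]

/-- An entire function whose real part is at most linear in `log ‖z‖` on arbitrarily large circles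
is constant. -/
lemma eq_const_of_re_le_mul_log {g : ℂ → ℂ} (hg : Differentiable ℂ g) {K : ℝ} (hK : 0 < K)
    (hgK : ∀ T : ℝ, ∃ t ≥ T, ∀ z : ℂ, ‖z‖ = Real.exp t → (g z).re ≤ K * t) :
    ∃ c, ∀ z, g z = c := by
  refine ⟨g 0, fun z => is_const_of_deriv_eq_zero hg (fun z₀ => ?_) z 0⟩
  by_contra hne
  have hpos : 0 < ‖deriv g z₀‖ := norm_pos_iff.2 hne
  obtain ⟨K', hK'⟩ : ∃ K', K' = 8 * (2 * K + 3 * ‖g 0‖) := ⟨_, rfl⟩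
  have hK'0 : 0 < K' := by rw [hK']; positivity
  obtain ⟨t, ht, hgt⟩ := hgK (1 + 4 * ‖z₀‖ + K' / ‖deriv g z₀‖)
  have hq0 : 0 < K' / ‖deriv g z₀‖ := by positivity
  have hz0 := norm_nonneg z₀
  have ht1 : 1 ≤ t := by linarith
  have hexp1 : t + 1 ≤ Real.exp t := Real.add_one_le_exp t
  have hexp2 : t ^ 2 / 2 ≤ Real.exp t := by
    have := Real.quadratic_le_exp_of_nonneg (by linarith : 0 ≤ t)
    linarith
  have hball : ∀ z ∈ Metric.ball (0 : ℂ) (Real.exp t), (g z).re ≤ K * t := by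
    intro z hz
    have h1 := Complex.norm_le_of_forall_mem_frontier_norm_le (f := fun z => Complex.exp (g z))
      (U := Metric.ball (0 : ℂ) (Real.exp t)) Metric.isBounded_ball
      hg.cexp.diffContOnCl (C := Real.exp (K * t)) (fun w hw => by
        rw [frontier_ball _ (Real.exp_pos t).ne'] at hw
        rw [Complex.norm_exp]
        exact Real.exp_le_exp.2 (hgt w (by simpa using hw))) (subset_closure hz)
    rw [Complex.norm_exp] at h1
    exact Real.exp_le_exp.1 h1
  have hhalf : ∀ z : ℂ, ‖z‖ ≤ Real.exp t / 2 → ‖g z‖ ≤ (2 * K + 3 * ‖g 0‖) * t := by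
    intro z hz
    have h0 := Real.exp_pos t
    have h1 := Complex.borelCaratheodory (f := g) (M := K * t) (by positivity)
      hg.differentiableOn hball h0 (z := z) (by rw [mem_ball_zero_iff]; linarith)
    have hd : 0 < Real.exp t - ‖z‖ := by linarith
    have h2 : 2 * (K * t) * ‖z‖ / (Real.exp t - ‖z‖) ≤ 2 * (K * t) := by
      rw [div_le_iff₀ hd]
      gcongr
      linarith
    have h3 : ‖g 0‖ * (Real.exp t + ‖z‖) / (Real.exp t - ‖z‖) ≤ 3 * ‖g 0‖ := by
      rw [div_le_iff₀ hd]
      nlinarith [norm_nonneg (g 0)]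
    nlinarith [norm_nonneg (g 0)]
  have hder : ‖deriv g z₀‖ ≤ (2 * K + 3 * ‖g 0‖) * t / (Real.exp t / 4) :=
    Complex.norm_deriv_le_of_forall_mem_sphere_norm_le (by positivity) hg.diffContOnCl
      (fun z hz => hhalf z (by
        have h1 : ‖z - z₀‖ = Real.exp t / 4 := by simpa [dist_eq_norm] using hz
        have h2 : ‖z‖ ≤ ‖z - z₀‖ + ‖z₀‖ := by simpa using norm_add_le (z - z₀) z₀
        linarith))
  have h1 : (2 * K + 3 * ‖g 0‖) * t / (Real.exp t / 4) ≤ K' / t := by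
    rw [div_le_div_iff₀ (by positivity) (by linarith), hK']
    have : 0 ≤ 2 * K + 3 * ‖g 0‖ := by positivity
    nlinarith
  have h2 : K' / t < ‖deriv g z₀‖ := by
    rw [div_lt_iff₀ (by linarith), ← div_lt_iff₀' hpos]
    linarith
  linarith

namespace IsTranscendentalSelfMapCStar

variable {f : ℂ → ℂ}

lemma ne_zero (hf : IsTranscendentalSelfMapCStar f) {z : ℂ} (hz : z ≠ 0) : f z ≠ 0 := by
  obtain ⟨m, g, h, -, -, -, -, hfe⟩ := hf
  rw [hfe z hz]
  exact mul_ne_zero (zpow_ne_zero _ hz) (Complex.exp_ne_zero _)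

lemma differentiableOn_s4 (hf : IsTranscendentalSelfMapCStar f) :
    DifferentiableOn ℂ f {0}ᶜ := by
  obtain ⟨m, g, h, hg, hh, -, -, hfe⟩ := hf
  refine DifferentiableOn.congr (f := fun z => z ^ m * Complex.exp (g z + h z⁻¹))
    (fun z hz => ?_) hfe
  have hz' : z ≠ 0 := hz
  have h1 : DifferentiableAt ℂ (fun z : ℂ => z ^ m) z :=
    differentiableAt_zpow.2 (Or.inl hz')
  have h2 : DifferentiableAt ℂ (fun z : ℂ => h z⁻¹) z :=
    (hh z⁻¹).comp z (differentiableAt_inv hz')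
  exact (h1.mul ((hg z).add h2).cexp).differentiableWithinAt

lemma inv (hf : IsTranscendentalSelfMapCStar f) :
    IsTranscendentalSelfMapCStar fun z => (f z)⁻¹ := by
  obtain ⟨m, g, h, hg, hh, hgc, hhc, hfe⟩ := hf
  refine ⟨-m, fun z => -g z, fun z => -h z, hg.neg, hh.neg, ?_, ?_, fun z hz => ?_⟩
  · rintro ⟨c, hc⟩
    exact hgc ⟨-c, fun z => by rw [← hc z, neg_neg]⟩
  · rintro ⟨c, hc⟩
    exact hhc ⟨-c, fun z => by rw [← hc z, neg_neg]⟩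
  · change (f z)⁻¹ = z ^ (-m) * Complex.exp (-g z + -h z⁻¹)
    rw [hfe z hz, mul_inv, ← Complex.exp_neg, zpow_neg]
    ring_nf

lemma comp_inv (hf : IsTranscendentalSelfMapCStar f) :
    IsTranscendentalSelfMapCStar fun z => f z⁻¹ := by
  obtain ⟨m, g, h, hg, hh, hgc, hhc, hfe⟩ := hf
  refine ⟨-m, h, g, hh, hg, hhc, hgc, fun z hz => ?_⟩
  change f z⁻¹ = z ^ (-m) * Complex.exp (h z + g z⁻¹)
  rw [hfe _ (inv_ne_zero hz), inv_inv, inv_zpow', add_comm]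

/-- The maximum modulus grows faster than any power of the radius. -/
lemma exists_mul_le_log_norm (hf : IsTranscendentalSelfMapCStar f) (c : ℝ) :
    ∃ T : ℝ, ∀ t ≥ T, ∃ z : ℂ, z ≠ 0 ∧ Real.log ‖z‖ = t ∧ c * t ≤ Real.log ‖f z‖ := by
  by_contra! hcon
  obtain ⟨m, g, h, hg, hh, hgc, -, hfe⟩ := hf
  obtain ⟨B, hB⟩ := (isCompact_closedBall (0 : ℂ) 1).exists_bound_of_continuousOn
    hh.continuous.continuousOn
  refine hgc (eq_const_of_re_le_mul_log hg (K := |c| + |(m : ℝ)| + |B| + 1) (by positivity)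
    fun T => ?_)
  obtain ⟨t, ht, hlt⟩ := hcon (max T 1)
  have ht1 : 1 ≤ t := (le_max_right _ _).trans ht
  refine ⟨t, (le_max_left _ _).trans ht, fun z hz => ?_⟩
  have hz0 : z ≠ 0 := norm_pos_iff.1 (hz ▸ Real.exp_pos t)
  have hlog : Real.log ‖z‖ = t := by rw [hz, Real.log_exp]
  have h1 := hlt z hz0 hlog
  rw [hfe z hz0, norm_mul, norm_zpow, Complex.norm_exp, Real.log_mul
    (zpow_ne_zero _ (norm_ne_zero_iff.2 hz0)) (Real.exp_pos _).ne', Real.log_zpow, Real.log_exp,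
    hlog, Complex.add_re] at h1
  have h2 : ‖h z⁻¹‖ ≤ B := hB _ (by
    rw [mem_closedBall_zero_iff, norm_inv, hz]
    exact inv_le_one_of_one_le₀ (Real.one_le_exp (by linarith)))
  have h3 := (abs_le.1 (Complex.abs_re_le_norm (h z⁻¹))).1
  have h4 := le_abs_self B
  have h5 := le_abs_self c
  have h6 := neg_abs_le (m : ℝ)
  nlinarith [abs_nonneg B]

/-- One step of the construction near `∞`: the map sends the circle at logarithmic height `t - 16`
below height `t₁ - 16`, while the image of the annulus around height `t` covers the annulus around
height `t₁`. -/
lemma exists_step (hf : IsTranscendentalSelfMapCStar f) :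
    ∃ T : ℝ, ∀ t ≥ T, ∃ t₁ ≥ t + 1,
      (∀ z, z ≠ 0 → Real.log ‖z‖ = t - 16 → Real.log ‖f z‖ < t₁ - 16) ∧
      ∀ w, w ≠ 0 → |Real.log ‖w‖ - t₁| ≤ 16 →
        ∃ z, z ≠ 0 ∧ |Real.log ‖z‖ - t| ≤ 16 ∧ f z = w := by
  obtain ⟨C, hC0, hC⟩ := exists_covering_const
  obtain ⟨c, hc⟩ := exists_nat_gt ((C + 32) / 16)
  have hc16 : C + 32 < 16 * c := by rw [div_lt_iff₀ (by norm_num)] at hc; linarith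
  have hc1 : (1 : ℝ) ≤ c := by linarith
  obtain ⟨T₁, hT₁⟩ := hf.exists_mul_le_log_norm (c + 1)
  obtain ⟨T₂, hT₂⟩ := hf.inv.exists_mul_le_log_norm 0
  have hne0 : ∀ s : ℝ, Metric.sphere (0 : ℂ) (Real.exp s) ⊆ {0}ᶜ := fun s z hz =>
    norm_pos_iff.1 ((mem_sphere_zero_iff_norm.1 hz) ▸ Real.exp_pos s)
  obtain ⟨B, hB⟩ := (isCompact_sphere (0 : ℂ) (Real.exp 0)).exists_bound_of_continuousOn
    (hf.differentiableOn_s4.continuousOn.mono (hne0 0))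
  refine ⟨max (max T₁ T₂) (max |B| (C + 17)), fun t ht => ?_⟩
  have htT₁ : T₁ ≤ t := ((le_max_left _ _).trans (le_max_left _ _)).trans ht
  have htT₂ : T₂ ≤ t := ((le_max_right _ _).trans (le_max_left _ _)).trans ht
  have htB : |B| ≤ t := ((le_max_left _ _).trans (le_max_right _ _)).trans ht
  have htC : C + 17 ≤ t := ((le_max_right _ _).trans (le_max_right _ _)).trans ht
  obtain ⟨z₁, hz₁, hmax⟩ := (isCompact_sphere (0 : ℂ) (Real.exp t)).exists_isMaxOn
    ⟨(Real.exp t : ℝ), by simp [Complex.norm_exp]⟩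
    (hf.differentiableOn_s4.continuousOn.mono (hne0 t)).norm
  have hz₁0 : z₁ ≠ 0 := hne0 t hz₁
  have hz₁n : ‖z₁‖ = Real.exp t := mem_sphere_zero_iff_norm.1 hz₁
  have hfz₁ : 0 < ‖f z₁‖ := norm_pos_iff.2 (hf.ne_zero hz₁0)
  obtain ⟨M, hM⟩ : ∃ M, M = Real.log ‖f z₁‖ := ⟨_, rfl⟩
  have hMe : ‖f z₁‖ = Real.exp M := by rw [hM, Real.exp_log hfz₁]
  have hMt : (c + 1) * t ≤ M := by
    obtain ⟨z, hz0, hzt, hzM⟩ := hT₁ t htT₁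
    refine hzM.trans (hM ▸ Real.log_le_log (norm_pos_iff.2 (hf.ne_zero hz0)) (hmax ?_))
    rw [mem_sphere_zero_iff_norm, ← hzt, Real.exp_log (norm_pos_iff.2 hz0)]
  have hnormt : ∀ z : ℂ, z ≠ 0 → ‖z‖ = Real.exp (Real.log ‖z‖) := fun z hz =>
    (Real.exp_log (norm_pos_iff.2 hz)).symm
  refine ⟨M - C - 16, by nlinarith, fun z hz0 hzt => ?_, fun w hw0 hwt => ?_⟩
  · have hU : IsOpen {z : ℂ | 1 < ‖z‖ ∧ ‖z‖ < Real.exp t} :=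
      (isOpen_lt continuous_const continuous_norm).inter
        (isOpen_lt continuous_norm continuous_const)
    have hcl : closure {z : ℂ | 1 < ‖z‖ ∧ ‖z‖ < Real.exp t} ⊆
        {z : ℂ | 1 ≤ ‖z‖ ∧ ‖z‖ ≤ Real.exp t} :=
      closure_minimal (fun z hz => ⟨hz.1.le, hz.2.le⟩)
        ((isClosed_le continuous_const continuous_norm).inter
          (isClosed_le continuous_norm continuous_const))
    have hcl0 : ∀ z ∈ closure {z : ℂ | 1 < ‖z‖ ∧ ‖z‖ < Real.exp t}, z ≠ 0 := fun z hz =>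
      norm_pos_iff.1 (zero_lt_one.trans_le (hcl hz).1)
    have hmaxp := Complex.norm_le_of_forall_mem_frontier_norm_le
      (f := fun z => f z / z ^ c) (U := {z : ℂ | 1 < ‖z‖ ∧ ‖z‖ < Real.exp t})
      (Metric.isBounded_ball.subset (s := {z : ℂ | 1 < ‖z‖ ∧ ‖z‖ < Real.exp t})
        (t := Metric.ball (0 : ℂ) (Real.exp t)) fun z hz => mem_ball_zero_iff.2 hz.2)
      (DifferentiableOn.diffContOnCl
        ((hf.differentiableOn_s4.mono hcl0).div (differentiableOn_pow c)
          fun z hz => pow_ne_zero _ (hcl0 z hz))) (C := Real.exp (M - c * t))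
      (fun z hz => by
        rw [hU.frontier_eq] at hz
        obtain ⟨h1, h2⟩ := hcl hz.1
        rw [norm_div, norm_pow]
        rcases h1.eq_or_lt with h1 | h1
        · rw [← h1, one_pow, div_one]
          have := hB z (by simpa using h1.symm)
          have h3 := Real.add_one_le_exp (M - c * t)
          have h4 := le_abs_self B
          nlinarith
        · have h3 : ‖z‖ = Real.exp t := le_antisymm h2 (not_lt.1 fun h => hz.2 ⟨h1, h⟩)
          have h4 : ‖f z‖ ≤ ‖f z₁‖ := hmax (by simpa using h3)
          rw [h3, ← Real.exp_nat_mul, Real.exp_sub, ← hMe]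
          gcongr)
      (z := z) (subset_closure (by
        rw [Set.mem_ofPred_eq, hnormt z hz0, hzt]
        exact ⟨Real.one_lt_exp_iff.2 (by linarith), Real.exp_lt_exp.2 (by linarith)⟩))
    rw [norm_div, norm_pow, div_le_iff₀ (pow_pos (norm_pos_iff.2 hz0) _), hnormt z hz0, hzt,
      ← Real.exp_nat_mul, ← Real.exp_add] at hmaxp
    have h1 := Real.log_le_log (norm_pos_iff.2 (hf.ne_zero hz0)) hmaxp
    rw [Real.log_exp] at h1
    linarith
  · obtain ⟨z₂, hz₂0, hz₂t, hz₂⟩ := hT₂ t htT₂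
    rw [norm_inv, Real.log_inv] at hz₂
    have hw := abs_le.1 hwt
    obtain ⟨z, hz0, hzt, hfz⟩ := hC f hf z₁ z₂ w hz₁0 hz₂0 hw0
      (by rw [hz₁n, hnormt z₂ hz₂0, hz₂t]) (by nlinarith [hw.1]) (by linarith [hw.2])
    rw [hz₁n, Real.log_exp] at hzt
    exact ⟨z, hz0, hzt, hfz⟩

end IsTranscendentalSelfMapCStar

/-- The coordinate on `ℂ*` in which the end `∞` (for `true`) or `0` (for `false`) is at `∞`. -/
def endFlip (b : Bool) (z : ℂ) : ℂ := if b then z else z⁻¹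

/-- The logarithmic height of a point of `ℂ*` above the unit circle, in the direction of the end
`∞` (for `true`) or `0` (for `false`). -/
def endLevel (b : Bool) (z : ℂ) : ℝ := Real.log ‖endFlip b z‖

/-- The point of the Riemann sphere representing the end `∞` (for `true`) or `0` (for `false`). -/
def endPoint (b : Bool) : OnePoint ℂ := if b then ∞ else ((0 : ℂ) : OnePoint ℂ)

/-- Points of `ℂ*` whose `n`-th iterate has height at least `a n` in the direction `s n`. -/
def orbitSet (f : ℂ → ℂ) (s : ℕ → Bool) (a : ℕ → ℝ) : Set ℂ :=
  {z | z ≠ 0 ∧ ∀ n, a n ≤ endLevel (s n) (f^[n] z)}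

lemma endFlip_ne_zero {b : Bool} {z : ℂ} (hz : z ≠ 0) : endFlip b z ≠ 0 := by
  cases b <;> simpa [endFlip]

@[simp]
lemma endFlip_endFlip (b : Bool) (z : ℂ) : endFlip b (endFlip b z) = z := by
  cases b <;> simp [endFlip]

lemma differentiableOn_endFlip (b : Bool) : DifferentiableOn ℂ (endFlip b) {0}ᶜ := by
  cases b
  · exact differentiableOn_inv
  · exact differentiableOn_id

lemma continuousOn_endLevel (b : Bool) : ContinuousOn (endLevel b) {0}ᶜ :=
  (differentiableOn_endFlip b).continuousOn.norm.log fun _ hz =>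
    norm_ne_zero_iff.2 (endFlip_ne_zero hz)

lemma endLevel_pos_iff {b : Bool} {z : ℂ} (hz : z ≠ 0) :
    0 < endLevel b z ↔ if b then 1 < ‖z‖ else ‖z‖ < 1 := by
  rw [endLevel, Real.log_pos_iff (norm_nonneg _)]
  cases b
  · simpa [endFlip] using one_lt_inv₀ (norm_pos_iff.2 hz)
  · simp [endFlip]

lemma isCompact_endLevel_mem_Icc (b : Bool) (c d : ℝ) :
    IsCompact {z | z ≠ 0 ∧ c ≤ endLevel b z ∧ endLevel b z ≤ d} := by
  have hK : IsCompact (Metric.closedBall (0 : ℂ) (Real.exp d) \ Metric.ball 0 (Real.exp c)) :=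
    (isCompact_closedBall _ _).diff Metric.isOpen_ball
  have hK0 : Metric.closedBall (0 : ℂ) (Real.exp d) \ Metric.ball 0 (Real.exp c) ⊆ {0}ᶜ := by
    rintro z ⟨-, hz⟩ rfl
    exact hz (Metric.mem_ball_self (Real.exp_pos c))
  have hmem : ∀ z : ℂ, z ≠ 0 → (z ∈ Metric.closedBall (0 : ℂ) (Real.exp d) \
      Metric.ball 0 (Real.exp c) ↔ c ≤ Real.log ‖z‖ ∧ Real.log ‖z‖ ≤ d) := fun z hz => by
    rw [Set.mem_sdiff, mem_closedBall_zero_iff, mem_ball_zero_iff, not_lt, and_comm,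
      Real.le_log_iff_exp_le (norm_pos_iff.2 hz), Real.log_le_iff_le_exp (norm_pos_iff.2 hz)]
  convert hK.image_of_continuousOn ((differentiableOn_endFlip b).continuousOn.mono hK0) using 1
  ext z
  constructor
  · rintro ⟨hz, h⟩
    exact ⟨endFlip b z, (hmem _ (endFlip_ne_zero hz)).2 h, endFlip_endFlip b z⟩
  · rintro ⟨w, hw, rfl⟩
    have hw0 : w ≠ 0 := hK0 hw
    refine ⟨endFlip_ne_zero hw0, ?_⟩
    rw [endLevel, endFlip_endFlip]
    exact (hmem w hw0).1 hw

section Dynamics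

variable {f : ℂ → ℂ} {s : ℕ → Bool} {a : ℕ → ℝ}

lemma continuousOn_endLevel_iterate (hd : DifferentiableOn ℂ f {0}ᶜ) (hm : MapsTo f {0}ᶜ {0}ᶜ)
    (k : ℕ) : ContinuousOn (fun z => endLevel (s k) (f^[k] z)) {0}ᶜ :=
  (continuousOn_endLevel _).comp (hd.iterate hm k).continuousOn (hm.iterate k)

lemma inter_orbitSet_nonempty (hd : DifferentiableOn ℂ f {0}ᶜ) (hm : MapsTo f {0}ᶜ {0}ᶜ)
    {K : Set ℂ} (hK : IsCompact K) (hK0 : K ⊆ {0}ᶜ)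
    (h : ∀ n, ∃ z ∈ K, ∀ k ≤ n, a k ≤ endLevel (s k) (f^[k] z)) :
    (K ∩ orbitSet f s a).Nonempty := by
  have hcl : ∀ k, IsClosed (K ∩ (fun z => endLevel (s k) (f^[k] z)) ⁻¹' Set.Ici (a k)) := fun k =>
    ((continuousOn_endLevel_iterate hd hm k).mono hK0).preimage_isClosed_of_isClosed
      hK.isClosed isClosed_Ici
  obtain ⟨z, hz⟩ := IsCompact.nonempty_iInter_of_sequence_nonempty_isCompact_isClosed
    (fun n => ⋂ k ≤ n, K ∩ (fun z => endLevel (s k) (f^[k] z)) ⁻¹' Set.Ici (a k))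
    (fun n => Set.biInter_subset_biInter_left fun k hk => Nat.le_succ_of_le hk)
    (fun n => by
      obtain ⟨z, hzK, hz⟩ := h n
      exact ⟨z, Set.mem_iInter₂.2 fun k hk => ⟨hzK, hz k hk⟩⟩)
    (hK.of_isClosed_subset (isClosed_biInter fun k _ => hcl k)
      fun z hz => (Set.mem_iInter₂.1 hz 0 le_rfl).1)
    (fun n => isClosed_biInter fun k _ => hcl k)
  have hz' : ∀ n, z ∈ K ∩ (fun z => endLevel (s n) (f^[n] z)) ⁻¹' Set.Ici (a n) := fun n =>
    Set.mem_iInter₂.1 (Set.mem_iInter.1 hz n) n le_rfl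
  exact ⟨z, (hz' 0).1, hK0 (hz' 0).1, fun n => (hz' n).2⟩

lemma exists_mem_frontier_le_endLevel (hd : DifferentiableOn ℂ f {0}ᶜ) (hm : MapsTo f {0}ᶜ {0}ᶜ)
    (hlow : ∀ n z, z ≠ 0 → endLevel (s n) z = a n → endLevel (s (n + 1)) (f z) < a (n + 1))
    {V : Set ℂ} (hV : IsOpen V) (hVb : Bornology.IsBounded V) (hV0 : (0 : ℂ) ∉ closure V)
    {z : ℂ} (hzV : z ∈ V) {n : ℕ} (hz : ∀ k ≤ n, a k ≤ endLevel (s k) (f^[k] z)) :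
    ∃ p ∈ frontier V, ∀ k ≤ n, a k ≤ endLevel (s k) (f^[k] p) := by
  have hcl0 : ∀ p ∈ closure V, p ≠ 0 := fun p hp h => hV0 (h ▸ hp)
  let O : Set ℂ := {0}ᶜ ∩ ⋂ k ∈ Finset.range n,
    ({0}ᶜ ∩ (fun z => endLevel (s k) (f^[k] z)) ⁻¹' Set.Ioi (a k))
  have hO : IsOpen O := isOpen_compl_singleton.inter (isOpen_biInter_finset fun k _ =>
    (continuousOn_endLevel_iterate hd hm k).isOpen_inter_preimage isOpen_compl_singleton isOpen_Ioi)
  have hOlt : ∀ p ∈ O, ∀ k < n, a k < endLevel (s k) (f^[k] p) := fun p hp k hk =>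
    (Set.mem_iInter₂.1 hp.2 k (Finset.mem_range.2 hk)).2
  have hOcl : ∀ p ∈ closure O, p ≠ 0 → ∀ k < n, a k ≤ endLevel (s k) (f^[k] p) := by
    intro p hp hp0 k hk
    by_contra! hlt
    obtain ⟨q, hq, hqO⟩ := mem_closure_iff.1 hp _
      ((continuousOn_endLevel_iterate hd hm k).isOpen_inter_preimage isOpen_compl_singleton
        isOpen_Iio) ⟨hp0, hlt⟩
    exact lt_asymm hq.2 (hOlt q hqO k hk)
  have hmemO : ∀ p, p ≠ 0 → (∀ k ≤ n, a k ≤ endLevel (s k) (f^[k] p)) → p ∈ O := by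
    refine fun p hp0 hp => ⟨hp0, Set.mem_iInter₂.2 fun k hk => ⟨hp0, ?_⟩⟩
    have hk := Finset.mem_range.1 hk
    refine lt_of_le_of_ne (hp k hk.le) fun heq => ?_
    have h1 := hlow k (f^[k] p) (hm.iterate k hp0) heq.symm
    rw [← Function.iterate_succ_apply' f] at h1
    exact (hp (k + 1) hk).not_gt h1
  have hVOcl : closure (V ∩ O) ⊆ {0}ᶜ := fun p hp => hcl0 p (closure_mono inter_subset_left hp)
  have hzVO : z ∈ V ∩ O := ⟨hzV, hmemO z (hcl0 z (subset_closure hzV)) hz⟩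
  obtain ⟨p, hp, hmax⟩ := Complex.exists_mem_frontier_isMaxOn_norm
    (f := fun z => endFlip (s n) (f^[n] z)) (hVb.subset inter_subset_left) ⟨z, hzVO⟩
    (((differentiableOn_endFlip (s n)).comp (hd.iterate hm n)
      (hm.iterate n)).mono hVOcl).diffContOnCl
  have hpcl : p ∈ closure (V ∩ O) := hp.1
  have hp0 : p ≠ 0 := hVOcl hpcl
  have hpn : a n ≤ endLevel (s n) (f^[n] p) := (hz n le_rfl).trans <|
    Real.log_le_log (norm_pos_iff.2 (endFlip_ne_zero (hm.iterate n hzVO.2.1)))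
      (hmax (subset_closure hzVO))
  have hple : ∀ k ≤ n, a k ≤ endLevel (s k) (f^[k] p) := fun k hk =>
    hk.eq_or_lt.elim (fun h => h ▸ hpn)
      (hOcl p (closure_mono inter_subset_right hpcl) hp0 k)
  refine ⟨p, ⟨closure_mono inter_subset_left hpcl, fun hpV => ?_⟩, hple⟩
  rw [(hV.inter hO).frontier_eq] at hp
  exact hp.2 ⟨hV.interior_eq ▸ hpV, hmemO p hp0 hple⟩

lemma isClosed_insert_endPoint (hd : DifferentiableOn ℂ f {0}ᶜ) (hm : MapsTo f {0}ᶜ {0}ᶜ)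
    (ha : 0 < a 0) :
    IsClosed (insert (endPoint (s 0)) ((fun z : ℂ => (z : OnePoint ℂ)) '' orbitSet f s a)) := by
  have hopen : IsOpen (⋃ n, ({0}ᶜ ∩ (fun z => endLevel (s n) (f^[n] z)) ⁻¹' Set.Iio (a n))) :=
    isOpen_iUnion fun n =>
      (continuousOn_endLevel_iterate hd hm n).isOpen_inter_preimage isOpen_compl_singleton isOpen_Iio
  have hcl : IsClosed (insert 0 (orbitSet f s a)) := by
    rw [← isOpen_compl_iff]
    convert hopen using 1
    ext z
    by_cases hz : z = 0 <;> simp [hz, orbitSet]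
  have hpos : ∀ z ∈ orbitSet f s a, 0 < endLevel (s 0) z := fun z hz => ha.trans_le (hz.2 0)
  cases hs : s 0
  · have : insert (endPoint false) ((fun z : ℂ => (z : OnePoint ℂ)) '' orbitSet f s a) =
        (fun z : ℂ => (z : OnePoint ℂ)) '' insert 0 (orbitSet f s a) := by
      rw [Set.image_insert_eq]
      simp [endPoint]
    rw [this, OnePoint.isClosed_image_coe]
    refine ⟨hcl, (isCompact_closedBall (0 : ℂ) 1).of_isClosed_subset hcl ?_⟩
    rintro z (rfl | hz)
    · simp
    · have h1 := (endLevel_pos_iff hz.1).1 (hpos z hz)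
      simp only [hs] at h1
      exact mem_closedBall_zero_iff.2 (by simpa using h1.le)
  · rw [OnePoint.isClosed_iff_of_mem (by simp [endPoint])]
    have : (fun z : ℂ => (z : OnePoint ℂ)) ⁻¹' insert (endPoint true)
        ((fun z : ℂ => (z : OnePoint ℂ)) '' orbitSet f s a) =
        insert 0 (orbitSet f s a) ∩ {z | 1 ≤ ‖z‖} := by
      ext z
      constructor
      · rintro (h | ⟨w, hw, h⟩)
        · simp [endPoint] at h
        · obtain rfl : w = z := OnePoint.coe_injective h
          have h1 := (endLevel_pos_iff hw.1).1 (hpos w hw)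
          simp only [hs] at h1
          exact ⟨Or.inr hw, by simpa using h1.le⟩
      · rintro ⟨rfl | hz, h⟩
        · norm_num at h
        · exact Or.inr ⟨z, hz, rfl⟩
    rw [this]
    exact hcl.inter (isClosed_le continuous_const continuous_norm)

lemma isBounded_and_zero_notMem_closure {b : Bool} {U V : Set (OnePoint ℂ)} (hU : IsOpen U)
    (hb : endPoint b ∈ U) (hUV : Disjoint U V) :
    Bornology.IsBounded {z : ℂ | (z : OnePoint ℂ) ∈ V ∧ z ≠ 0 ∧ 0 < endLevel b z} ∧
      (0 : ℂ) ∉ closure {z : ℂ | (z : OnePoint ℂ) ∈ V ∧ z ≠ 0 ∧ 0 < endLevel b z} := by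
  cases b
  · refine ⟨Metric.isBounded_ball.subset (t := Metric.ball (0 : ℂ) 1) fun z hz => ?_, fun h => ?_⟩
    · simpa using (endLevel_pos_iff hz.2.1).1 hz.2.2
    · obtain ⟨z, hzU, hz⟩ := mem_closure_iff.1 h _ (hU.preimage OnePoint.continuous_coe)
        (by simpa [endPoint] using hb)
      exact Set.disjoint_left.1 hUV hzU hz.1
  · refine ⟨?_, fun h => ?_⟩
    · have hc := ((OnePoint.isOpen_iff_of_mem (by simpa [endPoint] using hb)).1 hU).2
      exact hc.isBounded.subset fun z hz hzU => Set.disjoint_left.1 hUV hzU hz.1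
    · have := closure_minimal (t := {z : ℂ | 1 ≤ ‖z‖}) (fun z hz => by
        have h1 := (endLevel_pos_iff hz.2.1).1 hz.2.2
        simp only [if_true] at h1
        exact h1.le) (isClosed_le continuous_const continuous_norm) h
      norm_num at this

/-- The orbit set together with the end to which its points are close is connected. -/
lemma isPreconnected_insert_endPoint (hd : DifferentiableOn ℂ f {0}ᶜ) (hm : MapsTo f {0}ᶜ {0}ᶜ)
    (ha : 0 < a 0)
    (hlow : ∀ n z, z ≠ 0 → endLevel (s n) z = a n → endLevel (s (n + 1)) (f z) < a (n + 1)) :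
    IsPreconnected
      (insert (endPoint (s 0)) ((fun z : ℂ => (z : OnePoint ℂ)) '' orbitSet f s a)) := by
  rw [isPreconnected_iff_subset_of_fully_disjoint_closed (isClosed_insert_endPoint hd hm ha)]
  have key : ∀ u v : Set (OnePoint ℂ), IsClosed u → IsClosed v →
      insert (endPoint (s 0)) ((fun z : ℂ => (z : OnePoint ℂ)) '' orbitSet f s a) ⊆ u ∪ v →
      Disjoint u v → endPoint (s 0) ∈ u →
      insert (endPoint (s 0)) ((fun z : ℂ => (z : OnePoint ℂ)) '' orbitSet f s a) ⊆ u := by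
    rintro u v hu hv hsub huv hbu _ (rfl | ⟨x, hx, rfl⟩)
    · exact hbu
    refine (hsub (Or.inr ⟨x, hx, rfl⟩)).resolve_right fun hxv => ?_
    obtain ⟨U, V, hU, hV, huU, hvV, hUV⟩ := normal_separation hu hv huv
    obtain ⟨W, hWdef⟩ : ∃ W, W = {z : ℂ | (z : OnePoint ℂ) ∈ V ∧ z ≠ 0 ∧ 0 < endLevel (s 0) z} :=
      ⟨_, rfl⟩
    have hW : IsOpen W := hWdef ▸ (hV.preimage OnePoint.continuous_coe).inter
      ((continuousOn_endLevel (s 0)).isOpen_inter_preimage isOpen_compl_singleton isOpen_Ioi)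
    obtain ⟨hWb, hW0⟩ := isBounded_and_zero_notMem_closure hU (huU hbu) hUV
    rw [← hWdef] at hWb hW0
    have hpos : ∀ z ∈ orbitSet f s a, 0 < endLevel (s 0) z := fun z hz => ha.trans_le (hz.2 0)
    have hxW : x ∈ W := hWdef ▸ ⟨hvV hxv, hx.1, hpos x hx⟩
    obtain ⟨p, hpW, hp⟩ := inter_orbitSet_nonempty hd hm (s := s) (a := a) (K := frontier W)
      (hWb.isCompact_closure.of_isClosed_subset isClosed_frontier frontier_subset_closure)
      (fun p hp h => hW0 (h ▸ frontier_subset_closure hp))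
      fun n => exists_mem_frontier_le_endLevel hd hm hlow hW hWb hW0 hxW fun k _ => hx.2 k
    rw [hW.frontier_eq] at hpW
    rcases hsub (Or.inr ⟨p, hp, rfl⟩) with hpu | hpv
    · obtain ⟨q, hqU, hqW⟩ := mem_closure_iff.1 hpW.1 _ (hU.preimage OnePoint.continuous_coe)
        (huU hpu)
      rw [hWdef] at hqW
      exact Set.disjoint_left.1 hUV hqU hqW.1
    · exact hpW.2 (hWdef ▸ ⟨hvV hpv, hp.1, hpos p hp⟩)
  intro u v hu hv hsub huv
  rcases hsub (Set.mem_insert _ _) with h | h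
  · exact Or.inl (key u v hu hv hsub huv h)
  · exact Or.inr (key v u hv hu (Set.union_comm u v ▸ hsub) huv.symm h)

lemma orbitSet_subset_escapingSet (ha : ∀ n : ℕ, (n : ℝ) + 1 ≤ a n) :
    orbitSet f s a ⊆ escapingSet f := by
  refine fun z hz => ⟨hz.1, fun ε hε => ?_⟩
  obtain ⟨N, hN⟩ := exists_nat_gt (-Real.log ε)
  refine ⟨N, fun n hn => ?_⟩
  have hn' : (N : ℝ) ≤ n := Nat.cast_le.2 hn
  have h1 : -Real.log ε < endLevel (s n) (f^[n] z) := by linarith [ha n, hz.2 n]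
  have hne : f^[n] z ≠ 0 := by
    intro h0
    have := hz.2 n
    have h2 : endLevel (s n) (f^[n] z) = 0 := by
      rw [h0]
      cases s n <;> simp [endLevel, endFlip]
    linarith [ha n, (Nat.cast_nonneg n : (0 : ℝ) ≤ n)]
  have hpos := norm_pos_iff.2 hne
  cases hs : s n <;> simp only [hs, endLevel, endFlip, if_true, Bool.false_eq_true, if_false] at h1
  · left
    rw [norm_inv, Real.log_inv] at h1
    exact (Real.log_lt_log_iff hpos hε).1 (by linarith)
  · right
    rw [one_div]
    exact (Real.log_lt_log_iff (inv_pos.2 hε) hpos).1 (by rwa [Real.log_inv])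

lemma orbitSet_subset_littleEscapingSet (hm : MapsTo f {0}ᶜ {0}ᶜ)
    (ha : ∀ n : ℕ, (n : ℝ) + 1 ≤ a n) :
    orbitSet f s a ⊆ littleEscapingSet f fun n => s (n + 1) := by
  refine fun z hz => ⟨orbitSet_subset_escapingSet ha hz, 1, 0, fun n => ?_⟩
  have h0 : 0 < endLevel (s (n + 1)) (f^[n + 1] z) := by
    have h1 := ha (n + 1)
    have h2 := hz.2 (n + 1)
    have h3 : (0 : ℝ) ≤ (n + 1 : ℕ) := Nat.cast_nonneg _
    linarith
  rw [endLevel_pos_iff (hm.iterate (n + 1) hz.1)] at h0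
  cases hs : s (n + 1) <;> simp only [hs, if_true, Bool.false_eq_true, if_false] at h0
  · simpa [hs] using h0.le
  · simpa [hs] using h0

end Dynamics

namespace IsTranscendentalSelfMapCStar

variable {f : ℂ → ℂ}

lemma mapsTo (hf : IsTranscendentalSelfMapCStar f) : MapsTo f {0}ᶜ {0}ᶜ :=
  fun _ hz => hf.ne_zero hz

lemma endFlip_comp_comp (hf : IsTranscendentalSelfMapCStar f) (b b' : Bool) :
    IsTranscendentalSelfMapCStar fun z => endFlip b' (f (endFlip b z)) := by
  cases b <;> cases b'
  exacts [hf.comp_inv.inv, hf.comp_inv, hf.inv, hf]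

lemma exists_endLevel_step_of_ends (hf : IsTranscendentalSelfMapCStar f) (b b' : Bool) :
    ∃ T : ℝ, ∀ t ≥ T, ∃ t₁ ≥ t + 1,
      (∀ z, z ≠ 0 → endLevel b z = t - 16 → endLevel b' (f z) < t₁ - 16) ∧
      ∀ w, w ≠ 0 → |endLevel b' w - t₁| ≤ 16 →
        ∃ z, z ≠ 0 ∧ |endLevel b z - t| ≤ 16 ∧ f z = w := by
  obtain ⟨T, hT⟩ := (hf.endFlip_comp_comp b b').exists_step
  refine ⟨T, fun t ht => ?_⟩
  obtain ⟨t₁, ht₁, hlow, hcov⟩ := hT t ht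
  refine ⟨t₁, ht₁, fun z hz hzt => ?_, fun w hw hwt => ?_⟩
  · simpa [endLevel] using hlow (endFlip b z) (endFlip_ne_zero hz) hzt
  · obtain ⟨z, hz, hzt, hzw⟩ := hcov (endFlip b' w) (endFlip_ne_zero hw) hwt
    refine ⟨endFlip b z, endFlip_ne_zero hz, by simpa [endLevel] using hzt, ?_⟩
    rw [← endFlip_endFlip b' (f (endFlip b z)), hzw, endFlip_endFlip]

lemma exists_endLevel_step (hf : IsTranscendentalSelfMapCStar f) :
    ∃ T : ℝ, ∀ b b' : Bool, ∀ t ≥ T, ∃ t₁ ≥ t + 1,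
      (∀ z, z ≠ 0 → endLevel b z = t - 16 → endLevel b' (f z) < t₁ - 16) ∧
      ∀ w, w ≠ 0 → |endLevel b' w - t₁| ≤ 16 →
        ∃ z, z ≠ 0 ∧ |endLevel b z - t| ≤ 16 ∧ f z = w := by
  choose T hT using hf.exists_endLevel_step_of_ends
  obtain ⟨B, hB⟩ := (Set.finite_range fun p : Bool × Bool => T p.1 p.2).bddAbove
  exact ⟨B, fun b b' t ht => hT b b' t ((hB ⟨(b, b'), rfl⟩).trans ht)⟩

/-- Every sequence of ends is followed by an orbit set with heights tending to infinity. -/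
lemma exists_orbitSet_nonempty (hf : IsTranscendentalSelfMapCStar f) (s : ℕ → Bool) :
    ∃ a : ℕ → ℝ, (∀ n : ℕ, (n : ℝ) + 1 ≤ a n) ∧
      (∀ n z, z ≠ 0 → endLevel (s n) z = a n → endLevel (s (n + 1)) (f z) < a (n + 1)) ∧
      (orbitSet f s a).Nonempty := by
  obtain ⟨T, hT⟩ := hf.exists_endLevel_step
  choose! next hnext hlow hcov using hT
  let τ : ℕ → ℝ := Nat.rec (max T 17) fun n t => next (s n) (s (n + 1)) t
  have hτ : ∀ n, T ≤ τ n := fun n => by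
    induction n with
    | zero => exact le_max_left _ _
    | succ n ih => linarith [show τ (n + 1) ≥ τ n + 1 from hnext _ _ _ ih]
  have hτn : ∀ n : ℕ, (n : ℝ) + 17 ≤ τ n := fun n => by
    induction n with
    | zero =>
      rw [Nat.cast_zero, zero_add]
      exact le_max_right T 17
    | succ n ih =>
      push_cast
      linarith [show τ (n + 1) ≥ τ n + 1 from hnext _ _ _ (hτ n)]
  have hlift : ∀ n w, w ≠ 0 → |endLevel (s n) w - τ n| ≤ 16 →
      ∃ z, z ≠ 0 ∧ ∀ k ≤ n, |endLevel (s k) (f^[k] z) - τ k| ≤ 16 := by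
    suffices ∀ n w, w ≠ 0 → |endLevel (s n) w - τ n| ≤ 16 →
        ∃ z, z ≠ 0 ∧ f^[n] z = w ∧ ∀ k ≤ n, |endLevel (s k) (f^[k] z) - τ k| ≤ 16 from
      fun n w hw hwn => (this n w hw hwn).imp fun z hz => ⟨hz.1, hz.2.2⟩
    intro n
    induction n with
    | zero =>
      intro w hw hwn
      refine ⟨w, hw, rfl, fun k hk => ?_⟩
      obtain rfl := Nat.le_zero.1 hk
      exact hwn
    | succ n ih =>
      intro w hw hwn
      obtain ⟨y, hy, hyn, hyw⟩ := hcov _ _ _ (hτ n) w hw hwn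
      obtain ⟨z, hz, hzy, hzk⟩ := ih y hy hyn
      have hzw : f^[n + 1] z = w := by rw [Function.iterate_succ_apply', hzy, hyw]
      refine ⟨z, hz, hzw, fun k hk => ?_⟩
      rcases hk.eq_or_lt with rfl | hk
      · rwa [hzw]
      · exact hzk k (Nat.lt_succ_iff.1 hk)
  refine ⟨fun n => τ n - 16, fun n => by linarith [hτn n],
    fun n z hz hzn => hlow _ _ _ (hτ n) z hz hzn, ?_⟩
  refine (inter_orbitSet_nonempty hf.differentiableOn_s4 hf.mapsTo
    (isCompact_endLevel_mem_Icc (s 0) (τ 0 - 16) (τ 0 + 16)) (fun z hz => hz.1)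
    fun n => ?_).mono inter_subset_right
  obtain ⟨z, hz, hzk⟩ := hlift n (endFlip (s n) (Complex.exp (Complex.ofReal (τ n))))
    (endFlip_ne_zero (Complex.exp_ne_zero _)) (by simp [endLevel, Complex.norm_exp])
  have h0 := abs_le.1 (hzk 0 (Nat.zero_le n))
  refine ⟨z, ⟨hz, ?_, ?_⟩, fun k hk => by linarith [(abs_le.1 (hzk k hk)).1]⟩
  · linarith [h0.1, show endLevel (s 0) (f^[0] z) = endLevel (s 0) z from rfl]
  · linarith [h0.2, show endLevel (s 0) (f^[0] z) = endLevel (s 0) z from rfl]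

/-- The component of either end in the escaping set meets every little escaping set. -/
lemma connectedComponentIn_endPoint_inter_nonempty (hf : IsTranscendentalSelfMapCStar f)
    (b : Bool) (e : ℕ → Bool) :
    (connectedComponentIn (escapingSphere f) (endPoint b) ∩
      ((fun z : ℂ => (z : OnePoint ℂ)) '' littleEscapingSet f e)).Nonempty := by
  obtain ⟨a, ha, hlow, z, hz⟩ := hf.exists_orbitSet_nonempty fun n => Nat.casesOn n b e
  have hsub := (isPreconnected_insert_endPoint hf.differentiableOn_s4 hf.mapsTo
    (zero_lt_one.trans_le (by simpa using ha 0)) hlow).subset_connectedComponentIn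
    (F := escapingSphere f) (Set.mem_insert _ _) (Set.insert_subset
      (Or.inr (by cases b <;> simp [endPoint]))
      ((Set.image_mono (orbitSet_subset_escapingSet ha)).trans Set.subset_union_left))
  exact ⟨z, hsub (Or.inr ⟨z, hz, rfl⟩), z, orbitSet_subset_littleEscapingSet hf.mapsTo ha hz, rfl⟩

end IsTranscendentalSelfMapCStar

/-- If `I(f) ∪ {0,∞} ⊆ ℂ̂` is disconnected, so that it has exactly two
components `I⁰(f) ∋ 0` and `I^∞(f) ∋ ∞`, then for every `e ∈ {0,∞}^ℕ` both components
meet `I_e(f)`. -/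
theorem components_meet_littleEscapingSet (f : ℂ → ℂ)
    (hf : IsTranscendentalSelfMapCStar f)
    (hdisc : ¬ IsConnected (escapingSphere f)) :
    ∀ e : ℕ → Bool,
      (connectedComponentIn (escapingSphere f) ((0 : ℂ) : OnePoint ℂ) ∩
        ((fun z : ℂ => (z : OnePoint ℂ)) '' littleEscapingSet f e)).Nonempty ∧
      (connectedComponentIn (escapingSphere f) ∞ ∩
        ((fun z : ℂ => (z : OnePoint ℂ)) '' littleEscapingSet f e)).Nonempty := by
  exact fun e => ⟨hf.connectedComponentIn_endPoint_inter_nonempty false e,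
    hf.connectedComponentIn_endPoint_inter_nonempty true e⟩
end
end
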